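/- arXiv:2403.08595 — 2 statements merged into one kernel-verified Lean document; each statement's English description precedes it below -/
import Mathlib

section
/- Let D be a division ring whose center F contains at least four elements, let n be a positive integer, let G be a non-central subnormal subgroup of GL_n(D), and let ⋆ be an involution of the first kind on M_n(D). Then g·g^⋆ lies in the center of M_n(D) for every g ∈ G if and only if ⋆ is commuting, i.e., x·x^⋆ = x^⋆·x for every x ∈ M_n(D). -/
/-- A subgroup `G` of a group `Γ` is subnormal if there is a finite chain of
subgroups `G = G_r ⊴ G_{r-1} ⊴ ⋯ ⊴ G_0 = Γ` in which each term is a normal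
subgroup of the next. -/
def Subgroup.IsSubnormal' {Γ : Type*} [Group Γ] (G : Subgroup Γ) : Prop :=
  ∃ (r : ℕ) (c : Fin (r + 1) → Subgroup Γ), c 0 = G ∧ c (Fin.last r) = ⊤ ∧
    ∀ i : Fin r, c i.castSucc ≤ c i.succ ∧
      ∀ h ∈ c i.castSucc, ∀ g ∈ c i.succ, g * h * g⁻¹ ∈ c i.castSucc

/-- `G` is subnormal of depth at most `r`, described recursively from the top. -/
def SubnormalDepth {Γ : Type*} [Group Γ] : ℕ → Subgroup Γ → Prop
  | 0, G => G = ⊤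
  | r + 1, G => ∃ H : Subgroup Γ, SubnormalDepth r H ∧ G ≤ H ∧
      ∀ h ∈ G, ∀ g ∈ H, g * h * g⁻¹ ∈ G

theorem Subgroup.IsSubnormal'.exists_depth {Γ : Type*} [Group Γ] {G : Subgroup Γ}
    (h : G.IsSubnormal') : ∃ r, SubnormalDepth r G := by
  obtain ⟨r, c, h0, hl, hc⟩ := h
  refine ⟨r, ?_⟩
  induction r generalizing G with
  | zero => exact h0 ▸ hl
  | succ r ih =>
    refine ⟨c 1, ih (fun i => c i.succ) rfl (by simpa using hl) (fun i => ?_), ?_, ?_⟩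
    · have := hc i.succ
      rwa [Fin.castSucc_succ] at this
    · have := (hc 0).1
      simpa [h0] using this
    · have := (hc 0).2
      simpa [h0] using this

theorem SubnormalDepth.comap {Γ Γ' : Type*} [Group Γ] [Group Γ'] (f : Γ' →* Γ) {r : ℕ}
    {G : Subgroup Γ} (h : SubnormalDepth r G) : SubnormalDepth r (G.comap f) := by
  induction r generalizing G with
  | zero =>
    obtain rfl : G = ⊤ := h
    exact Subgroup.comap_top f
  | succ r ih =>
    obtain ⟨H, hH, hle, hn⟩ := h
    refine ⟨H.comap f, ih hH, Subgroup.comap_mono hle, fun h hh g hg => ?_⟩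
    simpa using hn _ hh _ hg

/-- Non-central subnormal subgroups have central centralizer. -/
def CentralizersCentral (Γ : Type*) [Group Γ] : Prop :=
  ∀ (r : ℕ) (G : Subgroup Γ), SubnormalDepth r G → ¬ G ≤ Subgroup.center Γ →
    ∀ s : Γ, (∀ g ∈ G, s * g = g * s) → s ∈ Subgroup.center Γ

/-- The elements of `G` commuting with `s`. -/
def commutingSubgroup {Γ : Type*} [Group Γ] (G : Subgroup Γ) (s : Γ) : Subgroup Γ :=
  G ⊓ Subgroup.centralizer {s}

theorem mem_commutingSubgroup {Γ : Type*} [Group Γ] {G : Subgroup Γ} {s g : Γ} :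
    g ∈ commutingSubgroup G s ↔ g ∈ G ∧ s * g = g * s := by
  simp [commutingSubgroup, Subgroup.mem_centralizer_singleton_iff, eq_comm]

theorem commutator_central_conj {Γ : Type*} [Group Γ] {s g h : Γ}
    (hh : s * h * s⁻¹ * h⁻¹ ∈ Subgroup.center Γ) (hg : s * g = g * s) :
    s * (h * g * h⁻¹) = h * g * h⁻¹ * s := by
  obtain ⟨z, hz⟩ : ∃ z, z = s * h * s⁻¹ * h⁻¹ := ⟨_, rfl⟩
  rw [← hz, Subgroup.mem_center_iff] at hh
  have h1 : s * h = z * h * s := by rw [hz]; group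
  have h2 : s * h⁻¹ = z⁻¹ * h⁻¹ * s := by
    have : h * s = z⁻¹ * (s * h) := by rw [h1]; group
    have h3 : s * h⁻¹ = h⁻¹ * (z⁻¹ * (s * h)) * h⁻¹ := by rw [← this]; group
    have h4 : h⁻¹ * z⁻¹ = z⁻¹ * h⁻¹ := by
      have := congrArg (·⁻¹) (hh h)
      simpa using this.symm
    rw [h3, ← mul_assoc, h4]; group
  have h5 : h * g * z⁻¹ = z⁻¹ * (h * g) := by
    rw [mul_inv_eq_iff_eq_mul, mul_assoc, hh, inv_mul_cancel_left]
  calc s * (h * g * h⁻¹) = (s * h) * g * h⁻¹ := by group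
    _ = z * h * (s * g) * h⁻¹ := by rw [h1]; group
    _ = z * h * g * (s * h⁻¹) := by rw [hg]; group
    _ = z * (h * g * z⁻¹) * h⁻¹ * s := by rw [h2]; group
    _ = h * g * h⁻¹ * s := by rw [h5]; group

theorem SubnormalDepth.commutingSubgroup {Γ : Type*} [Group Γ] {r : ℕ} {G : Subgroup Γ}
    (hG : SubnormalDepth r G) {s : Γ}
    (hs : ∀ g ∈ G, s * g * s⁻¹ * g⁻¹ ∈ Subgroup.center Γ) :
    SubnormalDepth (r + 1) (commutingSubgroup G s) := by
  refine ⟨G, hG, inf_le_left, fun g hg h hh => ?_⟩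
  rw [mem_commutingSubgroup] at hg ⊢
  exact ⟨G.mul_mem (G.mul_mem hh hg.1) (G.inv_mem hh), commutator_central_conj (hs h hh) hg.2⟩

theorem CentralizersCentral.of_commutators_central {Γ : Type*} [Group Γ]
    (hΓ : CentralizersCentral Γ) {r : ℕ} {G : Subgroup Γ} (hG : SubnormalDepth r G)
    (hnc : ¬ G ≤ Subgroup.center Γ) {s : Γ}
    (hs : ∀ g ∈ G, s * g * s⁻¹ * g⁻¹ ∈ Subgroup.center Γ) : s ∈ Subgroup.center Γ := by
  by_cases h1 : commutingSubgroup G s ≤ Subgroup.center Γ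
  · obtain ⟨b, hb, hbc⟩ := Set.not_subset.1 hnc
    refine absurd ?_ hbc
    have hb' : ∀ g ∈ G, b * g * b⁻¹ * g⁻¹ ∈ Subgroup.center Γ := by
      intro g hg
      apply h1
      rw [mem_commutingSubgroup]
      refine ⟨G.mul_mem (G.mul_mem (G.mul_mem hb hg) (G.inv_mem hb)) (G.inv_mem hg), ?_⟩
      have key : ∀ x ∈ G, ∃ z, (∀ y, y * z = z * y) ∧ s * x * s⁻¹ = z * x := by
        intro x hx
        exact ⟨_, Subgroup.mem_center_iff.1 (hs x hx), by group⟩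
      obtain ⟨z, hz, hz'⟩ := key b hb
      obtain ⟨y, hy, hy'⟩ := key g hg
      rw [← mul_inv_eq_iff_eq_mul]
      have hzi : ∀ x, x * z⁻¹ = z⁻¹ * x := fun x => by
        rw [mul_inv_eq_iff_eq_mul, mul_assoc, hz x, inv_mul_cancel_left]
      have hyi : ∀ x, x * y⁻¹ = y⁻¹ * x := fun x => by
        rw [mul_inv_eq_iff_eq_mul, mul_assoc, hy x, inv_mul_cancel_left]
      calc s * (b * g * b⁻¹ * g⁻¹) * s⁻¹
          = (s * b * s⁻¹) * (s * g * s⁻¹) * (s * b * s⁻¹)⁻¹ * (s * g * s⁻¹)⁻¹ := by group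
        _ = (z * (b * y)) * g * (b⁻¹ * z⁻¹) * (g⁻¹ * y⁻¹) := by rw [hz', hy']; group
        _ = b * g * b⁻¹ * g⁻¹ := by
          rw [hy b, hzi, hyi, ← hz (y * b)]
          have e1 : y * b * z * g * (z⁻¹ * b⁻¹) * (y⁻¹ * g⁻¹)
            = y * b * (z * g * z⁻¹) * b⁻¹ * y⁻¹ * g⁻¹ := by group
          have e2 : z * g * z⁻¹ = g := by rw [← hz g]; group
          have e3 : y * b * g * b⁻¹ * y⁻¹ * g⁻¹ = (y * (b * g * b⁻¹) * y⁻¹) * g⁻¹ := by group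
          rw [e1, e2, e3, ← hy]; group
    refine hΓ _ _ (hG.commutingSubgroup hb') (fun h => hbc (h ?_)) b
      (fun g hg => (mem_commutingSubgroup.1 hg).2)
    exact mem_commutingSubgroup.2 ⟨hb, rfl⟩
  · exact hΓ _ _ (hG.commutingSubgroup hs) h1 s (fun g hg => (mem_commutingSubgroup.1 hg).2)

theorem CentralizersCentral.congr {Γ Γ' : Type*} [Group Γ] [Group Γ'] (e : Γ ≃* Γ')
    (h : CentralizersCentral Γ') : CentralizersCentral Γ := by
  intro r G hG hnc s hs
  have hc : ∀ x, e x ∈ Subgroup.center Γ' → x ∈ Subgroup.center Γ := by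
    intro x hx
    rw [Subgroup.mem_center_iff] at hx ⊢
    intro g
    apply e.injective
    simpa using hx (e g)
  apply hc
  refine h r _ (hG.comap e.symm.toMonoidHom) (fun hle => hnc fun g hg => hc _ (hle ?_)) _ ?_
  · simpa using hg
  · intro g hg
    have := hs _ hg
    simpa using congrArg e this

theorem IsSimpleRing.eq_zero_of_mul_mul_eq_zero {R : Type*} [Ring R] [IsSimpleRing R] {a b : R}
    (h : ∀ w, a * w * b = 0) (hb : b ≠ 0) : a = 0 := by
  let I : TwoSidedIdeal R := TwoSidedIdeal.mk' {p | ∀ w, a * w * p = 0} (by simp)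
    (fun hx hy w => by rw [mul_add, hx w, hy w, add_zero])
    (fun hx w => by rw [mul_neg, hx w, neg_zero])
    (fun {x y} hy w => by rw [← mul_assoc, mul_assoc a, hy])
    (fun {x y} hx w => by rw [← mul_assoc, hx, zero_mul])
  have h1 : b ∈ I := by rw [TwoSidedIdeal.mem_mk']; exact h
  have h2 := IsSimpleRing.one_mem_of_ne_zero_mem I hb h1
  rw [TwoSidedIdeal.mem_mk'] at h2
  simpa using h2 1

theorem IsSimpleRing.eq_zero_of_central_mul_eq_zero {R : Type*} [Ring R] [IsSimpleRing R] {a b : R}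
    (ha : a ∈ Subring.center R) (h : a * b = 0) (hb : b ≠ 0) : a = 0 :=
  eq_zero_of_mul_mul_eq_zero
    (fun w => by rw [← Subring.mem_center_iff.1 ha w, mul_assoc, h, mul_zero]) hb

section CommutingInvolution

variable {R : Type*} [Ring R] {σ : R → R}

theorem commutator_sigma_symm (hadd : ∀ x y, σ (x + y) = σ x + σ y)
    (hcomm : ∀ x, x * σ x = σ x * x) (x y : R) : x * σ y - σ y * x = σ x * y - y * σ x := by
  have h := hcomm (x + y)
  rw [hadd, add_mul, mul_add, mul_add, add_mul, mul_add, mul_add, hcomm x, hcomm y] at h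
  rw [← sub_eq_zero] at h ⊢
  rw [← h]
  noncomm_ring

variable [IsSimpleRing R]

theorem exists_central_commutator_factor (hadd : ∀ x y, σ (x + y) = σ x + σ y)
    (hcomm : ∀ x, x * σ x = σ x * x) (hnc : ∃ u v : R, u * v - v * u ≠ 0) :
    ∃ c ∈ Subring.center R, ∀ x y, σ x * y - y * σ x = (x * y - y * x) * c := by
  obtain ⟨B, hB⟩ : ∃ B : R → R → R, ∀ x y, B x y = σ x * y - y * σ x := ⟨_, fun _ _ => rfl⟩
  have hB' : ∀ x y, B x y = x * σ y - σ y * x := fun x y => by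
    rw [hB, commutator_sigma_symm hadd hcomm]
  have hr : ∀ x y v, B x (y * v) = y * B x v + B x y * v := fun x y v => by
    simp only [hB]; noncomm_ring
  have hl : ∀ x u y, B (x * u) y = x * B u y + B x y * u := fun x u y => by
    simp only [hB']; noncomm_ring
  have h0 : ∀ x y u v, (x * y - y * x) * B u v = B x y * (u * v - v * u) := by
    intro x y u v
    have h1 : B (x * u) (y * v) = x * (y * B u v + B u y * v) + (y * B x v + B x y * v) * u := by
      rw [hl, hr, hr]
    have h2 : B (x * u) (y * v) = y * (x * B u v + B x v * u) + (x * B u y + B x y * u) * v := by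
      rw [hr, hl, hl]
    rw [h1] at h2
    rw [← sub_eq_zero] at h2 ⊢
    rw [← h2]
    noncomm_ring
  have h1 : ∀ x y z u v, (x * y - y * x) * z * B u v = B x y * z * (u * v - v * u) := by
    intro x y z u v
    have h2 := h0 x y (z * u) v
    have h3 := h0 x y z v
    rw [hl, mul_add, ← mul_assoc, ← mul_assoc, h3] at h2
    rw [← sub_eq_zero] at h2 ⊢
    rw [← h2]
    noncomm_ring
  let I : TwoSidedIdeal R :=
    TwoSidedIdeal.mk' {p | ∃ q, ∀ x y z, B x y * z * p = (x * y - y * x) * z * q}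
    ⟨0, by simp⟩
    (fun {p p'} hx hy => by
      obtain ⟨q, hq⟩ := hx
      obtain ⟨q', hq'⟩ := hy
      exact ⟨q + q', fun x y z => by rw [mul_add, hq, hq', mul_add]⟩)
    (fun {p} hx => by
      obtain ⟨q, hq⟩ := hx
      exact ⟨-q, fun x y z => by rw [mul_neg, hq, mul_neg]⟩)
    (fun {s p} hx => by
      obtain ⟨q, hq⟩ := hx
      exact ⟨s * q, fun x y z => by rw [← mul_assoc, mul_assoc _ z, hq]; noncomm_ring⟩)
    (fun {p s} hx => by
      obtain ⟨q, hq⟩ := hx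
      exact ⟨q * s, fun x y z => by rw [← mul_assoc, hq]; noncomm_ring⟩)
  obtain ⟨u, v, huv⟩ := hnc
  have hI : u * v - v * u ∈ I := by
    rw [TwoSidedIdeal.mem_mk']
    exact ⟨B u v, fun x y z => (h1 x y z u v).symm⟩
  have h2 := IsSimpleRing.one_mem_of_ne_zero_mem I huv hI
  rw [TwoSidedIdeal.mem_mk'] at h2
  obtain ⟨c, hc⟩ := h2
  simp only [mul_one] at hc
  have hc1 : ∀ x y, B x y = (x * y - y * x) * c := fun x y => by simpa using hc x y 1
  refine ⟨c, ?_, fun x y => by rw [← hB, hc1]⟩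
  rw [Subring.mem_center_iff]
  intro z
  by_contra hz
  refine huv (IsSimpleRing.eq_zero_of_mul_mul_eq_zero (b := z * c - c * z) (fun w => ?_)
    (sub_ne_zero.2 hz))
  have h3 : ∀ x y z, (x * y - y * x) * c * z = (x * y - y * x) * z * c := fun x y z => by
    rw [← hc1, hc]
  have h4 := h3 (u * w) v z
  have h5 := h3 w v z
  have h6 : u * ((w * v - v * w) * c * z) - u * ((w * v - v * w) * z * c) = 0 := by
    rw [h5, sub_self]
  rw [← sub_eq_zero] at h4
  have : (u * v - v * u) * w * (z * c - c * z) = 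
    (u * ((w * v - v * w) * c * z) - u * ((w * v - v * w) * z * c))
    - ((u * w * v - v * (u * w)) * c * z - (u * w * v - v * (u * w)) * z * c) := by noncomm_ring
  rw [this, h6, h4, sub_zero]

theorem norm_central_of_commuting (hadd : ∀ x y, σ (x + y) = σ x + σ y)
    (hmul : ∀ x y, σ (x * y) = σ y * σ x) (hinvo : ∀ x, σ (σ x) = x)
    (hfirst : ∀ x ∈ Subring.center R, σ x = x)
    (hcomm : ∀ x, x * σ x = σ x * x) (x : R) : x * σ x ∈ Subring.center R := by
  by_cases hnc : ∃ u v : R, u * v - v * u ≠ 0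
  swap
  · push Not at hnc
    exact Subring.mem_center_iff.2 fun g => sub_eq_zero.1 (hnc _ _)
  obtain ⟨c, hc, hcc⟩ := exists_central_commutator_factor hadd hcomm hnc
  have hc' := Subring.mem_center_iff.1 hc
  have h1 : ∀ x, σ x - c * x ∈ Subring.center R := by
    intro x
    rw [Subring.mem_center_iff]
    intro y
    have := hcc x y
    rw [hc'] at this
    rw [← sub_eq_zero] at this ⊢
    have e : y * (σ x - c * x) - (σ x - c * x) * y
      = -(σ x * y - y * σ x - c * (x * y - y * x)) - (y * c - c * y) * x := by noncomm_ring
    rw [e, this, hc', sub_self]; simp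
  have hσ0 : σ 0 = 0 := by simpa using hadd 0 0
  have hneg : ∀ x, σ (-x) = - σ x := fun x => by
    have := hadd x (-x)
    rw [add_neg_cancel, hσ0] at this
    exact (neg_eq_of_add_eq_zero_right this.symm).symm
  have h2 : ∀ x, (1 + c) * (x - σ x) = 0 := by
    intro x
    have := hfirst _ (h1 x)
    rw [sub_eq_add_neg, hadd, hneg, hmul, hinvo, hfirst c hc, hc'] at this
    rw [← sub_eq_zero] at this
    rw [← this]; noncomm_ring
  have hc1 : 1 + c = 0 := by
    by_contra hne
    have hid : ∀ x, σ x = x := by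
      intro x
      by_contra hx
      exact hne (IsSimpleRing.eq_zero_of_central_mul_eq_zero
        (add_mem (one_mem _) hc) (h2 x) (sub_ne_zero.2 (Ne.symm hx)))
    obtain ⟨u, v, huv⟩ := hnc
    apply huv
    have := hmul u v
    rw [hid, hid, hid] at this
    exact sub_eq_zero.2 this
  obtain rfl : c = -1 := (neg_eq_of_add_eq_zero_right hc1).symm
  obtain ⟨t, ht⟩ : ∃ t : R → R, ∀ x, t x = σ x + x := ⟨_, fun _ => rfl⟩
  have htc : ∀ x y, y * t x = t x * y := fun x => by
    have := Subring.mem_center_iff.1 (h1 x)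
    simpa [ht] using this
  have hσ : ∀ x, σ x = t x - x := fun x => by simp [ht]
  rw [Subring.mem_center_iff]
  intro y
  have e1 := hmul x y
  rw [hσ, hσ, hσ] at e1
  have e2 : x * y + y * x = t (x * y) - t y * t x + t y * x + t x * y := by
    have h3 := htc x y
    rw [← sub_eq_zero] at e1 h3 ⊢
    have : x * y + y * x - (t (x * y) - t y * t x + t y * x + t x * y)
      = -(t (x * y) - x * y - (t y - y) * (t x - x)) + (y * t x - t x * y) := by noncomm_ring
    rw [this, e1, h3]; simp
  have e3 : x * (x * y + y * x) - (x * y + y * x) * x = t x * (x * y - y * x) := by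
    rw [e2]
    have a1 := htc (x * y) x
    have a2 := htc y x
    have a3 := htc x x
    have a4 := htc y (t x * x)
    rw [← sub_eq_zero] at a1 a2 a3
    have : x * (t (x * y) - t y * t x + t y * x + t x * y) -
      (t (x * y) - t y * t x + t y * x + t x * y) * x - t x * (x * y - y * x)
      = (x * t (x * y) - t (x * y) * x) - (x * t y - t y * x) * t x 
        - t y * (x * t x - t x * x) 
        + (x * t y - t y * x) * x + (x * t x - t x * x) * y := by noncomm_ring
    rw [← sub_eq_zero, this, a1, a2, a3]; simp
  rw [hσ]
  have a1 := htc x y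
  have a3 := htc x x
  rw [← sub_eq_zero] at a1 e3 a3 ⊢
  have : y * (x * (t x - x)) - x * (t x - x) * y =
    (x * (x * y + y * x) - (x * y + y * x) * x - t x * (x * y - y * x)) + 
     y * (x * t x - t x * x) - (x * t x - t x * x) * y + (y * t x - t x * y) * x := by noncomm_ring
  rw [this, e3, a1, a3]; simp

theorem sigma_eq_neg_of_sq_eq_zero (hadd : ∀ x y, σ (x + y) = σ x + σ y)
    (hmul : ∀ x y, σ (x * y) = σ y * σ x) (hσ1 : σ 1 = 1)
    (hunit : ∀ g : Rˣ, g.val * σ g.val ∈ Subring.center R) {t : R} (ht : t * t = 0) :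
    σ t = -t := by
  have hσ0 : σ 0 = 0 := by simpa using hadd 0 0
  by_cases ht0 : t = 0
  · simp [ht0, hσ0]
  let g : Rˣ := ⟨1 + t, 1 - t, by noncomm_ring [ht], by noncomm_ring [ht]⟩
  obtain ⟨c, hc⟩ : ∃ c, c = (1 + t) * (1 + σ t) := ⟨_, rfl⟩
  have hcc : c ∈ Subring.center R := by
    have := hunit g
    simp only [g, hadd, hσ1] at this
    rwa [hc]
  have hct := Subring.mem_center_iff.1 hcc
  have h1 : σ t = c - 1 - c * t := by
    have : (1 - t) * c = 1 + σ t := by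
      rw [hc, ← mul_assoc]
      have : (1 - t) * (1 + t) = 1 := g.inv_mul
      rw [this, one_mul]
    rw [sub_mul, one_mul, hct] at this
    rw [sub_right_comm, this]; simp
  have h2 : σ t * σ t = 0 := by rw [← hmul, ht, hσ0]
  have h3 : (c - 1) * ((c - 1) * t) = 0 := by
    have : σ t * σ t * t = (c - 1) * ((c - 1) * t) := by
      rw [h1]
      have e : t * c = c * t := hct t
      have : (c - 1 - c * t) * (c - 1 - c * t) * t = (c - 1) * ((c - 1) * t)
        - (c - 1) * c * (t * t) - c * (t * c) * t + c * (t * t) + c * (t * c) * (t * t) := by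
          noncomm_ring
      rw [this, e, ht, mul_assoc c (c * t) t, mul_assoc c t t, ht]
      simp
    rw [← this, h2, zero_mul]
  have hc1 : c - 1 ∈ Subring.center R := sub_mem hcc (one_mem _)
  have h4 : c - 1 = 0 := by
    by_contra hne
    exact hne (IsSimpleRing.eq_zero_of_central_mul_eq_zero hc1 h3
      (fun h => hne (IsSimpleRing.eq_zero_of_central_mul_eq_zero hc1 h ht0)))
  rw [h1, h4, sub_eq_zero.1 h4]; simp

end CommutingInvolution

theorem Matrix.commuting_of_units_norm_central {D : Type*} [DivisionRing D] {n : ℕ} (hn : 0 < n)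
    {σ : Matrix (Fin n) (Fin n) D → Matrix (Fin n) (Fin n) D}
    (hadd : ∀ x y, σ (x + y) = σ x + σ y)
    (hmul : ∀ x y, σ (x * y) = σ y * σ x) (hσ1 : σ 1 = 1)
    (hunit : ∀ g : (Matrix (Fin n) (Fin n) D)ˣ,
      g.val * σ g.val ∈ Subring.center (Matrix (Fin n) (Fin n) D))
    (x : Matrix (Fin n) (Fin n) D) : x * σ x = σ x * x := by
  have hσ0 : σ 0 = 0 := by simpa using hadd 0 0
  have : Nonempty (Fin n) := ⟨⟨0, hn⟩⟩
  have hoff : ∀ i j a, i ≠ j → σ (single i j a) = - single i j a := by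
    intro i j a hij
    apply sigma_eq_neg_of_sq_eq_zero hadd hmul hσ1 hunit
    simp [hij.symm]
  have hdiag : ∀ i j a, i ≠ j → σ (single i i a) = single j j a := by
    intro i j a hij
    have : single i i a = single i j a * single j i 1 := by simp
    rw [this, hmul, hoff _ _ _ hij, hoff _ _ _ hij.symm]
    simp
  obtain h1 | h2 | h3 : n = 1 ∨ n = 2 ∨ 3 ≤ n := by omega
  · subst h1
    by_cases hx : x 0 0 = 0
    · have : x = 0 := by ext i j; fin_cases i; fin_cases j; exact hx
      simp [this, hσ0]
    · have hu : x * !![(x 0 0)⁻¹] = 1 := by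
        ext i j; fin_cases i; fin_cases j; simp [Matrix.mul_apply, hx]
      have hu' : !![(x 0 0)⁻¹] * x = 1 := by
        ext i j; fin_cases i; fin_cases j; simp [Matrix.mul_apply, hx]
      have := Subring.mem_center_iff.1 (hunit ⟨x, _, hu, hu'⟩) x
      have h4 := congrArg (!![(x 0 0)⁻¹] * ·) this
      simp only [← mul_assoc, hu', one_mul] at h4
      exact h4
  · subst h2
    have hcomm : ∀ a b : D, a * b = b * a := by
      intro a b
      have h4 := hmul (single 0 0 a) (single 0 0 b)
      rw [single_mul_single_same, hdiag 0 1 _ (by decide), hdiag 0 1 _ (by decide),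
        hdiag 0 1 _ (by decide), single_mul_single_same] at h4
      simpa using congrFun (congrFun h4 1) 1
    have hx : x = single 0 0 (x 0 0) + single 0 1 (x 0 1) + single 1 0 (x 1 0)
      + single 1 1 (x 1 1) := by
      ext i j; fin_cases i <;> fin_cases j <;> simp [single]
    have hσx : σ x = single 1 1 (x 0 0) - single 0 1 (x 0 1) - single 1 0 (x 1 0)
      + single 0 0 (x 1 1) := by
      conv_lhs => rw [hx]
      rw [hadd, hadd, hadd, hdiag 0 1 _ (by decide), hdiag 1 0 _ (by decide),
        hoff _ _ _ (by decide), hoff _ _ _ (by decide)]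
      abel
    ext i j
    have h1 := hcomm (x 0 0) (x 1 1)
    have h2 := hcomm (x 0 1) (x 1 0)
    have h3 := hcomm (x 0 0) (x 0 1)
    have h4 := hcomm (x 0 0) (x 1 0)
    have h5 := hcomm (x 1 1) (x 0 1)
    have h6 := hcomm (x 1 1) (x 1 0)
    fin_cases i <;> fin_cases j <;>
      simp [hσx, Matrix.mul_apply, single, h1, h2, h3, h4, h5, h6]
  · have h4 := hdiag ⟨0, by omega⟩ ⟨1, by omega⟩ 1 (by simp)
    rw [hdiag ⟨0, by omega⟩ ⟨2, by omega⟩ 1 (by simp)] at h4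
    have := congrFun (congrFun h4 ⟨1, by omega⟩) ⟨1, by omega⟩
    simp at this

section SquareZero

variable {R : Type*} [Ring R]

/-- The unit `1 + t` for an element `t` of square zero. -/
def sqZeroUnit (t : R) (ht : t * t = 0) : Rˣ where
  val := 1 + t
  inv := 1 - t
  val_inv := by noncomm_ring [ht]
  inv_val := by noncomm_ring [ht]

theorem commutator_sqZeroUnit {p e : R} (hp : p * p = 0) (he : e * e = 0) (h : e * p = 0) :
    ((sqZeroUnit p hp * sqZeroUnit e he * (sqZeroUnit p hp)⁻¹ * (sqZeroUnit e he)⁻¹ : Rˣ) : R)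
      = 1 + p * e := by
  change (1 + p) * (1 + e) * (1 - p) * (1 - e) = _
  have : (1 + p) * (1 + e) * (1 - p) * (1 - e) = 1 + p * e - p * p + p * p * e - e * p - e * e
    + (e * p) * e - p * (e * p) - p * (e * e) + p * (e * p) * e := by noncomm_ring
  rw [this, hp, he, h]
  simp

theorem commutator_conj_sqZeroUnit (g : Rˣ) {e z : R} (he : e * e = 0) (hz : z * z = 0)
    (hez : e * z = 0) (hze : z * e = 0) (hgz : e * (↑g⁻¹ * z) = 0) :
    let h := g * sqZeroUnit e he * g⁻¹ * (sqZeroUnit e he)⁻¹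
    ((h * sqZeroUnit z hz * h⁻¹ * (sqZeroUnit z hz)⁻¹ : Rˣ) : R) = 1 - z * (g * e * ↑g⁻¹) := by
  intro h
  obtain ⟨t, ht⟩ : ∃ t : R, t = g * e * ↑g⁻¹ := ⟨_, rfl⟩
  have htz : t * z = 0 := by rw [ht, mul_assoc, mul_assoc, hgz, mul_zero]
  have h1 : (h : R) = (1 + t) * (1 - e) := by
    change g * (1 + e) * ↑g⁻¹ * (1 - e) = _
    rw [mul_add, add_mul, mul_one, Units.mul_inv, ht]
  have h2 : ((h⁻¹ : Rˣ) : R) = (1 + e) * (1 - t) := by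
    have : h⁻¹ = sqZeroUnit e he * (g * (sqZeroUnit e he)⁻¹ * g⁻¹) := by simp only [h]; group
    rw [this]
    change (1 + e) * (g * (1 - e) * ↑g⁻¹) = _
    rw [mul_sub, sub_mul, mul_one, Units.mul_inv, ht]
  have h3 : (h : R) * z = z := by
    rw [h1, mul_assoc, sub_mul, hez, one_mul, sub_zero, add_mul, one_mul, htz, add_zero]
  have h4 : z * ((h⁻¹ : Rˣ) : R) = z - z * t := by
    rw [h2, ← mul_assoc, mul_add, hze, mul_one, add_zero, mul_sub, mul_one]
  push_cast
  change h * (1 + z) * ↑h⁻¹ * (1 - z) = _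
  have h5 : (h : R) * (1 + z) * ↑h⁻¹ = 1 + z - z * t := by
    rw [mul_add, add_mul, mul_one, Units.mul_inv, h3, h4]; abel
  rw [h5, ← ht]
  have : (1 + z - z * t) * (1 - z) = 1 - z * t - z * z + z * (t * z) := by noncomm_ring
  rw [this, hz, htz]; simp

end SquareZero

theorem Subgroup.commutator_mem_of_normalizer {Γ : Type*} [Group Γ] {K : Subgroup Γ} {k g : Γ}
    (hk : k ∈ K) (hg : g ∈ Subgroup.normalizer (K : Set Γ)) : k * g * k⁻¹ * g⁻¹ ∈ K := by
  have := (Subgroup.mem_normalizer_iff.1 hg k⁻¹).1 (K.inv_mem hk)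
  have h2 := K.mul_mem hk this
  simpa [mul_assoc] using h2

theorem Subgroup.commutator_mem_of_normalizer' {Γ : Type*} [Group Γ] {K : Subgroup Γ} {k g : Γ}
    (hk : k ∈ K) (hg : g ∈ Subgroup.normalizer (K : Set Γ)) : g * k * g⁻¹ * k⁻¹ ∈ K :=
  K.mul_mem ((Subgroup.mem_normalizer_iff.1 hg k).1 hk) (K.inv_mem hk)

theorem Subgroup.conj_mem_of_normalizer {Γ : Type*} [Group Γ] {K : Subgroup Γ} {k g : Γ}
    (hk : k ∈ K) (hg : g ∈ Subgroup.normalizer (K : Set Γ)) : g * k * g⁻¹ ∈ K :=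
  (Subgroup.mem_normalizer_iff.1 hg k).1 hk

namespace Matrix

variable {D : Type*} [DivisionRing D] {ι : Type*} [Fintype ι] [DecidableEq ι]

theorem single_mul_single_self_of_ne {i j : ι} (h : i ≠ j) (c : D) :
    single i j c * single i j c = 0 := by
  simp [h.symm]

/-- The elementary transvection `1 + c E_{ij}`. -/
def elemUnit (i j : ι) (h : i ≠ j) (c : D) : (Matrix ι ι D)ˣ :=
  sqZeroUnit (single i j c) (single_mul_single_self_of_ne h c)

@[simp] theorem val_elemUnit (i j : ι) (h : i ≠ j) (c : D) :
    (elemUnit i j h c).val = 1 + single i j c := rfl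

theorem elemUnit_mul (i j : ι) (h : i ≠ j) (c d : D) :
    elemUnit i j h c * elemUnit i j h d = elemUnit i j h (c + d) := by
  apply Units.ext
  simp [mul_add, add_mul, h.symm, single_add]
  abel

theorem elemUnit_inv (i j : ι) (h : i ≠ j) (c : D) :
    (elemUnit i j h c)⁻¹ = elemUnit i j h (-c) := by
  apply Units.ext
  change 1 - single i j c = 1 + single i j (-c)
  rw [sub_eq_add_neg, ← Matrix.single_neg]

theorem commute_single_of_commute_elemUnit {g : Matrix ι ι D} {i j : ι} (h : i ≠ j) {c : D}
    (hg : g * (elemUnit i j h c).val = (elemUnit i j h c).val * g) :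
    g * single i j c = single i j c * g := by
  rw [val_elemUnit] at hg
  simpa [mul_add, add_mul] using hg

theorem val_mem_center_of_commute_elemUnit [Nontrivial ι] {s : (Matrix ι ι D)ˣ}
    (hs : ∀ i j (h : i ≠ j) c, s * elemUnit i j h c = elemUnit i j h c * s) :
    s.val ∈ Subring.center (Matrix ι ι D) := by
  have h1 : ∀ i j c, i ≠ j → s.val * single i j c = single i j c * s.val := fun i j c h =>
    commute_single_of_commute_elemUnit h (congrArg Units.val (hs i j h c))
  have h2 : ∀ i j c, s.val * single i j c = single i j c * s.val := by
    intro i j c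
    by_cases hij : i = j
    · subst hij
      obtain ⟨k, hk⟩ := exists_ne i
      have : single i i c = single i k c * single k i 1 := by simp
      rw [this, ← mul_assoc, h1 _ _ _ hk.symm, mul_assoc, h1 _ _ _ hk, mul_assoc]
    · exact h1 i j c hij
  rw [Subring.mem_center_iff]
  intro g
  rw [Matrix.matrix_eq_sum_single g]
  simp only [Finset.sum_mul, Finset.mul_sum, h2]

theorem mem_center_of_commute_elemUnit [Nontrivial ι] {s : (Matrix ι ι D)ˣ}
    (hs : ∀ i j (h : i ≠ j) c, s * elemUnit i j h c = elemUnit i j h c * s) :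
    s ∈ Subgroup.center (Matrix ι ι D)ˣ :=
  Subgroup.mem_center_iff.2 fun g => Units.ext
    (Subring.mem_center_iff.1 (val_mem_center_of_commute_elemUnit hs) g.val)

variable {K : Subgroup (Matrix ι ι D)ˣ}

theorem exists_offdiag_ne_zero [Nontrivial ι]
    (hE : ∀ i j (h : i ≠ j) c, elemUnit i j h c ∈ Subgroup.normalizer (K : Set (Matrix ι ι D)ˣ))
    (hK : ¬ K ≤ Subgroup.center _) : ∃ g ∈ K, ∃ i j, i ≠ j ∧ g.val j i ≠ 0 := by
  by_contra! hcon
  obtain ⟨g, hg, hgc⟩ := Set.not_subset.1 hK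
  refine hgc (mem_center_of_commute_elemUnit fun i j h c => ?_)
  have h1 := Subgroup.conj_mem_of_normalizer hg (hE i j h c)
  have h2 := hcon _ h1 j i h.symm
  rw [elemUnit_inv] at h2
  have h3 : c * g.val j j = g.val i i * c := by
    rw [Units.val_mul, Units.val_mul, val_elemUnit, val_elemUnit] at h2
    simp [mul_add, add_mul, hcon g hg j i h.symm, hcon g hg i j h, Matrix.mul_assoc] at h2
    exact add_neg_eq_zero.1 h2
  apply Units.ext
  simp only [Units.val_mul, val_elemUnit, mul_add, add_mul, mul_one, one_mul, add_right_inj]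
  ext p q
  by_cases hp : p = i <;> by_cases hq : q = j
  · subst hp hq; simp [h3]
  · subst hp; simp [hq, hcon g hg q j hq]
  · subst hq; simp [hp, hcon g hg i p (Ne.symm hp)]
  · simp [hp, hq]

end Matrix

namespace Matrix

variable {D : Type*} [DivisionRing D] {ι : Type*} [Fintype ι] [DecidableEq ι]
  {K : Subgroup (Matrix ι ι D)ˣ}

theorem single_mul_apply_mul_single (i j k l : ι) (a b : D) (M : Matrix ι ι D) :
    single i j a * M * single k l b = single i l (a * M j k * b) := by
  ext p q
  by_cases hp : p = i <;> by_cases hq : q = l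
  · subst hp hq; simp
  · subst hp; simp [hq, Ne.symm hq]
  · subst hq; simp [hp, Ne.symm hp]
  · simp [hq, Ne.symm hp, Ne.symm hq]

theorem commutator_elemUnit_mem {i j k : ι} (hij : i ≠ j) (hjk : j ≠ k) (hik : i ≠ k) (c d : D)
    (h : elemUnit i j hij c * elemUnit j k hjk d * (elemUnit i j hij c)⁻¹ *
      (elemUnit j k hjk d)⁻¹ ∈ K) : elemUnit i k hik (c * d) ∈ K := by
  convert h using 1
  apply Units.ext
  rw [val_elemUnit]
  simp only [elemUnit]
  rw [commutator_sqZeroUnit _ _ (by simp [hik.symm])]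
  simp

/-- Two-entry column: `a E_{kj} + b E_{lj}`. -/
def columnPair (k l j : ι) (a b : D) : Matrix ι ι D := single k j a + single l j b

theorem columnPair_sq {k l j : ι} (hk : k ≠ j) (hl : l ≠ j) (a b : D) :
    columnPair k l j a b * columnPair k l j a b = 0 := by
  simp [columnPair, mul_add, add_mul, hk.symm, hl.symm]

theorem columnPair_mem_normalizer
    (hE : ∀ i j (h : i ≠ j) c, elemUnit i j h c ∈ Subgroup.normalizer (K : Set (Matrix ι ι D)ˣ))
    {k l j : ι} (hk : k ≠ j) (hl : l ≠ j) (a b : D) :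
    sqZeroUnit _ (columnPair_sq hk hl a b) ∈ Subgroup.normalizer (K : Set (Matrix ι ι D)ˣ) := by
  convert mul_mem (hE k j hk a) (hE l j hl b) using 1
  apply Units.ext
  change 1 + columnPair k l j a b = (1 + single k j a) * (1 + single l j b)
  simp [columnPair, mul_add, add_mul, hl.symm]
  abel

theorem exists_columnPair_mem
    (hE : ∀ i j (h : i ≠ j) c, elemUnit i j h c ∈ Subgroup.normalizer (K : Set (Matrix ι ι D)ˣ))
    {g : (Matrix ι ι D)ˣ} (hg : g ∈ K) {i j k l : ι} (hij : i ≠ j) (hji : g.val j i ≠ 0)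
    (hk : k ≠ j) (hl : l ≠ j) :
    ∃ a b, ∃ h : columnPair k l j a b * columnPair k l j a b = 0, (a ≠ 0 ∨ b ≠ 0) ∧
      sqZeroUnit _ h ∈ K := by
  obtain ⟨ψ, hψ⟩ : ∃ ψ : ι → D, ∀ m, ψ m = g⁻¹.val j m := ⟨_, fun _ => rfl⟩
  obtain ⟨a, b, hab, hz⟩ : ∃ a b : D, (a ≠ 0 ∨ b ≠ 0) ∧ ψ k * a + ψ l * b = 0 := by
    by_cases h : ψ k = 0
    · exact ⟨1, 0, Or.inl one_ne_zero, by simp [h]⟩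
    · exact ⟨-((ψ k)⁻¹ * ψ l), 1, Or.inr one_ne_zero, by simp [mul_inv_cancel_left₀ h]⟩
  obtain ⟨z, hzdef⟩ : ∃ z, z = columnPair k l j a b := ⟨_, rfl⟩
  have hzz : z * z = 0 := hzdef ▸ columnPair_sq hk hl a b
  have hzE : sqZeroUnit z hzz ∈ Subgroup.normalizer (K : Set (Matrix ι ι D)ˣ) := by
    subst hzdef; exact columnPair_mem_normalizer hE hk hl a b
  have hrow : ∀ (m : ι) (c : D), single m j c * z = 0 := fun m c => by
    simp [hzdef, columnPair, mul_add, hk.symm, hl.symm]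
  have hgz : single i j (1 : D) * (g⁻¹.val * z) = 0 := by
    ext p q
    by_cases hp : p = i
    swap
    · simp [hp]
    subst hp
    by_cases hq : q = j
    · subst hq; simp [hzdef, columnPair, mul_add, ← hψ, hz]
    · simp [hzdef, columnPair, mul_add, hq]
  have hcomm : ∀ (p q : ι) (c : D), z * (g.val * single i j 1 * g⁻¹.val) * single p q c =
      columnPair k l q (a * (g.val j i * ψ p) * c) (b * (g.val j i * ψ p) * c) := by
    intro p q c
    have h1 : (g.val * single i j (1 : D) * g⁻¹.val : Matrix ι ι D) j p = g.val j i * ψ p := by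
      have h2 := single_mul_apply_mul_single j j p p 1 1 (g.val * single i j 1 * g⁻¹.val)
      have h3 : (single j j 1 * g.val * single i j 1) * g⁻¹.val * single p p 1
        = single j p (g.val j i * ψ p) := by
        rw [single_mul_apply_mul_single, single_mul_apply_mul_single]; simp [hψ]
      have h4 := congrFun (congrFun (h2.symm.trans (by simpa [Matrix.mul_assoc] using h3)) j) p
      simpa using h4
    rw [hzdef, columnPair, add_mul, add_mul, single_mul_apply_mul_single,
      single_mul_apply_mul_single, h1, columnPair]
  have hh := Subgroup.commutator_mem_of_normalizer
    (Subgroup.commutator_mem_of_normalizer hg (hE i j hij 1)) hzE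
  obtain ⟨p, hp⟩ : ∃ p, p = -(z * (g.val * single i j 1 * g⁻¹.val)) := ⟨_, rfl⟩
  have hTz : (g.val * single i j 1 * g⁻¹.val) * z = 0 := by
    rw [Matrix.mul_assoc, Matrix.mul_assoc, hgz, Matrix.mul_zero]
  have hpp : p * p = 0 := by
    rw [hp, neg_mul_neg]
    rw [← Matrix.mul_assoc, Matrix.mul_assoc z, hTz]
    simp
  have hpK : sqZeroUnit p hpp ∈ K := by
    convert hh using 1
    apply Units.ext
    rw [elemUnit, commutator_conj_sqZeroUnit g (single_mul_single_self_of_ne hij 1) hzz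
      (hrow i 1) (by simp [hzdef, columnPair, add_mul, hij.symm]) hgz]
    change 1 + p = _
    rw [hp, sub_eq_add_neg]
  have hpcomm : ∀ (m q : ι) (c : D), p * single m q c =
      columnPair k l q (a * -(g.val j i * ψ m) * c) (b * -(g.val j i * ψ m) * c) := by
    intro m q c
    rw [hp, neg_mul, hcomm]
    simp [columnPair, ← single_neg, add_comm]
  by_cases hm : ∃ m, m ≠ j ∧ ψ m ≠ 0
  · obtain ⟨m, hmj, hm⟩ := hm
    have hep : single m j (1 : D) * p = 0 := by
      rw [hp, mul_neg, ← Matrix.mul_assoc, hrow]; simp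
    have h5 := Subgroup.commutator_mem_of_normalizer hpK (hE m j hmj 1)
    refine ⟨_, _, columnPair_sq hk hl (a * -(g.val j i * ψ m) * 1) (b * -(g.val j i * ψ m) * 1),
      by simpa [hm, hji] using hab, ?_⟩
    convert h5 using 1
    apply Units.ext
    rw [elemUnit, commutator_sqZeroUnit _ _ hep, hpcomm]
    rfl
  · push Not at hm
    have hψj : ψ j ≠ 0 := by
      intro h0
      have h6 : ∀ m, ψ m = 0 := fun m => by
        by_cases h : m = j
        · exact h ▸ h0
        · exact hm m h
      have h7 := congrFun (congrFun g.inv_mul j) j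
      rw [Matrix.mul_apply] at h7
      simp [← hψ, h6] at h7
    refine ⟨_, _, columnPair_sq hk hl (a * -(g.val j i * ψ j) * 1) (b * -(g.val j i * ψ j) * 1),
      by simpa [hψj, hji] using hab, ?_⟩
    convert hpK using 1
    apply Units.ext
    change 1 + _ = 1 + p
    rw [← hpcomm]
    congr 1
    ext r q
    by_cases hq : q = j
    · subst hq; simp
    · have h8 := congrFun (congrFun (hpcomm q q 1) r) q
      rw [hm q hq] at h8
      simp [columnPair] at h8
      simp [hq, h8]

theorem elemUnit_mem_of_columnPair_mem
    (hE : ∀ i j (h : i ≠ j) c, elemUnit i j h c ∈ Subgroup.normalizer (K : Set (Matrix ι ι D)ˣ))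
    {j k l m : ι} (hkl : k ≠ l) (hmj : m ≠ j) (hml : m ≠ l) {a b : D}
    (h : columnPair k l j a b * columnPair k l j a b = 0) (hK : sqZeroUnit _ h ∈ K) (hb : b ≠ 0)
    (c : D) : elemUnit m j hmj c ∈ K := by
  have h1 := Subgroup.commutator_mem_of_normalizer' hK (hE m l hml (c * b⁻¹))
  convert h1 using 1
  apply Units.ext
  rw [val_elemUnit]
  simp only [elemUnit]
  rw [commutator_sqZeroUnit _ _]
  · simp [columnPair, mul_add, hkl.symm, hb]
  · simp [columnPair, add_mul, hmj.symm]

theorem elemUnit_mem_of_three_le (hι : 3 ≤ Fintype.card ι)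
    (hE : ∀ i j (h : i ≠ j) c, elemUnit i j h c ∈ Subgroup.normalizer (K : Set (Matrix ι ι D)ˣ))
    (hK : ¬ K ≤ Subgroup.center _) (i j : ι) (h : i ≠ j) (c : D) : elemUnit i j h c ∈ K := by
  have hthird : ∀ i j : ι, ∃ k, k ≠ i ∧ k ≠ j := by
    intro i j
    have : ({i, j} : Finset ι) ≠ Finset.univ := by
      intro h
      have h1 := Finset.card_le_two (a := i) (b := j)
      rw [h, Finset.card_univ] at h1
      omega
    obtain ⟨k, hk⟩ := not_forall.1 (mt Finset.eq_univ_iff_forall.2 this)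
    simp at hk
    exact ⟨k, hk⟩
  have : Nontrivial ι := Fintype.one_lt_card_iff_nontrivial.1 (by omega)
  obtain ⟨g, hg, i₀, j₀, hij, hji⟩ := exists_offdiag_ne_zero hE hK
  obtain ⟨l, hli, hlj⟩ := hthird i₀ j₀
  have hstart : ∃ m j, m ≠ j ∧ ∀ h : m ≠ j, ∀ c, elemUnit m j h c ∈ K := by
    obtain ⟨a, b, hz, hab, hmem⟩ := exists_columnPair_mem hE hg hij hji hij hlj
    rcases eq_or_ne b 0 with hb | hb
    · obtain ⟨ha, hb⟩ : a ≠ 0 ∧ b = 0 := ⟨by simpa [hb] using hab, hb⟩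
      have e : columnPair i₀ l j₀ a b = columnPair l i₀ j₀ b a := by
        rw [columnPair, columnPair, add_comm]
      refine ⟨l, j₀, hlj, fun _ c => ?_⟩
      have hz' := hz
      rw [e] at hz'
      refine elemUnit_mem_of_columnPair_mem hE hli hlj hli hz' ?_ ha c
      convert hmem using 2
      exact e.symm
    · exact ⟨i₀, j₀, hij, fun _ c =>
        elemUnit_mem_of_columnPair_mem hE hli.symm hij hli.symm hz hmem hb c⟩
  obtain ⟨m, n, hmn, hQ⟩ := hstart
  have hQr : ∀ m j k, m ≠ k → m ≠ j → (∀ h : m ≠ j, ∀ c, elemUnit m j h c ∈ K) →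
      ∀ h : m ≠ k, ∀ c, elemUnit m k h c ∈ K := by
    intro m j k hmk hmj hQ h c
    by_cases hjk : j = k
    · subst hjk; exact hQ _ _
    have := commutator_elemUnit_mem hmj hjk hmk c 1
      (Subgroup.commutator_mem_of_normalizer (hQ hmj c) (hE _ _ _ _))
    simpa using this
  have hQl : ∀ m j k, k ≠ j → m ≠ j → (∀ h : m ≠ j, ∀ c, elemUnit m j h c ∈ K) →
      ∀ h : k ≠ j, ∀ c, elemUnit k j h c ∈ K := by
    intro m j k hkj hmj hQ h c
    by_cases hkm : k = m
    · subst hkm; exact hQ _ _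
    have := commutator_elemUnit_mem hkm hmj hkj 1 c
      (Subgroup.commutator_mem_of_normalizer' (hQ hmj c) (hE _ _ _ _))
    simpa using this
  by_cases hjm : j = m
  · subst hjm
    by_cases hin : i = n
    · subst hin
      obtain ⟨k, hk1, hk2⟩ := hthird j i
      have h1 := hQr j i k hk1.symm hmn hQ
      have h2 := hQl j k i hk2.symm hk1.symm h1
      exact hQr i k j h hk2.symm h2 h c
    · have h1 := hQl j n i hin hmn hQ
      exact hQr i n j h hin h1 h c
  · have h1 := hQr m n j (Ne.symm hjm) hmn hQ
    exact hQl m j i h (Ne.symm hjm) h1 h c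

end Matrix

namespace Matrix

variable {D : Type*} [DivisionRing D] {ι : Type*} [DecidableEq ι]

/-- The matrix with rows `(a, b)` and `(c, d)` in the coordinates `i`, `j`. -/
def twoByTwo (i j : ι) (a b c d : D) : Matrix ι ι D :=
  single i i a + single i j b + single j i c + single j j d

theorem eq_twoByTwo {i j : ι} (h : i ≠ j) (hij : ∀ k, k = i ∨ k = j) (M : Matrix ι ι D) :
    M = twoByTwo i j (M i i) (M i j) (M j i) (M j j) := by
  ext p q
  rcases hij p with rfl | rfl <;> rcases hij q with rfl | rfl <;>
    simp [twoByTwo, h, h.symm]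

theorem twoByTwo_inj {i j : ι} (h : i ≠ j) {a b c d a' b' c' d' : D} :
    twoByTwo i j a b c d = twoByTwo i j a' b' c' d' ↔ a = a' ∧ b = b' ∧ c = c' ∧ d = d' := by
  refine ⟨fun he => ⟨?_, ?_, ?_, ?_⟩, by rintro ⟨rfl, rfl, rfl, rfl⟩; rfl⟩
  · simpa [twoByTwo, h, h.symm] using congrFun (congrFun he i) i
  · simpa [twoByTwo, h, h.symm] using congrFun (congrFun he i) j
  · simpa [twoByTwo, h, h.symm] using congrFun (congrFun he j) i
  · simpa [twoByTwo, h, h.symm] using congrFun (congrFun he j) j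

theorem one_eq_twoByTwo {i j : ι} (h : i ≠ j) (hij : ∀ k, k = i ∨ k = j) :
    (1 : Matrix ι ι D) = twoByTwo i j 1 0 0 1 := by
  rw [eq_twoByTwo h hij 1]; simp [h, h.symm]

variable [Fintype ι] {K : Subgroup (Matrix ι ι D)ˣ}

theorem twoByTwo_mul {i j : ι} (h : i ≠ j) (a b c d a' b' c' d' : D) :
    twoByTwo i j a b c d * twoByTwo i j a' b' c' d' =
      twoByTwo i j (a * a' + b * c') (a * b' + b * d') (c * a' + d * c') (c * b' + d * d') := by
  simp [twoByTwo, mul_add, add_mul, h, h.symm, single_add]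
  abel

theorem val_elemUnit_two {i j : ι} (h : i ≠ j) (hij : ∀ k, k = i ∨ k = j) (c : D) :
    (elemUnit i j h c).val = twoByTwo i j 1 c 0 1 := by
  rw [val_elemUnit, one_eq_twoByTwo h hij]; simp [twoByTwo]; abel

theorem val_elemUnit_two' {i j : ι} (h : i ≠ j) (hij : ∀ k, k = i ∨ k = j) (c : D) :
    (elemUnit j i h.symm c).val = twoByTwo i j 1 0 c 1 := by
  rw [val_elemUnit, one_eq_twoByTwo h hij]; simp [twoByTwo]; abel

/-- The monomial unit with entries `u`, `-u⁻¹` off the diagonal. -/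
def weylUnit (i j : ι) (h : i ≠ j) (u : D) : (Matrix ι ι D)ˣ :=
  elemUnit i j h u * elemUnit j i h.symm (-u⁻¹) * elemUnit i j h u

theorem val_weylUnit {i j : ι} (h : i ≠ j) (hij : ∀ k, k = i ∨ k = j) {u : D} (hu : u ≠ 0) :
    (weylUnit i j h u).val = twoByTwo i j 0 u (-u⁻¹) 0 := by
  rw [weylUnit, Units.val_mul, Units.val_mul, val_elemUnit_two h hij, val_elemUnit_two' h hij,
    twoByTwo_mul h, twoByTwo_mul h]
  simp [hu]

theorem weylUnit_mem_normalizer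
    (hE : ∀ i j (h : i ≠ j) c, elemUnit i j h c ∈ Subgroup.normalizer (K : Set (Matrix ι ι D)ˣ))
    {i j : ι} (h : i ≠ j) (u : D) :
    weylUnit i j h u ∈ Subgroup.normalizer (K : Set (Matrix ι ι D)ˣ) :=
  mul_mem (mul_mem (hE _ _ _ _) (hE _ _ _ _)) (hE _ _ _ _)

/-- The unit `diag(u, u⁻¹)`. -/
def diagUnit (i j : ι) (h : i ≠ j) (u : D) : (Matrix ι ι D)ˣ :=
  weylUnit i j h u * weylUnit i j h (-1)

theorem val_diagUnit {i j : ι} (h : i ≠ j) (hij : ∀ k, k = i ∨ k = j) {u : D} (hu : u ≠ 0) :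
    (diagUnit i j h u).val = twoByTwo i j u 0 0 u⁻¹ := by
  rw [diagUnit, Units.val_mul, val_weylUnit h hij hu, val_weylUnit h hij (by simp),
    twoByTwo_mul h]
  simp [inv_neg]

theorem diagUnit_mem_normalizer
    (hE : ∀ i j (h : i ≠ j) c, elemUnit i j h c ∈ Subgroup.normalizer (K : Set (Matrix ι ι D)ˣ))
    {i j : ι} (h : i ≠ j) (u : D) :
    diagUnit i j h u ∈ Subgroup.normalizer (K : Set (Matrix ι ι D)ˣ) :=
  mul_mem (weylUnit_mem_normalizer hE h _) (weylUnit_mem_normalizer hE h _)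

theorem diagUnit_conj {i j : ι} (h : i ≠ j) (hij : ∀ k, k = i ∨ k = j) {u : D} (hu : u ≠ 0)
    (c : D) : diagUnit i j h u * elemUnit i j h c * (diagUnit i j h u)⁻¹ =
      elemUnit i j h (u * c * u) := by
  rw [mul_inv_eq_iff_eq_mul]
  apply Units.ext
  simp only [Units.val_mul, val_diagUnit h hij hu, val_elemUnit_two h hij, twoByTwo_mul h]
  simp [mul_assoc, hu]

theorem diagUnit_conj' {i j : ι} (h : i ≠ j) (hij : ∀ k, k = i ∨ k = j) {u : D} (hu : u ≠ 0)
    (c : D) : diagUnit i j h u * elemUnit j i h.symm c * (diagUnit i j h u)⁻¹ =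
      elemUnit j i h.symm (u⁻¹ * c * u⁻¹) := by
  rw [mul_inv_eq_iff_eq_mul]
  apply Units.ext
  simp only [Units.val_mul, val_diagUnit h hij hu, val_elemUnit_two' h hij, twoByTwo_mul h]
  simp [mul_assoc, hu]

theorem weylUnit_conj {i j : ι} (h : i ≠ j) (hij : ∀ k, k = i ∨ k = j) (c : D) :
    weylUnit i j h 1 * elemUnit j i h.symm c * (weylUnit i j h 1)⁻¹ = elemUnit i j h (-c) := by
  rw [mul_inv_eq_iff_eq_mul]
  apply Units.ext
  simp only [Units.val_mul, val_weylUnit h hij one_ne_zero, val_elemUnit_two h hij,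
    val_elemUnit_two' h hij, twoByTwo_mul h]
  simp

theorem elemUnit_mem_of_symm
    (hE : ∀ i j (h : i ≠ j) c, elemUnit i j h c ∈ Subgroup.normalizer (K : Set (Matrix ι ι D)ˣ))
    {i j : ι} (h : i ≠ j) (hij : ∀ k, k = i ∨ k = j) 
    (hK : ∀ c : D, elemUnit j i h.symm c ∈ K) (c : D) : elemUnit i j h c ∈ K := by
  have := Subgroup.conj_mem_of_normalizer (hK (-c)) (weylUnit_mem_normalizer hE h 1)
  rwa [weylUnit_conj h hij, neg_neg] at this

/-- A nonzero additive subgroup stable under `x ↦ u x u` is everything in characteristic not two. -/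
theorem _root_.AddSubgroup.eq_top_of_conj_stable (S : AddSubgroup D) (h2 : (2 : D) ≠ 0)
    (hS : ∀ u x, u ≠ 0 → x ∈ S → u * x * u ∈ S) {s : D} (hs : s ∈ S) (hs0 : s ≠ 0) : S = ⊤ := by
  have h1 : ∀ x ∈ S, ∀ u, u * x + x * u ∈ S := by
    intro x hx u
    by_cases hu : u = 0
    · simp [hu, S.zero_mem]
    by_cases hu1 : u + 1 = 0
    · obtain rfl : u = -1 := eq_neg_of_add_eq_zero_left hu1
      simpa using S.add_mem (S.neg_mem hx) (S.neg_mem hx)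
    · have := S.sub_mem (S.sub_mem (hS _ _ hu1 hx) (hS _ _ hu hx)) hx
      convert this using 1
      noncomm_ring
  have h3 := h1 s hs s⁻¹
  rw [inv_mul_cancel₀ hs0, mul_inv_cancel₀ hs0, one_add_one_eq_two] at h3
  rw [eq_top_iff]
  intro x _
  have h4 := h1 2 h3 (2⁻¹ * (2⁻¹ * x))
  have e : (2⁻¹ * (2⁻¹ * x)) * 2 = 2 * (2⁻¹ * (2⁻¹ * x)) := by rw [mul_two, two_mul]
  rw [e, mul_inv_cancel_left₀ h2, ← two_mul, mul_inv_cancel_left₀ h2] at h4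
  exact h4

theorem elemUnit_mem_of_fourth_root
    (hE : ∀ i j (h : i ≠ j) c, elemUnit i j h c ∈ Subgroup.normalizer (K : Set (Matrix ι ι D)ˣ))
    {i j : ι} (h : i ≠ j) (hij : ∀ k, k = i ∨ k = j) {u : D} (huc : u ∈ Subring.center D)
    (hu : u * u = -1) (h2 : (2 : D) ≠ 0) {x y : D} (hy : y ≠ 0) (hxy : 2 + x * y ≠ 0)
    (hK : elemUnit j i h.symm y * elemUnit i j h x ∈ K) (c : D) : elemUnit i j h c ∈ K := by
  have hu' := Subring.mem_center_iff.1 huc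
  have hu0 : u ≠ 0 := by rintro rfl; simp at hu
  have huinv : u⁻¹ = -u := by
    exact inv_eq_of_mul_eq_one_right (by rw [mul_neg, hu, neg_neg])
  have h1 : elemUnit i j h x * elemUnit j i h.symm y ∈ K := by
    have := Subgroup.conj_mem_of_normalizer hK (inv_mem (hE j i h.symm y))
    convert this using 1
    group
  obtain ⟨A, hA⟩ : ∃ A, A = diagUnit i j h (-u) * elemUnit i j h (2 * y⁻¹) := ⟨_, rfl⟩
  have hAN : A ∈ Subgroup.normalizer (K : Set (Matrix ι ι D)ˣ) := by
    rw [hA]; exact mul_mem (diagUnit_mem_normalizer hE h _) (hE _ _ _ _)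
  have hAval : A.val = twoByTwo i j (-u) (-u * (2 * y⁻¹)) 0 u := by
    rw [hA, Units.val_mul, val_diagUnit h hij (neg_ne_zero.2 hu0), val_elemUnit_two h hij,
      twoByTwo_mul h]
    simp [inv_neg, huinv]
  obtain ⟨T, hT⟩ : ∃ T, T = (elemUnit i j h x * elemUnit j i h.symm y) * A *
    (elemUnit i j h x * elemUnit j i h.symm y)⁻¹ * A⁻¹ := ⟨_, rfl⟩
  have hTK : T ∈ K := hT ▸ Subgroup.commutator_mem_of_normalizer h1 hAN
  have hTval : T.val = twoByTwo i j (-1) (-(2 * x + 4 * y⁻¹)) 0 (-1) := by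
    have e1 : T * (A * (elemUnit i j h x * elemUnit j i h.symm y)) =
        (elemUnit i j h x * elemUnit j i h.symm y) * A := by rw [hT]; group
    have e2 := congrArg Units.val e1
    have e3 : twoByTwo i j (-1) (-(2 * x + 4 * y⁻¹)) 0 (-1) *
      (A * (elemUnit i j h x * elemUnit j i h.symm y) : (Matrix ι ι D)ˣ).val =
        ((elemUnit i j h x * elemUnit j i h.symm y) * A : (Matrix ι ι D)ˣ).val := by
      simp only [Units.val_mul, hAval, val_elemUnit_two h hij, val_elemUnit_two' h hij,
        twoByTwo_mul h, twoByTwo_inj h]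
      have c1 : ∀ z ∈ ({x, y, y⁻¹} : Set D), ∀ w, z * (u * w) = u * (z * w) := fun z _ w => by
        rw [← mul_assoc, hu', mul_assoc]
      refine ⟨?_, ?_, ?_, ?_⟩
      all_goals
        simp only [two_mul, add_mul, mul_add, mul_one, one_mul, mul_zero, zero_mul, add_zero,
          zero_add, neg_mul, mul_neg, mul_assoc, show (4 : D) = 2 + 2 by norm_num, hu' y, hu' x,
          hu' y⁻¹, c1 x (by simp), c1 y (by simp), c1 y⁻¹ (by simp), inv_mul_cancel₀ hy,
          mul_inv_cancel₀ hy]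
        try abel
    rw [← e3, Units.val_mul] at e2
    exact (Units.mul_left_inj _).1 e2
  have hTT : T * T = elemUnit i j h (2 * (2 * x + 4 * y⁻¹)) := by
    apply Units.ext
    rw [Units.val_mul, hTval, val_elemUnit_two h hij, twoByTwo_mul h, twoByTwo_inj h]
    simp [two_mul]
  let S : AddSubgroup D :=
    { carrier := {c | elemUnit i j h c ∈ K}
      zero_mem' := by
        have : elemUnit i j h (0 : D) = 1 := by apply Units.ext; simp
        simp [this, K.one_mem]
      add_mem' := fun {a b} ha hb => by
        have := K.mul_mem ha hb
        rwa [elemUnit_mul] at this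
      neg_mem' := fun {a} ha => by
        have := K.inv_mem ha
        rwa [elemUnit_inv] at this }
  have hmem : 2 * (2 * x + 4 * y⁻¹) ∈ S := by
    change elemUnit i j h _ ∈ K
    rw [← hTT]
    exact K.mul_mem hTK hTK
  have hne : 2 * (2 * x + 4 * y⁻¹) ≠ 0 := by
    have : 2 * (2 * x + 4 * y⁻¹) = 2 * (2 * ((2 + x * y) * y⁻¹)) := by
      rw [add_mul, mul_assoc x, mul_inv_cancel₀ hy, mul_add 2 (2 * y⁻¹), ← mul_assoc 2 2 y⁻¹]
      norm_num [add_comm]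
    rw [this]
    exact mul_ne_zero h2 (mul_ne_zero h2 (mul_ne_zero hxy (inv_ne_zero hy)))
  have hS := AddSubgroup.eq_top_of_conj_stable S h2 (fun w z hw hz => by
    change elemUnit i j h _ ∈ K
    rw [← diagUnit_conj h hij hw]
    exact Subgroup.conj_mem_of_normalizer hz (diagUnit_mem_normalizer hE h w)) hmem hne
  have : c ∈ S := by rw [hS]; trivial
  exact this

theorem elemUnit_mem_of_card_eq_two (hι : Fintype.card ι = 2)
    (hF : ∃ u ∈ Subring.center D, u ≠ 0 ∧ u ≠ 1 ∧ u ≠ -1)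
    (hE : ∀ i j (h : i ≠ j) c, elemUnit i j h c ∈ Subgroup.normalizer (K : Set (Matrix ι ι D)ˣ))
    (hK : ¬ K ≤ Subgroup.center _) (p q : ι) (hpq : p ≠ q) (c : D) : elemUnit p q hpq c ∈ K := by
  have : Nontrivial ι := Fintype.one_lt_card_iff_nontrivial.1 (by omega)
  obtain ⟨g, hg, i, j, h, hji⟩ := exists_offdiag_ne_zero hE hK
  have hij : ∀ k, k = i ∨ k = j := by
    have h1 : ({i, j} : Finset ι) = Finset.univ := by
      apply Finset.eq_univ_of_card
      rw [Finset.card_pair h, hι]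
    intro k
    have := Finset.mem_univ k
    rw [← h1] at this
    simpa using this
  suffices hs : ∀ c : D, elemUnit i j h c ∈ K by
    have hs' := elemUnit_mem_of_symm hE h.symm (fun k => (hij k).symm) hs
    rcases hij p with rfl | rfl <;> rcases hij q with rfl | rfl
    · exact absurd rfl hpq
    · exact hs c
    · exact hs' c
    · exact absurd rfl hpq
  obtain ⟨g', hg', b, c₀, d, hb, hc₀, hval, hinv⟩ : ∃ g' ∈ K, ∃ b c₀ d : D, b ≠ 0 ∧ c₀ ≠ 0 ∧
      g'.val = twoByTwo i j 0 b c₀ d ∧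
      g'⁻¹.val = twoByTwo i j (-(c₀⁻¹ * d * b⁻¹)) c₀⁻¹ b⁻¹ 0 := by
    have h1 := Subgroup.conj_mem_of_normalizer hg (hE i j h (-(g.val i i * (g.val j i)⁻¹)))
    obtain ⟨g', hg'⟩ : ∃ g', g' = elemUnit i j h (-(g.val i i * (g.val j i)⁻¹)) * g *
      (elemUnit i j h (-(g.val i i * (g.val j i)⁻¹)))⁻¹ := ⟨_, rfl⟩
    rw [← hg'] at h1
    have h2 : ∃ b d, g'.val = twoByTwo i j 0 b (g.val j i) d := by
      have h3 := eq_twoByTwo h hij g.val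
      obtain ⟨α, hα⟩ : ∃ α, α = g.val i i := ⟨_, rfl⟩
      obtain ⟨β, hβ⟩ : ∃ β, β = g.val i j := ⟨_, rfl⟩
      obtain ⟨γ, hγ⟩ : ∃ γ, γ = g.val j i := ⟨_, rfl⟩
      obtain ⟨δ, hδ⟩ : ∃ δ, δ = g.val j j := ⟨_, rfl⟩
      rw [← hα, ← hβ, ← hγ, ← hδ] at h3
      rw [← hγ] at hji
      rw [hg', Units.val_mul, Units.val_mul, elemUnit_inv, ← hα, ← hγ, h3, val_elemUnit_two h hij,
        val_elemUnit_two h hij, twoByTwo_mul h, twoByTwo_mul h]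
      simp only [twoByTwo_inj h]
      refine ⟨_, _, ?_, rfl, ?_, rfl⟩ <;> simp [hji]
    obtain ⟨b, d, h2⟩ := h2
    have hb : b ≠ 0 := by
      rintro rfl
      have h4 := g'.mul_inv
      rw [eq_twoByTwo h hij g'⁻¹.val, h2, one_eq_twoByTwo h hij, twoByTwo_mul h,
        twoByTwo_inj h] at h4
      simpa using h4.1
    refine ⟨g', h1, b, _, d, hb, hji, h2, ?_⟩
    apply Units.inv_eq_of_mul_eq_one_right
    rw [h2, one_eq_twoByTwo h hij, twoByTwo_mul h, twoByTwo_inj h]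
    refine ⟨?_, ?_, ?_, ?_⟩ <;> simp [hb, hji, mul_assoc]
  have hh : ∀ c, elemUnit j i h.symm (c₀ * c * b⁻¹) * elemUnit i j h (-c) ∈ K := by
    intro c
    convert Subgroup.commutator_mem_of_normalizer hg' (hE i j h c) using 1
    rw [elemUnit_inv]
    congr 1
    apply Units.ext
    rw [Units.val_mul, Units.val_mul, hval, hinv, val_elemUnit_two h hij, val_elemUnit_two' h hij,
      twoByTwo_mul h, twoByTwo_mul h, twoByTwo_inj h]
    refine ⟨?_, ?_, ?_, ?_⟩ <;> simp [hb, hc₀, mul_assoc, add_mul]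
  by_cases h4 : ∃ u ∈ Subring.center D, u ≠ 0 ∧ u * u * (u * u) ≠ 1
  · obtain ⟨u, huc, hu0, hu4⟩ := h4
    have hu' := Subring.mem_center_iff.1 huc
    have hv : u⁻¹ * u⁻¹ - u * u ≠ 0 := by
      intro hv
      apply hu4
      calc u * u * (u * u) = u * u * (u⁻¹ * u⁻¹) := by rw [sub_eq_zero.1 hv]
        _ = 1 := by simp [mul_assoc, hu0]
    refine elemUnit_mem_of_symm hE h hij fun y => ?_
    obtain ⟨c, hc⟩ : ∃ c, c = c₀⁻¹ * ((u⁻¹ * u⁻¹ - u * u)⁻¹ * y) * b := ⟨_, rfl⟩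
    have h5 := Subgroup.conj_mem_of_normalizer (hh c) (diagUnit_mem_normalizer hE h u)
    have h6 := K.mul_mem h5 (K.inv_mem (hh (u * c * u)))
    convert h6 using 1
    have e1 : diagUnit i j h u * (elemUnit j i h.symm (c₀ * c * b⁻¹) * elemUnit i j h (-c)) *
      (diagUnit i j h u)⁻¹ = (diagUnit i j h u * elemUnit j i h.symm (c₀ * c * b⁻¹) *
      (diagUnit i j h u)⁻¹) * (diagUnit i j h u * elemUnit i j h (-c) * (diagUnit i j h u)⁻¹) := by
      group
    have e2 : u * -c * u = -(u * c * u) := by simp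
    rw [e1, diagUnit_conj' h hij hu0, diagUnit_conj h hij hu0, e2, _root_.mul_inv_rev, mul_assoc,
      mul_inv_cancel_left, elemUnit_inv, elemUnit_mul]
    congr 1
    have hui : ∀ z, z * u⁻¹ = u⁻¹ * z := fun z => by
      rw [mul_inv_eq_iff_eq_mul₀ hu0, mul_assoc, hu', inv_mul_cancel_left₀ hu0]
    have e3 : c₀ * c * b⁻¹ = (u⁻¹ * u⁻¹ - u * u)⁻¹ * y := by
      rw [hc]; simp [mul_assoc, hb, hc₀]
    have e4 : c₀ * (u * c * u) * b⁻¹ = u * u * (c₀ * c * b⁻¹) := by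
      have c1 : ∀ z ∈ ({c, c₀} : Set D), ∀ w, z * (u * w) = u * (z * w) := fun z _ w => by
        rw [← mul_assoc, hu', mul_assoc]
      simp only [mul_assoc, c1 c (by simp), c1 c₀ (by simp)]
    rw [e4, e3, hui, ← mul_assoc, ← mul_assoc, ← sub_eq_add_neg]
    rw [← mul_assoc, ← sub_mul, ← sub_mul, mul_inv_cancel₀ hv, one_mul]
  · push Not at h4
    obtain ⟨u, huc, hu0, hu1, hu2⟩ := hF
    have hu' := Subring.mem_center_iff.1 huc
    have hu4 := h4 u huc hu0
    have huu : u * u = -1 := by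
      have e1 : (u - 1) * ((u + 1) * (u * u + 1)) = 0 := by
        have : (u - 1) * ((u + 1) * (u * u + 1)) = u * u * (u * u) - 1 := by noncomm_ring
        rw [this, hu4, sub_self]
      rcases mul_eq_zero.1 e1 with e | e
      · exact absurd (sub_eq_zero.1 e) hu1
      rcases mul_eq_zero.1 e with e | e
      · exact absurd (eq_neg_of_add_eq_zero_left e) hu2
      · exact eq_neg_of_add_eq_zero_left e
    have h2 : (2 : D) ≠ 0 := by
      intro h2
      have e1 : (u - 1) * (u - 1) = 0 := by
        have : (u - 1) * (u - 1) = u * u + 1 - 2 * u := by noncomm_ring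
        rw [this, huu, h2]; simp
      exact hu1 (sub_eq_zero.1 (mul_self_eq_zero.1 e1))
    by_cases h5 : 2 + (-1 : D) * (c₀ * 1 * b⁻¹) = 0
    · refine elemUnit_mem_of_fourth_root hE h hij huc huu h2 (x := -u) (y := c₀ * u * b⁻¹)
        (by simp [hc₀, hu0, hb]) (fun h6 => ?_) (hh u)
      have e : -u * (c₀ * u * b⁻¹) = c₀ * b⁻¹ := by
        rw [hu' c₀, mul_assoc u, ← mul_assoc, neg_mul, huu]; simp
      rw [e] at h6
      simp at h5
      have : (2 : D) * 2 = 0 := by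
        have := congrArg₂ (· + ·) h5 h6
        simp only [add_zero] at this
        rw [← this, two_mul]; abel
      exact h2 (mul_self_eq_zero.1 this)
    · exact elemUnit_mem_of_fourth_root hE h hij huc huu h2 (x := -1) (y := c₀ * 1 * b⁻¹)
        (by simp [hc₀, hb]) h5 (hh 1)

end Matrix

namespace Matrix

variable {D : Type*} [DivisionRing D] {ι : Type*} [Fintype ι] [DecidableEq ι] [Nontrivial ι]

theorem elemUnit_mem_of_subnormalDepth
    (hF : ∃ u ∈ Subring.center D, u ≠ 0 ∧ u ≠ 1 ∧ u ≠ -1) {r : ℕ}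
    {G : Subgroup (Matrix ι ι D)ˣ} (hG : SubnormalDepth r G) (hnc : ¬ G ≤ Subgroup.center _)
    (i j : ι) (h : i ≠ j) (c : D) : elemUnit i j h c ∈ G := by
  induction r generalizing G i j c with
  | zero =>
    obtain rfl : G = ⊤ := hG
    trivial
  | succ r ih =>
    obtain ⟨H, hH, hle, hn⟩ := hG
    have hE : ∀ i j (h : i ≠ j) c,
        elemUnit i j h c ∈ Subgroup.normalizer (G : Set (Matrix ι ι D)ˣ) := by
      intro i j h c
      have h1 := ih hH (fun h => hnc (hle.trans h)) i j h c
      rw [Subgroup.mem_normalizer_iff]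
      refine fun x => ⟨fun hx => hn x hx _ h1, fun hx => ?_⟩
      have := hn _ hx _ (H.inv_mem h1)
      convert this using 1
      group
    have hcard : 1 < Fintype.card ι := Fintype.one_lt_card
    by_cases h2 : Fintype.card ι = 2
    · exact elemUnit_mem_of_card_eq_two h2 hF hE hnc i j h c
    · exact elemUnit_mem_of_three_le (by omega) hE hnc i j h c

theorem centralizersCentral_units
    (hF : ∃ u ∈ Subring.center D, u ≠ 0 ∧ u ≠ 1 ∧ u ≠ -1) :
    CentralizersCentral (Matrix ι ι D)ˣ :=
  fun _ _ hG hnc _ hs => mem_center_of_commute_elemUnit fun i j h c =>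
    hs _ (elemUnit_mem_of_subnormalDepth hF hG hnc i j h c)

end Matrix

/-- The iterated commutators `x`, `x (g x g⁻¹)⁻¹`, … of `x` with `g`. -/
def iterComm {α : Type*} [Mul α] [Inv α] (g : α) : ℕ → α → α
  | 0, x => x
  | k + 1, x => iterComm g k x * (g * iterComm g k x * g⁻¹)⁻¹

theorem SubnormalDepth.iterComm_mem {Γ : Type*} [Group Γ] {r : ℕ} {G : Subgroup Γ}
    (hG : SubnormalDepth r G) {g : Γ} (hg : g ∈ G) (x : Γ) : iterComm g r x ∈ G := by
  induction r generalizing G with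
  | zero =>
    obtain rfl : G = ⊤ := hG
    trivial
  | succ r ih =>
    obtain ⟨H, hH, hle, hn⟩ := hG
    have h1 := G.mul_mem (hn g hg _ (ih hH (hle hg))) (G.inv_mem hg)
    convert h1 using 1
    rw [iterComm]; group

theorem Units.val_iterComm {D : Type*} [DivisionRing D] (g x : Dˣ) (k : ℕ) :
    (iterComm g k x).val = iterComm g.val k x.val := by
  induction k with
  | zero => rfl
  | succ k ih => simp [iterComm, ih]

/-- Conjugation `x ↦ g x g⁻¹` as an additive endomorphism. -/
def conjEnd {D : Type*} [DivisionRing D] (g : D) : AddMonoid.End D :=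
  (AddMonoidHom.mulRight g⁻¹).comp (AddMonoidHom.mulLeft g)

@[simp] theorem conjEnd_apply {D : Type*} [DivisionRing D] (g x : D) :
    conjEnd g x = g * x * g⁻¹ := rfl

theorem one_sub_conjEnd_pow_succ {D : Type*} [DivisionRing D] (g x : D) (k : ℕ) :
    ((1 - conjEnd g) ^ (k + 1)) x =
      ((1 - conjEnd g) ^ k) x - g * ((1 - conjEnd g) ^ k) x * g⁻¹ := by
  rw [pow_succ']; rfl

namespace SkewPoly

variable {D : Type*} [DivisionRing D] (M : Subfield D) (n : D)

/-- Skew polynomials in `n` of degree `< d` over `M`, in Horner form. -/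
def bounded : ℕ → Set D
  | 0 => {0}
  | d + 1 => {x | ∃ m ∈ M, ∃ y ∈ bounded d, x = m + n * y}

/-- The skew polynomials in `n` over `M`. -/
def poly : Set D := {x | ∃ d, x ∈ bounded M n d}

/-- The skew polynomials in `n` over `M` with nonzero constant term. -/
def nzconst : Set D := {x | ∃ m ∈ M, m ≠ 0 ∧ ∃ y ∈ poly M n, x = m + n * y}

/-- The elements `d` with `q d` a multiple of `n²` for some `q` with nonzero constant term. -/
def small : Set D := {d | ∃ q ∈ nzconst M n, ∃ y ∈ poly M n, q * d = n * (n * y)}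

/-- The elements `d` with `q d` a skew polynomial for some `q` with nonzero constant term. -/
def jetRing : Set D := {d | ∃ q ∈ nzconst M n, q * d ∈ poly M n}

/-- The hypotheses on `n`: it normalizes `M` and is transcendental over `M`. -/
structure Transcendental : Prop where
  ne_zero : n ≠ 0
  conj_mem : ∀ m ∈ M, n * m * n⁻¹ ∈ M
  conj_mem' : ∀ m ∈ M, n⁻¹ * m * n ∈ M
  eq_zero : ∀ m ∈ M, ∀ y ∈ poly M n, m + n * y = 0 → m = 0

variable {M n}

theorem bounded_zero_mem (d : ℕ) : (0 : D) ∈ bounded M n d := by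
  induction d with
  | zero => rfl
  | succ d ih => exact ⟨0, M.zero_mem, 0, ih, by simp⟩

theorem bounded_succ {d : ℕ} {x : D} (hx : x ∈ bounded M n d) : x ∈ bounded M n (d + 1) := by
  induction d generalizing x with
  | zero => obtain rfl : x = 0 := hx; exact bounded_zero_mem 1
  | succ d ih =>
    obtain ⟨m, hm, y, hy, rfl⟩ := hx
    exact ⟨m, hm, y, ih hy, rfl⟩

theorem bounded_mono {d e : ℕ} (h : d ≤ e) {x : D} (hx : x ∈ bounded M n d) :
    x ∈ bounded M n e := by
  induction h with
  | refl => exact hx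
  | step _ ih => exact bounded_succ ih

theorem bounded_add {d : ℕ} {x y : D} (hx : x ∈ bounded M n d) (hy : y ∈ bounded M n d) :
    x + y ∈ bounded M n d := by
  induction d generalizing x y with
  | zero => obtain rfl : x = 0 := hx; obtain rfl : y = 0 := hy; simp [bounded]
  | succ d ih =>
    obtain ⟨m, hm, x', hx', rfl⟩ := hx
    obtain ⟨m', hm', y', hy', rfl⟩ := hy
    exact ⟨m + m', M.add_mem hm hm', x' + y', ih hx' hy', by rw [mul_add]; abel⟩

theorem bounded_neg {d : ℕ} {x : D} (hx : x ∈ bounded M n d) : -x ∈ bounded M n d := by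
  induction d generalizing x with
  | zero => obtain rfl : x = 0 := hx; simp [bounded]
  | succ d ih =>
    obtain ⟨m, hm, x', hx', rfl⟩ := hx
    exact ⟨-m, M.neg_mem hm, -x', ih hx', by rw [mul_neg]; abel⟩

theorem mem_poly_of_mem {m : D} (hm : m ∈ M) : m ∈ poly M n :=
  ⟨1, m, hm, 0, rfl, by simp⟩

theorem poly_add {x y : D} (hx : x ∈ poly M n) (hy : y ∈ poly M n) : x + y ∈ poly M n := by
  obtain ⟨d, hx⟩ := hx
  obtain ⟨e, hy⟩ := hy
  exact ⟨max d e, bounded_add (bounded_mono (le_max_left _ _) hx)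
    (bounded_mono (le_max_right _ _) hy)⟩

theorem poly_neg {x : D} (hx : x ∈ poly M n) : -x ∈ poly M n :=
  hx.imp fun _ => bounded_neg

theorem poly_sub {x y : D} (hx : x ∈ poly M n) (hy : y ∈ poly M n) : x - y ∈ poly M n := by
  rw [sub_eq_add_neg]; exact poly_add hx (poly_neg hy)

theorem poly_n_mul {x : D} (hx : x ∈ poly M n) : n * x ∈ poly M n := by
  obtain ⟨d, hx⟩ := hx
  exact ⟨d + 1, 0, M.zero_mem, x, hx, by simp⟩

theorem poly_of_nzconst {x : D} (hx : x ∈ nzconst M n) : x ∈ poly M n := by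
  obtain ⟨m, hm, -, y, hy, rfl⟩ := hx
  exact poly_add (mem_poly_of_mem hm) (poly_n_mul hy)

theorem one_mem_nzconst : (1 : D) ∈ nzconst M n :=
  ⟨1, M.one_mem, one_ne_zero, 0, mem_poly_of_mem M.zero_mem, by simp⟩

theorem bounded_map {f : D → D} (hadd : ∀ x y, f (x + y) = f x + f y)
    (hmul : ∀ x, f (n * x) = n * f x) (hM : ∀ m ∈ M, f m ∈ M) {d : ℕ} {x : D}
    (hx : x ∈ bounded M n d) : f x ∈ bounded M n d := by
  induction d generalizing x with
  | zero =>
    obtain rfl : x = 0 := hx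
    have : f 0 = 0 := by simpa using hadd 0 0
    rw [this]; rfl
  | succ d ih =>
    obtain ⟨m, hm, y, hy, rfl⟩ := hx
    exact ⟨f m, hM m hm, f y, ih hy, by rw [hadd, hmul]⟩

theorem bounded_mul_left (h0 : n ≠ 0) (hc : ∀ m ∈ M, n⁻¹ * m * n ∈ M) {d : ℕ} {m x : D}
    (hm : m ∈ M) (hx : x ∈ bounded M n d) : m * x ∈ bounded M n d := by
  induction d generalizing x m with
  | zero => obtain rfl : x = 0 := hx; simp [bounded]
  | succ d ih =>
    obtain ⟨m', hm', y, hy, rfl⟩ := hx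
    refine ⟨m * m', M.mul_mem hm hm', _, ih (hc m hm) hy, ?_⟩
    simp [mul_add, mul_assoc, h0]

theorem bounded_mul_right {d : ℕ} {m x : D} (hm : m ∈ M) (hx : x ∈ bounded M n d) :
    x * m ∈ bounded M n d := by
  induction d generalizing x with
  | zero => obtain rfl : x = 0 := hx; simp [bounded]
  | succ d ih =>
    obtain ⟨m', hm', y, hy, rfl⟩ := hx
    exact ⟨m' * m, M.mul_mem hm' hm, _, ih hy, by rw [add_mul, mul_assoc]⟩

end SkewPoly

namespace SkewPoly
namespace Transcendental

variable {D : Type*} [DivisionRing D] {M : Subfield D} {n : D}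

theorem poly_mul (h : Transcendental M n)
    {x y : D} (hx : x ∈ poly M n) (hy : y ∈ poly M n) : x * y ∈ poly M n := by
  obtain ⟨d, hx⟩ := hx
  induction d generalizing x with
  | zero => obtain rfl : x = 0 := hx; rw [zero_mul]; exact mem_poly_of_mem M.zero_mem
  | succ d ih =>
    obtain ⟨m, hm, x', hx', rfl⟩ := hx
    rw [add_mul, mul_assoc n]
    exact poly_add (hy.imp fun _ => bounded_mul_left h.ne_zero h.conj_mem' hm) (poly_n_mul (ih hx'))

theorem poly_conj (h : Transcendental M n) {x : D} (hx : x ∈ poly M n) : n * x * n⁻¹ ∈ poly M n :=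
  hx.imp fun _ hx => bounded_map (f := fun x => n * x * n⁻¹)
    (fun x y => by simp [mul_add, add_mul]) (fun x => by simp [mul_assoc]) h.conj_mem hx

theorem bounded_conj' (h : Transcendental M n)
    {d : ℕ} {x : D} (hx : x ∈ bounded M n d) : n⁻¹ * x * n ∈ bounded M n d :=
  bounded_map (f := fun x => n⁻¹ * x * n)
    (fun x y => by simp [mul_add, add_mul]) (fun x => by simp [mul_assoc, h.ne_zero])
    h.conj_mem' hx

theorem poly_conj' (h : Transcendental M n) {x : D} (hx : x ∈ poly M n) : n⁻¹ * x * n ∈ poly M n :=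
  hx.imp fun _ hx => h.bounded_conj' hx

theorem nzconst_conj (h : Transcendental M n)
    {x : D} (hx : x ∈ nzconst M n) : n * x * n⁻¹ ∈ nzconst M n := by
  obtain ⟨m, hm, h0, y, hy, rfl⟩ := hx
  refine ⟨_, h.conj_mem m hm, by simp [h0, h.ne_zero], _, h.poly_conj hy, ?_⟩
  simp [mul_add, add_mul, mul_assoc]

theorem nzconst_conj' (h : Transcendental M n)
    {x : D} (hx : x ∈ nzconst M n) : n⁻¹ * x * n ∈ nzconst M n := by
  obtain ⟨m, hm, h0, y, hy, rfl⟩ := hx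
  refine ⟨_, h.conj_mem' m hm, by simp [h0, h.ne_zero], _, h.poly_conj' hy, ?_⟩
  simp [mul_add, add_mul, mul_assoc, h.ne_zero]

theorem nzconst_mul (h : Transcendental M n)
    {x y : D} (hx : x ∈ nzconst M n) (hy : y ∈ nzconst M n) :
    x * y ∈ nzconst M n := by
  have hy' := poly_of_nzconst hy
  obtain ⟨a, ha, ha0, x, hx, rfl⟩ := hx
  obtain ⟨b, hb, hb0, y, hy, rfl⟩ := hy
  refine ⟨a * b, M.mul_mem ha hb, mul_ne_zero ha0 hb0, (n⁻¹ * a * n) * y + x * (b + n * y),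
    poly_add (h.poly_mul (mem_poly_of_mem (h.conj_mem' a ha)) hy) (h.poly_mul hx hy'), ?_⟩
  simp only [mul_add, add_mul, mul_assoc, mul_inv_cancel_left₀ h.ne_zero]
  abel

theorem nzconst_add_n_mul {x y : D} (hx : x ∈ nzconst M n) (hy : y ∈ poly M n) :
    x + n * y ∈ nzconst M n := by
  obtain ⟨a, ha, ha0, x, hx, rfl⟩ := hx
  exact ⟨a, ha, ha0, x + y, poly_add hx hy, by rw [mul_add, add_assoc]⟩

theorem nzconst_ne (h : Transcendental M n)
    {x y : D} (hx : x ∈ nzconst M n) (hy : y ∈ poly M n) : x ≠ n * y := by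
  obtain ⟨a, ha, ha0, x, hx, rfl⟩ := hx
  intro he
  exact ha0 (h.eq_zero a ha (x - y) (poly_sub hx hy) (by rw [mul_sub, ← add_sub_assoc, he,
    sub_self]))

theorem ore_aux (h : Transcendental M n)
    (N : ℕ) : ∀ (d e : ℕ) (P Q : D), d + e ≤ N → P ∈ bounded M n d →
    Q ∈ bounded M n e → Q ∈ nzconst M n → ∃ A ∈ poly M n, ∃ B ∈ nzconst M n, A * Q = B * P := by
  induction N with
  | zero =>
    intro d e P Q hde hP _ _
    obtain rfl : d = 0 := by omega
    obtain rfl : P = 0 := hP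
    exact ⟨0, mem_poly_of_mem M.zero_mem, 1, one_mem_nzconst, by simp⟩
  | succ N ih =>
    intro d e P Q hde hP hQ hQn
    have hn := h.ne_zero
    rcases d with _ | d
    · obtain rfl : P = 0 := hP
      exact ⟨0, mem_poly_of_mem M.zero_mem, 1, one_mem_nzconst, by simp⟩
    rcases e with _ | e
    · obtain rfl : Q = 0 := hQ
      exact absurd (mul_zero n).symm (h.nzconst_ne hQn (mem_poly_of_mem M.zero_mem))
    obtain ⟨p, hp, P', hP', hPe⟩ := hP
    obtain ⟨q, hq, Q', hQ', hQe⟩ := hQ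
    have hq0 : q ≠ 0 := by
      rintro rfl
      exact h.nzconst_ne hQn ⟨e, hQ'⟩ (by rw [hQe, zero_add])
    have hpq : p * q⁻¹ ∈ M := M.mul_mem hp (M.inv_mem hq)
    by_cases hle : p = 0 ∨ e ≤ d
    · have key : ∃ P₁ ∈ bounded M n d, P = p * q⁻¹ * Q + n * P₁ := by
        rcases hle with rfl | hle
        · exact ⟨P', hP', by simp [hPe]⟩
        · refine ⟨P' - (n⁻¹ * (p * q⁻¹) * n) * Q', ?_, ?_⟩
          · rw [sub_eq_add_neg]
            exact bounded_add hP' (bounded_neg (bounded_mul_left h.ne_zero h.conj_mem' (h.conj_mem' _ hpq)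
              (bounded_mono hle hQ')))
          · rw [hPe, hQe]
            simp only [mul_add, mul_sub, mul_assoc, mul_inv_cancel_left₀ hn, inv_mul_cancel₀ hq0]
            simp
      obtain ⟨P₁, hP₁, hP₁e⟩ := key
      obtain ⟨A₁, hA, B₁, hB, hAB⟩ := ih d (e + 1) P₁ Q (by omega) hP₁ ⟨q, hq, Q', hQ', hQe⟩ hQn
      refine ⟨n * B₁ * n⁻¹ * (p * q⁻¹) + n * A₁, poly_add (h.poly_mul
        (poly_of_nzconst (h.nzconst_conj hB)) (mem_poly_of_mem hpq)) (poly_n_mul hA),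
        n * B₁ * n⁻¹, h.nzconst_conj hB, ?_⟩
      rw [hP₁e, add_mul, mul_assoc n A₁, hAB]
      simp only [mul_add, mul_assoc, inv_mul_cancel_left₀ hn]
    · push Not at hle
      obtain ⟨hp0, hle⟩ := hle
      have hqp : q * p⁻¹ ∈ M := M.mul_mem hq (M.inv_mem hp)
      obtain ⟨A₁, hA, B₁, hB, hAB⟩ := ih e (d + 1) (Q' - (n⁻¹ * (q * p⁻¹) * n) * P') P (by omega)
        (by
          rw [sub_eq_add_neg]
          exact bounded_add hQ' (bounded_neg (bounded_mul_left h.ne_zero h.conj_mem' (h.conj_mem' _ hqp)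
              (bounded_mono hle.le hP')))) ⟨p, hp, P', hP', hPe⟩ ⟨p, hp, hp0, P', ⟨d, hP'⟩, hPe⟩
      have hQ₁e : Q = q * p⁻¹ * P + n * (Q' - (n⁻¹ * (q * p⁻¹) * n) * P') := by
        rw [hPe, hQe]
        simp only [mul_add, mul_sub, mul_assoc, mul_inv_cancel_left₀ hn, inv_mul_cancel₀ hp0]
        simp
      have hB' := h.nzconst_conj hB
      refine ⟨n * B₁ * n⁻¹, poly_of_nzconst hB', n * B₁ * n⁻¹ * (q * p⁻¹) + n * A₁,
        nzconst_add_n_mul (h.nzconst_mul hB' ⟨_, hqp, mul_ne_zero hq0 (inv_ne_zero hp0), 0,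
          mem_poly_of_mem M.zero_mem, by simp⟩) hA, ?_⟩
      rw [add_mul, mul_assoc n A₁, hAB]
      conv_lhs => rw [hQ₁e]
      simp only [mul_add, mul_assoc, inv_mul_cancel_left₀ hn]

/-- The Ore condition for skew polynomials with nonzero constant term. -/
theorem ore (h : Transcendental M n) {P Q : D} (hP : P ∈ poly M n) (hQ : Q ∈ nzconst M n) :
    ∃ A ∈ poly M n, ∃ B ∈ nzconst M n, A * Q = B * P := by
  obtain ⟨d, hd⟩ := hP
  obtain ⟨e, he⟩ := poly_of_nzconst hQ
  exact h.ore_aux (d + e) d e P Q le_rfl hd he hQ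

theorem local_add (h : Transcendental M n)
    {x y : D} (hx : x ∈ jetRing M n) (hy : y ∈ jetRing M n) : x + y ∈ jetRing M n := by
  obtain ⟨Q₁, hQ₁, h₁⟩ := hx
  obtain ⟨Q₂, hQ₂, h₂⟩ := hy
  obtain ⟨A, hA, B, hB, e⟩ := h.ore (poly_of_nzconst hQ₁) hQ₂
  refine ⟨B * Q₁, h.nzconst_mul hB hQ₁, ?_⟩
  rw [mul_add, mul_assoc, ← e, mul_assoc]
  exact poly_add (h.poly_mul (poly_of_nzconst hB) h₁) (h.poly_mul hA h₂)

theorem mul_n_mul_n (h : Transcendental M n)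
    (x : D) : x * (n * n) = n * (n * (n⁻¹ * (n⁻¹ * x * n) * n)) := by
  simp only [mul_assoc, mul_inv_cancel_left₀ h.ne_zero]

theorem local_mul_small (h : Transcendental M n)
    {x y : D} (hx : x ∈ jetRing M n) (hy : y ∈ small M n) :
    x * y ∈ small M n := by
  obtain ⟨Q₁, hQ₁, h₁⟩ := hx
  obtain ⟨Q₂, hQ₂, z, hz, h₂⟩ := hy
  obtain ⟨A, hA, B, hB, e⟩ := h.ore h₁ hQ₂
  refine ⟨B * Q₁, h.nzconst_mul hB hQ₁, _, h.poly_mul (h.poly_conj' (h.poly_conj' hA)) hz, ?_⟩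
  have : B * Q₁ * (x * y) = A * (n * n) * z := by
    rw [mul_assoc A, mul_assoc n, ← h₂, ← mul_assoc A, e]; simp only [mul_assoc]
  rw [this, h.mul_n_mul_n]
  simp only [mul_assoc]

theorem small_mul_local (h : Transcendental M n)
    {x y : D} (hx : x ∈ small M n) (hy : y ∈ jetRing M n) :
    x * y ∈ small M n := by
  obtain ⟨Q₁, hQ₁, z, hz, h₁⟩ := hx
  obtain ⟨Q₂, hQ₂, h₂⟩ := hy
  obtain ⟨A, hA, B, hB, e⟩ := h.ore hz hQ₂
  refine ⟨n * (n * B * n⁻¹) * n⁻¹ * Q₁, h.nzconst_mul (h.nzconst_conj (h.nzconst_conj hB)) hQ₁,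
    _, h.poly_mul hA h₂, ?_⟩
  rw [← mul_assoc A, e]
  have : n * (n * B * n⁻¹) * n⁻¹ * Q₁ * (x * y) = n * (n * B * n⁻¹) * n⁻¹ * (Q₁ * x) * y := by
    simp only [mul_assoc]
  rw [this, h₁]
  simp only [mul_assoc, inv_mul_cancel_left₀ h.ne_zero]

theorem small_add (h : Transcendental M n)
    {x y : D} (hx : x ∈ small M n) (hy : y ∈ small M n) : x + y ∈ small M n := by
  obtain ⟨Q₁, hQ₁, z, hz, h₁⟩ := hx
  obtain ⟨Q₂, hQ₂, w, hw, h₂⟩ := hy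
  obtain ⟨A, hA, B, hB, e⟩ := h.ore (poly_of_nzconst hQ₁) hQ₂
  refine ⟨B * Q₁, h.nzconst_mul hB hQ₁, _, poly_add
    (h.poly_mul (h.poly_conj' (h.poly_conj' (poly_of_nzconst hB))) hz)
    (h.poly_mul (h.poly_conj' (h.poly_conj' hA)) hw), ?_⟩
  have h3 : B * Q₁ * (x + y) = B * (n * n) * z + A * (n * n) * w := by
    rw [mul_assoc A, mul_assoc n n w, ← h₂, ← mul_assoc A, e, mul_assoc B (n * n),
      mul_assoc n n z, ← h₁]
    simp only [mul_add, mul_assoc]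
  rw [h3, h.mul_n_mul_n, h.mul_n_mul_n A]
  simp only [mul_assoc, mul_add]

theorem small_neg {x : D} (hx : x ∈ small M n) : -x ∈ small M n := by
  obtain ⟨Q, hQ, z, hz, e⟩ := hx
  exact ⟨Q, hQ, -z, poly_neg hz, by simp [e]⟩

theorem local_of_poly {x : D} (hx : x ∈ poly M n) : x ∈ jetRing M n :=
  ⟨1, one_mem_nzconst, by rwa [one_mul]⟩

theorem local_of_small {x : D} (hx : x ∈ small M n) : x ∈ jetRing M n := by
  obtain ⟨Q, hQ, z, hz, e⟩ := hx
  exact ⟨Q, hQ, e ▸ poly_n_mul (poly_n_mul hz)⟩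

theorem eq_zero_of_nzconst_mul (h : Transcendental M n)
    {q m y : D} (hq : q ∈ nzconst M n) (hm : m ∈ M)
    (hy : y ∈ poly M n) (e : q * m = n * y) : m = 0 := by
  obtain ⟨a, ha, ha0, x, hx, rfl⟩ := hq
  have := h.eq_zero (a * m) (M.mul_mem ha hm) (x * m - y)
    (poly_sub (h.poly_mul hx (mem_poly_of_mem hm)) hy) (by
      rw [mul_sub, ← mul_assoc, ← add_sub_assoc, ← add_mul, e, sub_self])
  exact (mul_eq_zero.1 this).resolve_left ha0

theorem eq_zero_of_mem_small (h : Transcendental M n)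
    {a b : D} (ha : a ∈ M) (hb : b ∈ M) (hs : a + n * b ∈ small M n) :
    a = 0 ∧ b = 0 := by
  obtain ⟨Q, hQ, y, hy, e⟩ := hs
  have hn := h.ne_zero
  obtain rfl : a = 0 := by
    refine h.eq_zero_of_nzconst_mul hQ ha (y := n * y - n⁻¹ * Q * n * b) (poly_sub (poly_n_mul hy)
      (h.poly_mul (poly_of_nzconst (h.nzconst_conj' hQ)) (mem_poly_of_mem hb))) ?_
    rw [mul_sub, ← e]
    simp only [mul_assoc, mul_add, mul_inv_cancel_left₀ hn]
    simp
  refine ⟨rfl, h.eq_zero_of_nzconst_mul (h.nzconst_conj' hQ) hb hy ?_⟩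
  rw [zero_add] at e
  simp only [mul_assoc, e, inv_mul_cancel_left₀ hn]

end Transcendental

variable {D : Type*} [DivisionRing D] (M : Subfield D) (n : D)

/-- `d` agrees with `1 + v` to second order in `n`, where `v` is linear in `n`. -/
def Jet (d v : D) : Prop := (∃ m ∈ M, v = n * m) ∧ d - 1 - v ∈ small M n

variable {M n}

namespace Transcendental

theorem jet_one_add {m : D} (hm : m ∈ M) : Jet M n (1 + n * m) (n * m) :=
  ⟨⟨m, hm, rfl⟩, 1, one_mem_nzconst, 0, mem_poly_of_mem M.zero_mem, by simp⟩

theorem small_of_linear (h : Transcendental M n)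
    {v v' : D} (hv : ∃ m ∈ M, v = n * m) (hv' : ∃ m ∈ M, v' = n * m) :
    v * v' ∈ small M n := by
  obtain ⟨m, hm, rfl⟩ := hv
  obtain ⟨m', hm', rfl⟩ := hv'
  refine ⟨1, one_mem_nzconst, _, h.poly_mul (mem_poly_of_mem (h.conj_mem' _ hm))
    (mem_poly_of_mem hm'), ?_⟩
  simp only [mul_assoc, one_mul, mul_inv_cancel_left₀ h.ne_zero]

theorem local_of_jet (h : Transcendental M n) {d v : D} (hj : Jet M n d v) : d ∈ jetRing M n := by
  obtain ⟨⟨m, hm, rfl⟩, hs⟩ := hj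
  have := h.local_add (local_of_small hs) (local_of_poly (poly_add (x := 1)
    (poly_of_nzconst one_mem_nzconst) (poly_n_mul (mem_poly_of_mem hm))))
  convert this using 1
  abel

theorem jet_mul (h : Transcendental M n) {d v d' v' : D} (hj : Jet M n d v) (hj' : Jet M n d' v') :
    Jet M n (d * d') (v + v') := by
  constructor
  · obtain ⟨m, hm, rfl⟩ := hj.1
    obtain ⟨m', hm', rfl⟩ := hj'.1
    exact ⟨m + m', M.add_mem hm hm', (mul_add _ _ _).symm⟩
  · have h1 := h.small_mul_local hj.2 (h.local_of_jet hj')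
    have h2 : (1 + v) * (d' - 1 - v') ∈ small M n := by
      refine h.local_mul_small (local_of_poly ?_) hj'.2
      obtain ⟨m, hm, rfl⟩ := hj.1
      exact poly_add (poly_of_nzconst one_mem_nzconst) (poly_n_mul (mem_poly_of_mem hm))
    have h3 := h.small_add (h.small_add h1 h2) (h.small_of_linear hj.1 hj'.1)
    convert h3 using 1
    noncomm_ring

theorem local_inv_of_jet (h : Transcendental M n)
    {d v : D} (hj : Jet M n d v) : d ≠ 0 ∧ d⁻¹ ∈ jetRing M n := by
  obtain ⟨⟨m, hm, rfl⟩, Q, hQ, y, hy, e⟩ := hj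
  have hQd : Q * d ∈ nzconst M n := by
    have : Q * d = Q + n * ((n⁻¹ * Q * n) * m + n * y) := by
      rw [mul_add n, ← e]
      simp only [mul_assoc, mul_sub, mul_inv_cancel_left₀ h.ne_zero]
      simp
    rw [this]
    exact nzconst_add_n_mul hQ (poly_add (h.poly_mul
      (h.poly_conj' (poly_of_nzconst hQ)) (mem_poly_of_mem hm)) (poly_n_mul hy))
  have hd : d ≠ 0 := by
    rintro rfl
    exact h.nzconst_ne hQd (mem_poly_of_mem M.zero_mem) (by simp)
  exact ⟨hd, Q * d, hQd, by rw [mul_assoc, mul_inv_cancel₀ hd, mul_one]; exact poly_of_nzconst hQ⟩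

theorem jet_inv (h : Transcendental M n) {d v : D} (hj : Jet M n d v) : Jet M n d⁻¹ (-v) := by
  obtain ⟨hd, hl⟩ := h.local_inv_of_jet hj
  constructor
  · obtain ⟨m, hm, rfl⟩ := hj.1
    exact ⟨-m, M.neg_mem hm, (mul_neg _ _).symm⟩
  · have hv : v ∈ jetRing M n := by
      obtain ⟨m, hm, rfl⟩ := hj.1
      exact local_of_poly (poly_n_mul (mem_poly_of_mem hm))
    have h1 := h.small_mul_local hj.2 hv
    have h2 := h.small_add (h.small_add h1 (h.small_of_linear hj.1 hj.1)) (small_neg hj.2)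
    have h3 := h.local_mul_small hl h2
    convert h3 using 1
    have e1 : d⁻¹ - 1 - -v = d⁻¹ * (d * (d⁻¹ - 1 - -v)) := by rw [inv_mul_cancel_left₀ hd]
    rw [e1]
    congr 1
    rw [mul_sub, mul_sub, mul_inv_cancel₀ hd]
    noncomm_ring

theorem jet_conj {g : D} (hg0 : g ≠ 0) (hg : g * n = n * g) (hgM : ∀ m ∈ M, g * m * g⁻¹ ∈ M)
    {d v : D} (hj : Jet M n d v) : Jet M n (g * d * g⁻¹) (g * v * g⁻¹) := by
  have hp : ∀ x ∈ poly M n, g * x * g⁻¹ ∈ poly M n := fun x hx =>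
    hx.imp fun _ hx => bounded_map (f := fun x => g * x * g⁻¹)
      (fun x y => by simp [mul_add, add_mul])
      (fun x => by simp only [← mul_assoc, hg]) hgM hx
  constructor
  · obtain ⟨m, hm, rfl⟩ := hj.1
    exact ⟨_, hgM m hm, by simp only [← mul_assoc, hg]⟩
  · obtain ⟨Q, hQ, y, hy, e⟩ := hj.2
    refine ⟨g * Q * g⁻¹, ?_, _, hp y hy, ?_⟩
    · obtain ⟨m, hm, hm0, x, hx, rfl⟩ := hQ
      exact ⟨_, hgM m hm, by simp [hm0, hg0], _, hp x hx, by
        simp only [← mul_assoc, mul_add, add_mul, hg]⟩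
    · have e1 : g * d * g⁻¹ - 1 - g * v * g⁻¹ = g * (d - 1 - v) * g⁻¹ := by
        simp [mul_sub, sub_mul, hg0]
      have e2 : g * Q * g⁻¹ * (g * (d - 1 - v) * g⁻¹) = g * (Q * (d - 1 - v)) * g⁻¹ := by
        simp only [mul_assoc, inv_mul_cancel_left₀ hg0]
      rw [e1, e2, e]
      simp only [← mul_assoc, hg]
      rw [mul_assoc n g n, hg, ← mul_assoc]

theorem jet_iterComm (h : Transcendental M n) {g : D} (hg0 : g ≠ 0) (hg : g * n = n * g)
    (hgM : ∀ m ∈ M, g * m * g⁻¹ ∈ M) {m : D} (hm : m ∈ M) (k : ℕ) :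
    Jet M n (iterComm g k (1 + n * m)) (((1 - conjEnd g) ^ k) (n * m)) := by
  induction k with
  | zero => exact jet_one_add hm
  | succ k ih =>
    rw [one_sub_conjEnd_pow_succ, sub_eq_add_neg]
    exact h.jet_mul ih (h.jet_inv (jet_conj hg0 hg hgM ih))

theorem jet_commute (h : Transcendental M n)
    {d v m m' : D} (hj : Jet M n d v) (hm : m ∈ M) (hm' : m' ∈ M)
    (e : d * m = m' * d) : m = m' ∧ v * m = m * v := by
  have h1 := h.small_mul_local hj.2 (local_of_poly (mem_poly_of_mem hm))
  have h2 := h.local_mul_small (local_of_poly (mem_poly_of_mem hm')) hj.2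
  have h3 := h.small_add h1 (small_neg h2)
  obtain ⟨a, ha, rfl⟩ := hj.1
  obtain ⟨h4, h5⟩ := h.eq_zero_of_mem_small (M.sub_mem hm' hm)
    (M.sub_mem (M.mul_mem (h.conj_mem' _ hm') ha) (M.mul_mem ha hm)) (by
      convert h3 using 1
      simp only [mul_sub, sub_mul, e, mul_assoc, mul_inv_cancel_left₀ h.ne_zero]
      simp only [mul_one, one_mul]
      abel)
  obtain rfl := sub_eq_zero.1 h4
  refine ⟨rfl, ?_⟩
  rw [mul_assoc, ← sub_eq_zero.1 h5]
  simp only [mul_assoc, mul_inv_cancel_left₀ h.ne_zero]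

theorem jet_eq_zero (h : Transcendental M n) {d v : D} (hj : Jet M n d v) (hd : d ∈ M) : v = 0 := by
  obtain ⟨⟨a, ha, rfl⟩, hs⟩ := hj
  have := h.eq_zero_of_mem_small (M.sub_mem hd M.one_mem) (M.neg_mem ha)
    (by rwa [mul_neg, ← sub_eq_add_neg])
  rw [neg_eq_zero.1 this.2, mul_zero]

end Transcendental
end SkewPoly

section
variable {D : Type*} [DivisionRing D]

theorem one_sub_conjEnd_pow_eq {g x c : D} (hx : g * x * g⁻¹ = c * x)
    (hc : g * c = c * g) (k : ℕ) : ((1 - conjEnd g) ^ k) x = (1 - c) ^ k * x := by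
  induction k with
  | zero => simp
  | succ k ih =>
    have h1 : Commute g ((1 - c) ^ k) := ((Commute.one_right g).sub_right hc).pow_right k
    have h2 : g * ((1 - c) ^ k * x) * g⁻¹ = (1 - c) ^ k * (c * x) := by
      rw [← hx, ← mul_assoc g, h1.eq]; simp only [mul_assoc]
    rw [one_sub_conjEnd_pow_succ, ih, h2, pow_succ, mul_assoc, sub_mul, one_mul, mul_sub]

theorem eq_of_one_sub_conjEnd_pow_eq_zero {g x c : D} (hx0 : x ≠ 0)
    (hx : g * x * g⁻¹ = c * x) (hc : g * c = c * g) {k : ℕ}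
    (h : ((1 - conjEnd g) ^ k) x = 0) : c = 1 := by
  rw [one_sub_conjEnd_pow_eq hx hc] at h
  have := eq_zero_of_pow_eq_zero ((mul_eq_zero.1 h).resolve_right hx0)
  exact (sub_eq_zero.1 this).symm

theorem Subfield.one_sub_conjEnd_pow_mem {K : Subfield D} {g : D} (hg : ∀ x ∈ K, g * x * g⁻¹ ∈ K)
    {x : D} (hx : x ∈ K) (k : ℕ) : ((1 - conjEnd g) ^ k) x ∈ K := by
  induction k with
  | zero => exact hx
  | succ k ih => rw [one_sub_conjEnd_pow_succ]; exact K.sub_mem ih (hg _ ih)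

theorem Subfield.iterComm_mem {K : Subfield D} {g : D} (hg : ∀ x ∈ K, g * x * g⁻¹ ∈ K)
    {x : D} (hx : x ∈ K) (k : ℕ) : iterComm g k x ∈ K := by
  induction k with
  | zero => exact hx
  | succ k ih => exact K.mul_mem ih (K.inv_mem (hg _ ih))

theorem exists_fixed_of_one_sub_conjEnd_pow {V : Set D} {g x : D} (hx : x ∈ V) (hx0 : x ≠ 0)
    (hV : ∀ x ∈ V, x - g * x * g⁻¹ ∈ V) {N : ℕ} (hN : ((1 - conjEnd g) ^ N) x = 0) :
    ∃ v ∈ V, v ≠ 0 ∧ g * v * g⁻¹ = v := by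
  induction N with
  | zero => exact absurd hN hx0
  | succ N ih =>
    by_cases h : ((1 - conjEnd g) ^ N) x = 0
    · exact ih h
    · refine ⟨_, ?_, h, ?_⟩
      · clear ih hN h
        induction N with
        | zero => exact hx
        | succ N ih => rw [one_sub_conjEnd_pow_succ]; exact hV _ ih
      · rw [one_sub_conjEnd_pow_succ, sub_eq_zero] at hN
        exact hN.symm

theorem exists_conj_eq_add_one {K : Subfield D} {g x : D} (hg0 : g ≠ 0)
    (hg : ∀ x ∈ K, g * x * g⁻¹ ∈ K) (hx : x ∈ K) (hgx : g * x * g⁻¹ ≠ x) {N : ℕ}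
    (hN : ((1 - conjEnd g) ^ N) x = 0) : ∃ w ∈ K, g * w * g⁻¹ = w + 1 := by
  obtain ⟨u, ⟨z, hz, rfl⟩, hu0, hu⟩ := exists_fixed_of_one_sub_conjEnd_pow
    (V := {u | ∃ z ∈ K, u = z - g * z * g⁻¹}) (x := x - g * x * g⁻¹) (g := g) (N := N)
    ⟨x, hx, rfl⟩ (sub_ne_zero.2 (Ne.symm hgx))
    (by
      rintro _ ⟨z, hz, rfl⟩
      exact ⟨_, K.sub_mem hz (hg z hz), rfl⟩)
    (by
      have : ((1 - conjEnd g) ^ (N + 1)) x = 0 := by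
        rw [one_sub_conjEnd_pow_succ, hN]; simp
      rw [pow_succ] at this
      exact this)
  refine ⟨-(z * (z - g * z * g⁻¹)⁻¹), K.neg_mem (K.mul_mem hz (K.inv_mem (K.sub_mem hz
    (hg z hz)))), ?_⟩
  have h1 : g * (z - g * z * g⁻¹)⁻¹ * g⁻¹ = (z - g * z * g⁻¹)⁻¹ := by
    conv_rhs => rw [← hu]
    simp [_root_.mul_inv_rev, mul_assoc]
  set u := z - g * z * g⁻¹ with hud
  have h2 : g * z * g⁻¹ = z - u := by rw [hud]; abel
  have h3 : g * -(z * u⁻¹) * g⁻¹ = -((g * z * g⁻¹) * (g * u⁻¹ * g⁻¹)) := by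
    simp only [mul_assoc, inv_mul_cancel_left₀ hg0, mul_neg, neg_mul]
  rw [h3, h1, h2, sub_mul, mul_inv_cancel₀ hu0]
  abel

theorem iterComm_ne_zero {g w : D} (hg : g ≠ 0) (hw : w ≠ 0) (k : ℕ) : iterComm g k w ≠ 0 := by
  rw [← Units.val_mk0 hw, ← Units.val_mk0 hg, ← Units.val_iterComm]
  exact Units.ne_zero _

theorem conj_iterComm {g w : D} (hg : g ≠ 0) (hw : w ≠ 0) (k : ℕ) :
    g * iterComm g k w * g⁻¹ = (iterComm g (k + 1) w)⁻¹ * iterComm g k w := by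
  simp [iterComm, iterComm_ne_zero hg hw k]

/-- If `g` acts unipotently by conjugation, then nontrivial commutators iterate to nontrivial
commutators. -/
theorem conj_eq_of_iterComm_eq_one {K : Subfield D} {g w : D} (hg0 : g ≠ 0)
    (hg : ∀ x ∈ K, g * x * g⁻¹ ∈ K) (hw : w ∈ K) (hw0 : w ≠ 0) {N : ℕ}
    (hN : ∀ x ∈ K, ((1 - conjEnd g) ^ N) x = 0) (k : ℕ) (h : iterComm g (k + 1) w = 1) :
    g * w * g⁻¹ = w := by
  induction k with
  | zero =>
    have h2 := conj_iterComm hg0 hw0 0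
    rw [h] at h2
    simpa [iterComm] using h2
  | succ k ih =>
    have hfix : g * iterComm g (k + 1) w * g⁻¹ = iterComm g (k + 1) w := by
      rw [conj_iterComm hg0 hw0, h]; simp
    apply ih
    rw [mul_inv_eq_iff_eq_mul₀ hg0] at hfix
    have := eq_of_one_sub_conjEnd_pow_eq_zero (iterComm_ne_zero hg0 hw0 k)
      (conj_iterComm hg0 hw0 k) (Commute.inv_right₀ hfix)
      (hN _ (Subfield.iterComm_mem hg hw k))
    exact inv_eq_one.1 this

/-- If the elements of a subnormal subgroup act on a division subring containing it by unipotent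
conjugations, then they act trivially. -/
theorem commute_of_unipotent {r : ℕ} {G : Subgroup Dˣ} (hG : SubnormalDepth r G)
    {K : Subfield D} (hGK : ∀ g ∈ G, g.val ∈ K) {N : ℕ}
    (hN : ∀ g ∈ G, ∀ x ∈ K, ((1 - conjEnd g.val) ^ N) x = 0) :
    ∀ g ∈ G, ∀ x ∈ K, g.val * x = x * g.val := by
  intro b hb x hx
  by_contra hne
  have hbK : ∀ g ∈ G, ∀ x ∈ K, g.val * x * g.val⁻¹ ∈ K := fun g hg x hx =>
    K.mul_mem (K.mul_mem (hGK g hg) hx) (K.inv_mem (hGK g hg))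
  obtain ⟨w, hw, hbw⟩ := exists_conj_eq_add_one b.ne_zero (hbK b hb) hx
    (fun h => hne (by rwa [mul_inv_eq_iff_eq_mul₀ b.ne_zero] at h)) (hN b hb x hx)
  have hw0 : w ≠ 0 := by rintro rfl; simp at hbw
  -- the double centralizer of `w`
  let E : Set D := {x | ∀ c, c * w = w * c → c * x = x * c}
  have hEcomm : ∀ x ∈ E, ∀ y ∈ E, x * y = y * x := fun x hx y hy => hy x (hx w rfl).symm
  have hEb : ∀ x ∈ E, b.val * x * b.val⁻¹ ∈ E := by
    intro x hx c hc
    have h1 : (b.val⁻¹ * c * b) * w = w * (b.val⁻¹ * c * b) := by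
      have h2 : b.val * w = (w + 1) * b := by
        rw [← hbw, inv_mul_cancel_right₀ b.ne_zero]
      have h3 : w * b.val⁻¹ = b.val⁻¹ * (w + 1) := by
        rw [mul_inv_eq_iff_eq_mul₀ b.ne_zero, mul_assoc, ← h2, inv_mul_cancel_left₀ b.ne_zero]
      rw [mul_assoc, h2, ← mul_assoc, mul_assoc b.val⁻¹, mul_add, hc, mul_one, ← mul_assoc w,
        ← mul_assoc w, h3, mul_assoc b.val⁻¹ (w + 1), add_mul, one_mul]
    have h2 := hx _ h1
    have h3 := congrArg (fun t => b.val * t * b.val⁻¹) h2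
    simpa [mul_assoc] using h3
  have hEW : ∀ k, iterComm b.val k w ∈ E := by
    intro k
    induction k with
    | zero => exact fun c hc => hc
    | succ k ih =>
      intro c hc
      exact (Commute.mul_right (ih c hc) (Commute.inv_right₀ (hEb _ ih c hc)))
  have hlast : iterComm b.val (r + 1) w = 1 := by
    have hy : iterComm b r (Units.mk0 w hw0) ∈ G := hG.iterComm_mem hb _
    have hyv : (iterComm b r (Units.mk0 w hw0)).val = iterComm b.val r w := by
      rw [Units.val_iterComm, Units.val_mk0]
    have h1 := hN _ hy b.val (hGK b hb)
    rw [hyv] at h1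
    refine eq_of_one_sub_conjEnd_pow_eq_zero b.ne_zero ?_ ?_ h1
    · simp [iterComm, mul_assoc]
    · exact hEcomm _ (hEW _) _ (hEW _)
  have h1 := conj_eq_of_iterComm_eq_one b.ne_zero (hbK b hb) hw hw0 (hN b hb) r hlast
  simp [hbw] at h1

end

section
variable {D : Type*} [DivisionRing D]

/-- The division subring of elements commuting with every element of `s`. -/
def Subfield.commutant (s : Set D) : Subfield D where
  toSubring := Subring.centralizer s
  inv_mem' x hx := by
    rcases eq_or_ne x 0 with rfl | h0
    · simp
    · intro m hm
      exact Commute.inv_right₀ (hx m hm)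

theorem mem_center_units_iff {s : Dˣ} :
    s ∈ Subgroup.center Dˣ ↔ ∀ d : D, s.val * d = d * s.val := by
  rw [Subgroup.mem_center_iff]
  constructor
  · intro h d
    rcases eq_or_ne d 0 with rfl | hd
    · simp
    · have := congrArg Units.val (h (Units.mk0 d hd))
      simpa using this.symm
  · intro h g
    ext
    simpa using (h g).symm

theorem one_sub_conjEnd_pow_mul_left {g c : D} (hc : g * c = c * g) (k : ℕ) (x : D) :
    ((1 - conjEnd g) ^ k) (c * x) = c * ((1 - conjEnd g) ^ k) x := by
  induction k with
  | zero => rfl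
  | succ k ih =>
    rw [one_sub_conjEnd_pow_succ, one_sub_conjEnd_pow_succ, ih, mul_sub, ← mul_assoc, hc]
    simp only [mul_assoc]

theorem one_sub_conjEnd_pow_mul_right {g c : D} (hc : g * c = c * g) (k : ℕ) (x : D) :
    ((1 - conjEnd g) ^ k) (x * c) = ((1 - conjEnd g) ^ k) x * c := by
  have hc' : c * g⁻¹ = g⁻¹ * c := Commute.inv_right₀ hc.symm
  induction k with
  | zero => rfl
  | succ k ih =>
    rw [one_sub_conjEnd_pow_succ, one_sub_conjEnd_pow_succ, ih, sub_mul]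
    simp only [mul_assoc, hc']

theorem iterComm_zero {g : D} (k : ℕ) : iterComm g k 0 = 0 := by
  induction k with
  | zero => rfl
  | succ k ih => simp [iterComm, ih]

theorem iterComm_commute_of_subnormal {r : ℕ} {G : Subgroup Dˣ} (hG : SubnormalDepth r G)
    {s : D} (hs : ∀ g ∈ G, s * g.val = g.val * s) {b : Dˣ} (hb : b ∈ G) (x : D) :
    s * iterComm b.val r x = iterComm b.val r x * s := by
  rcases eq_or_ne x 0 with rfl | hx
  · simp [iterComm_zero]
  · have := hs _ (hG.iterComm_mem hb (Units.mk0 x hx))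
    rwa [Units.val_iterComm, Units.val_mk0] at this

open Filter

/-- The constant embedding into the ultrapower. -/
noncomputable def constGerm (D : Type*) [DivisionRing D] :
    D →+* Germ (hyperfilter ℕ : Filter ℕ) D :=
  (Germ.coeRingHom _).comp (Pi.constRingHom ℕ D)

theorem constGerm_apply (x : D) :
    constGerm D x = ((fun _ => x : ℕ → D) : Germ (hyperfilter ℕ : Filter ℕ) D) := rfl

theorem iterComm_germ (b : D) (f : ℕ → D) (k : ℕ) :
    iterComm (constGerm D b) k (f : Germ (hyperfilter ℕ : Filter ℕ) D) =
      ((fun i => iterComm b k (f i) : ℕ → D) : Germ (hyperfilter ℕ : Filter ℕ) D) := by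
  induction k with
  | zero => rfl
  | succ k ih => rw [iterComm, ih]; rfl

theorem exists_polynomial_of_mem_bounded (c : ℕ → Subring.center D) (d : ℕ)
    {y : Germ (hyperfilter ℕ : Filter ℕ) D}
    (hy : y ∈ SkewPoly.bounded (constGerm D).fieldRange
      ((fun i => (c i : D) : ℕ → D) : Germ (hyperfilter ℕ : Filter ℕ) D) d) :
    ∃ Y : Subring.center D → D,
      y = ((fun i => Y (c i) : ℕ → D) : Germ (hyperfilter ℕ : Filter ℕ) D) ∧
      ∀ φ : D →ₗ[Subring.center D] Subring.center D, ∃ q : Polynomial (Subring.center D),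
        ∀ x, φ (Y x) = q.eval x := by
  induction d generalizing y with
  | zero =>
    obtain rfl : y = 0 := hy
    exact ⟨fun _ => 0, rfl, fun φ => ⟨0, by simp⟩⟩
  | succ d ih =>
    obtain ⟨_, ⟨m, rfl⟩, y, hy, rfl⟩ := hy
    obtain ⟨Y, rfl, hY⟩ := ih hy
    refine ⟨fun x => m + x • Y x, rfl, fun φ => ?_⟩
    obtain ⟨q, hq⟩ := hY φ
    exact ⟨Polynomial.C (φ m) + Polynomial.X * q, fun x => by simp [hq]⟩

theorem transcendental_germ (c : ℕ → Subring.center D) (hc : Function.Injective c) :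
    SkewPoly.Transcendental (constGerm D).fieldRange
      ((fun i => (c i : D) : ℕ → D) : Germ (hyperfilter ℕ : Filter ℕ) D) := by
  have hcomm : ∀ m ∈ (constGerm D).fieldRange,
      ((fun i => (c i : D) : ℕ → D) : Germ (hyperfilter ℕ : Filter ℕ) D) * m =
      m * ((fun i => (c i : D) : ℕ → D) : Germ (hyperfilter ℕ : Filter ℕ) D) := by
    rintro _ ⟨m, rfl⟩
    rw [constGerm_apply, ← Germ.coe_mul, ← Germ.coe_mul]
    congr 1
    funext i
    exact (Subring.mem_center_iff.1 (c i).2 m).symm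
  have hinf : ∀ p : ℕ → Prop, (∀ᶠ i in (hyperfilter ℕ : Filter ℕ), p i) → {i | p i}.Infinite := by
    intro p hp hfin
    exact Filter.notMem_hyperfilter_of_finite hfin hp
  have hne : ((fun i => (c i : D) : ℕ → D) : Germ (hyperfilter ℕ : Filter ℕ) D) ≠ 0 := by
    intro h
    have := hinf _ (Germ.coe_eq.1 h)
    refine this ((Set.finite_singleton (0 : Subring.center D)).preimage hc.injOn |>.subset ?_)
    intro i hi
    exact Subtype.ext hi
  refine ⟨hne, fun m hm => ?_, fun m hm => ?_, ?_⟩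
  · rw [hcomm m hm, mul_inv_cancel_right₀ hne]; exact hm
  · rw [mul_assoc, ← hcomm m hm, inv_mul_cancel_left₀ hne]; exact hm
  · rintro _ ⟨m, rfl⟩ y ⟨d, hy⟩ h
    obtain ⟨Y, rfl, hY⟩ := exists_polynomial_of_mem_bounded c d hy
    have h1 := hinf _ (Germ.coe_eq.1 h)
    have hm : m = 0 := by
      rw [← Module.forall_dual_apply_eq_zero_iff (Subring.center D)]
      intro φ
      obtain ⟨q, hq⟩ := hY φ
      have h2 : Polynomial.C (φ m) + Polynomial.X * q = 0 := by
        apply Polynomial.eq_zero_of_infinite_isRoot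
        refine (h1.image hc.injOn).mono ?_
        rintro _ ⟨i, hi, rfl⟩
        have h3 : m + c i • Y (c i) = 0 := hi
        have := congrArg φ h3
        simpa [hq] using this
      simpa using congrArg (Polynomial.eval 0) h2
    rw [hm, map_zero]

theorem one_sub_conjEnd_pow_commute [Infinite (Subring.center D)] {r : ℕ} {b s y : D}
    (hb0 : b ≠ 0) (hs : ∀ c ∈ Subring.center D,
      s * iterComm b r (1 + c * y) = iterComm b r (1 + c * y) * s) :
    s * ((1 - conjEnd b) ^ r) y = ((1 - conjEnd b) ^ r) y * s := by
  obtain ⟨c, hc⟩ : ∃ c : ℕ → Subring.center D, Function.Injective c :=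
    ⟨_, (Infinite.natEmbedding _).injective⟩
  have h := transcendental_germ c hc
  set t : Germ (hyperfilter ℕ : Filter ℕ) D :=
    ((fun i => (c i : D) : ℕ → D) : Germ (hyperfilter ℕ : Filter ℕ) D) with ht
  have hcomm : ∀ m, constGerm D m * t = t * constGerm D m := by
    intro m
    rw [constGerm_apply, ht, ← Germ.coe_mul, ← Germ.coe_mul]
    congr 1
    funext i
    exact Subring.mem_center_iff.1 (c i).2 m
  have hj := h.jet_iterComm (g := constGerm D b) (by simpa using hb0)
    (hcomm _) (by
      rintro _ ⟨m, rfl⟩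
      exact ⟨b * m * b⁻¹, by simp⟩) (m := constGerm D y) ⟨y, rfl⟩ r
  have hit : constGerm D s * iterComm (constGerm D b) r (1 + t * constGerm D y) =
      iterComm (constGerm D b) r (1 + t * constGerm D y) * constGerm D s := by
    have e : 1 + t * constGerm D y = ((fun i => 1 + c i * y : ℕ → D) : Germ (hyperfilter ℕ : Filter ℕ) D) := rfl
    rw [e, iterComm_germ, constGerm_apply, ← Germ.coe_mul, ← Germ.coe_mul]
    congr 1
    funext i
    exact hs _ (c i).2
  have hv := (h.jet_commute hj ⟨s, rfl⟩ ⟨s, rfl⟩ hit.symm).2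
  have hmap : ∀ k : ℕ, ((1 - conjEnd (constGerm D b)) ^ k) (constGerm D y) =
      constGerm D (((1 - conjEnd b) ^ k) y) := by
    intro k
    induction k with
    | zero => rfl
    | succ k ih => rw [one_sub_conjEnd_pow_succ, one_sub_conjEnd_pow_succ, ih]; simp
  rw [one_sub_conjEnd_pow_mul_left (hcomm _), hmap, mul_assoc, ← mul_assoc (constGerm D s),
    hcomm, mul_assoc t] at hv
  have := mul_left_cancel₀ h.ne_zero hv
  rw [← map_mul, ← map_mul] at this
  exact ((constGerm D).injective this).symm

theorem SubnormalDepth.one_sub_conjEnd_pow_commute [Infinite (Subring.center D)] {r : ℕ}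
    {G : Subgroup Dˣ} (hG : SubnormalDepth r G) {s : D} (hs : ∀ g ∈ G, s * g.val = g.val * s)
    {b : Dˣ} (hb : b ∈ G) (y : D) :
    s * ((1 - conjEnd b.val) ^ r) y = ((1 - conjEnd b.val) ^ r) y * s :=
  _root_.one_sub_conjEnd_pow_commute b.ne_zero fun _ _ => iterComm_commute_of_subnormal hG hs hb _

theorem centralizersCentral_of_infinite_center [Infinite (Subring.center D)] :
    CentralizersCentral Dˣ := by
  intro r G hG hnc s hs
  have hs' : ∀ g ∈ G, s.val * g.val = g.val * s.val := fun g hg => congrArg Units.val (hs g hg)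
  by_contra hsc
  rw [mem_center_units_iff] at hsc
  push Not at hsc
  obtain ⟨d, hd⟩ := hsc
  have hVnil : ∀ g ∈ G, ∀ d, ((1 - conjEnd g.val) ^ r) (s.val * d - d * s.val) = 0 := by
    intro g hg d
    have hgs := (hs' g hg).symm
    rw [map_sub, one_sub_conjEnd_pow_mul_left hgs, one_sub_conjEnd_pow_mul_right hgs,
      hG.one_sub_conjEnd_pow_commute hs' hg, sub_self]
  have hnil : ∀ g ∈ G, ∀ x ∈ Subfield.commutant {s.val}, ((1 - conjEnd g.val) ^ r) x = 0 := by
    intro g hg x hx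
    have hgs : g.val * s = s * g.val := (hs' g hg).symm
    have hgs' : s * g.val⁻¹ = g.val⁻¹ * s.val := Commute.inv_right₀ hgs.symm
    obtain ⟨_, ⟨d, rfl⟩, hv0, hv⟩ := exists_fixed_of_one_sub_conjEnd_pow
      (V := {v | ∃ d, v = s.val * d - d * s.val}) (g := g.val) ⟨d, rfl⟩ (sub_ne_zero.2 hd)
      (by
        rintro _ ⟨d, rfl⟩
        refine ⟨d - g.val * d * g.val⁻¹, ?_⟩
        simp only [mul_sub, sub_mul, mul_assoc]
        rw [← hgs', ← mul_assoc g.val s.val, hgs]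
        simp only [mul_assoc]
        abel) (hVnil g hg d)
    have hx' : s.val * x = x * s.val := hx _ rfl
    have h1 := hVnil g hg (x * d)
    rw [← mul_assoc, hx', mul_assoc, mul_assoc, ← mul_sub, one_sub_conjEnd_pow_mul_right] at h1
    · exact (mul_eq_zero.1 h1).resolve_right hv0
    · rwa [mul_inv_eq_iff_eq_mul₀ g.ne_zero] at hv
  have hGs : ∀ g ∈ G, g.val ∈ Subfield.commutant {s.val} := by
    rintro g hg _ rfl
    exact hs' g hg
  have hcomm := commute_of_unipotent hG hGs hnil
  have hnil' : ∀ g ∈ G, ∀ x ∈ (⊤ : Subfield D), ((1 - conjEnd g.val) ^ (r + 1)) x = 0 := by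
    intro g hg x _
    have := hG.one_sub_conjEnd_pow_commute (fun a ha => hcomm g hg _ (hGs a ha)) hg x
    rw [one_sub_conjEnd_pow_succ, this, mul_inv_cancel_right₀ g.ne_zero, sub_self]
  exact hnc fun g hg => mem_center_units_iff.2 fun d =>
    commute_of_unipotent hG (K := ⊤) (fun _ _ => Subfield.mem_top _) hnil' g hg d
      (Subfield.mem_top _)

end

section
variable {D : Type*} [DivisionRing D]

theorem commute_of_normalizes_of_center_mem [Infinite (Subring.center D)] {m : ℕ}
    {H : Subgroup Dˣ} (hH : SubnormalDepth m H) {L : Subfield D}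
    (hL : ∀ x ∈ L, ∀ y ∈ L, x * y = y * x) (hFL : ∀ x ∈ Subring.center D, x ∈ L)
    (hHL : ∀ h ∈ H, ∀ x ∈ L, h.val * x * h.val⁻¹ ∈ L)
    {n : Dˣ} (hn : n ∈ H) {x : D} (hx : x ∈ L) : n.val * x = x * n.val := by
  by_contra hne
  have hx0 : x ≠ 0 := by rintro rfl; simp at hne
  let N : Subgroup Dˣ := H ⊓ Subgroup.centralizer {y : Dˣ | y.val ∈ L}
  have hN : SubnormalDepth (m + 1) N := by
    refine ⟨H, hH, inf_le_left, fun h hh g hg => ⟨H.mul_mem (H.mul_mem hg hh.1) (H.inv_mem hg), ?_⟩⟩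
    refine Subgroup.mem_centralizer_iff.2 fun y hy => ?_
    have h1 : (g⁻¹ * y * g) * h = h * (g⁻¹ * y * g) := by
      refine Subgroup.mem_centralizer_iff.1 hh.2 _ ?_
      simpa using hHL g⁻¹ (H.inv_mem hg) _ hy
    have h2 := congrArg (fun t => g * t * g⁻¹) h1
    simpa [mul_assoc] using h2
  have hNc : N ≤ Subgroup.center Dˣ := by
    by_contra hnc
    have := centralizersCentral_of_infinite_center _ _ hN hnc (Units.mk0 x hx0) fun g hg =>
      Subgroup.mem_centralizer_iff.1 hg.2 _ hx
    exact hne (mem_center_units_iff.1 this n).symm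
  have hfix : ∀ y ∈ L, n.val * iterComm n.val m y = iterComm n.val m y * n.val := by
    intro y hy
    rcases eq_or_ne y 0 with rfl | hy0
    · simp [iterComm_zero]
    have h1 : (iterComm n m (Units.mk0 y hy0)).val = iterComm n.val m y := by
      rw [Units.val_iterComm, Units.val_mk0]
    have h2 : iterComm n m (Units.mk0 y hy0) ∈ N := by
      refine ⟨hH.iterComm_mem hn _, Subgroup.mem_centralizer_iff.2 fun z hz => Units.ext ?_⟩
      rw [Units.val_mul, Units.val_mul, h1]
      exact hL _ hz _ (Subfield.iterComm_mem (hHL n hn) hy m)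
    rw [← h1]
    exact (mem_center_units_iff.1 (hNc h2) n).symm
  have hnil : ∀ y ∈ L, ((1 - conjEnd n.val) ^ (m + 1)) y = 0 := by
    intro y hy
    have := one_sub_conjEnd_pow_commute (r := m) (y := y) n.ne_zero fun c hc =>
      hfix _ (L.add_mem L.one_mem (L.mul_mem (hFL c hc) hy))
    rw [one_sub_conjEnd_pow_succ, this, mul_inv_cancel_right₀ n.ne_zero, sub_self]
  obtain ⟨w, hw, hnw⟩ := exists_conj_eq_add_one n.ne_zero (hHL n hn) hx
    (fun h => hne (by rwa [mul_inv_eq_iff_eq_mul₀ n.ne_zero] at h)) (hnil x hx)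
  have hw0 : w ≠ 0 := by rintro rfl; simp at hnw
  have h1 := conj_eq_of_iterComm_eq_one n.ne_zero (hHL n hn) hw hw0 hnil m (by
    rw [iterComm, hfix w hw, mul_inv_cancel_right₀ n.ne_zero,
      mul_inv_cancel₀ (iterComm_ne_zero n.ne_zero hw0 m)])
  simp [hnw] at h1

theorem commutant_conj_mem {s : Set D} {h : D} (h0 : h ≠ 0) (hs : ∀ x ∈ s, h⁻¹ * x * h ∈ s) {x : D}
    (hx : x ∈ Subfield.commutant s) : h * x * h⁻¹ ∈ Subfield.commutant s := by
  intro y hy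
  have h2 := congrArg (fun t => h * t * h⁻¹) (hx _ (hs y hy))
  simpa [mul_assoc, h0] using h2

theorem subgroup_commutant_conj_mem {H : Subgroup Dˣ} {s : Set D}
    (hs : ∀ h ∈ H, ∀ x ∈ s, h.val * x * h.val⁻¹ ∈ s) {h : Dˣ} (hh : h ∈ H) {x : D}
    (hx : x ∈ Subfield.commutant s) : h.val * x * h.val⁻¹ ∈ Subfield.commutant s :=
  commutant_conj_mem h.ne_zero (fun y hy => by simpa using hs h⁻¹ (H.inv_mem hh) y hy) hx

theorem commute_of_normalizes_of_infinite_center [Infinite (Subring.center D)] {m : ℕ}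
    {H : Subgroup Dˣ} (hH : SubnormalDepth m H) {L : Subfield D}
    (hL : ∀ x ∈ L, ∀ y ∈ L, x * y = y * x) (hHL : ∀ h ∈ H, ∀ x ∈ L, h.val * x * h.val⁻¹ ∈ L)
    {n : Dˣ} (hn : n ∈ H) {x : D} (hx : x ∈ L) : n.val * x = x * n.val := by
  have hC : ∀ h ∈ H, ∀ x ∈ Subfield.commutant (L : Set D),
      h.val * x * h.val⁻¹ ∈ Subfield.commutant (L : Set D) := fun h hh x hx =>
    subgroup_commutant_conj_mem hHL hh hx
  have hLC : ∀ x ∈ L, x ∈ Subfield.commutant (L : Set D) := fun x hx y hy => hL y hy x hx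
  refine commute_of_normalizes_of_center_mem hH
    (L := Subfield.commutant (Subfield.commutant (L : Set D) : Set D)) ?_ ?_
    (fun h hh x hx => subgroup_commutant_conj_mem hC hh hx) hn ?_
  · intro x hx y hy
    exact hy x fun z hz => hx z (hLC z hz)
  · intro x hx y _
    exact Subring.mem_center_iff.1 hx y
  · intro y hy
    exact (hy x hx).symm

/-- A subnormal subgroup acts trivially on a commutative division subring that it normalizes, as
far as the centralizer of an infinite commuting set sees it. -/
theorem commute_of_normalizes_of_infinite {m : ℕ} {H : Subgroup Dˣ} (hH : SubnormalDepth m H)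
    {L : Subfield D} (hL : ∀ x ∈ L, ∀ y ∈ L, x * y = y * x)
    (hHL : ∀ h ∈ H, ∀ x ∈ L, h.val * x * h.val⁻¹ ∈ L) {n : Dˣ} (hn : n ∈ H)
    {Z : Set D} (hZ : Z.Infinite) (hZZ : ∀ x ∈ Z, ∀ y ∈ Z, x * y = y * x)
    (hZL : ∀ x ∈ Z, ∀ y ∈ L, x * y = y * x) (hZn : ∀ x ∈ Z, x * n.val = n.val * x)
    {x : D} (hx : x ∈ L) : n.val * x = x * n.val := by
  let D₀ := Subfield.commutant Z
  have : Infinite Z := hZ.to_subtype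
  have : Infinite (Subring.center D₀) :=
    Infinite.of_injective (fun z : Z => (⟨⟨z.1, fun y hy => hZZ y hy z z.2⟩,
      Subring.mem_center_iff.2 fun y => Subtype.ext (y.2 z.1 z.2).symm⟩ : Subring.center D₀))
      fun a b hab => Subtype.ext (congrArg (fun t : Subring.center D₀ => t.1.1) hab)
  have hnD : n.val ∈ D₀ := hZn
  let n₀ : D₀ˣ := Units.mk0 ⟨n.val, hnD⟩ fun h => n.ne_zero (congrArg Subtype.val h)
  have hn₀ : Units.map D₀.subtype.toMonoidHom n₀ = n := Units.ext rfl
  have := commute_of_normalizes_of_infinite_center (D := D₀)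
    (hH.comap (Units.map D₀.subtype.toMonoidHom)) (L := L.comap D₀.subtype)
    (fun x hx y hy => Subtype.ext (hL _ hx _ hy))
    (fun h hh x hx => hHL _ hh _ hx) (n := n₀) (by
      rw [Subgroup.mem_comap, hn₀]; exact hn) (x := ⟨x, fun z hz => hZL z hz x hx⟩) hx
  exact congrArg Subtype.val this

end

section FiniteOrder

theorem exists_pow_eq_one_of_finite {G : Type*} [DivisionRing G] {x : G} (hx : x ≠ 0) {S : Set G}
    (hS : S.Finite) (h : ∀ k : ℕ, x ^ k ∈ S) : ∃ N, 0 < N ∧ x ^ N = 1 := by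
  have : Finite S := hS.to_subtype
  obtain ⟨i, j, hne, hij⟩ := Finite.exists_ne_map_eq_of_infinite (fun k : ℕ => (⟨_, h k⟩ : S))
  have hij' : x ^ i = x ^ j := congrArg Subtype.val hij
  wlog hlt : i < j generalizing i j
  · exact this j i hne.symm hij.symm hij'.symm (lt_of_le_of_ne (not_lt.1 hlt) hne.symm)
  refine ⟨j - i, Nat.sub_pos_of_lt hlt, ?_⟩
  have : x ^ i * x ^ (j - i) = x ^ i * 1 := by
    rw [← pow_add, Nat.add_sub_cancel' hlt.le, mul_one, hij']
  exact mul_left_cancel₀ (pow_ne_zero _ hx) this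

/-- Finite submonoids of a division ring of positive characteristic are commutative. -/
theorem Submonoid.commute_of_finite {D : Type*} [DivisionRing D] {p : ℕ} [Fact p.Prime] [CharP D p]
    {S : Submonoid D} (hS : (S : Set D).Finite) {x y : D} (hx : x ∈ S) (hy : y ∈ S) :
    x * y = y * x := by
  let := ZMod.algebra D p
  let A := Algebra.adjoin (ZMod p) (S : Set D)
  have hfin : Module.Finite (ZMod p) A := by
    have h1 : (Subalgebra.toSubmodule A).FG := by
      rw [Algebra.adjoin_eq_span, Submonoid.closure_eq]
      exact Submodule.fg_span hS
    exact Module.Finite.iff_fg.2 h1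
  have : Finite A := Module.finite_of_finite (ZMod p)
  have h := (Finite.isDomain_to_isField A).mul_comm ⟨x, Algebra.subset_adjoin hx⟩
    ⟨y, Algebra.subset_adjoin hy⟩
  exact congrArg Subtype.val h

theorem commute_of_normalizes_finite {D : Type*} [DivisionRing D] {p : ℕ} [Fact p.Prime]
    [CharP D p] {T : Submonoid D} (hT : (T : Set D).Finite) {x : D} {N : ℕ} (hN : 0 < N)
    (hx : x ^ N = 1) (hTx : ∀ t ∈ T, x * t * x⁻¹ ∈ T) {t : D} (ht : t ∈ T) : x * t = t * x := by
  have hx0 : x ≠ 0 := by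
    rintro rfl
    rw [zero_pow hN.ne'] at hx
    exact zero_ne_one hx
  have hTx' : ∀ (k : ℕ), ∀ t ∈ T, ∃ t' ∈ T, x ^ k * t = t' * x ^ k := by
    intro k
    induction k with
    | zero => exact fun t ht => ⟨t, ht, by simp⟩
    | succ k ih =>
      intro t ht
      obtain ⟨t', ht', h⟩ := ih _ (hTx t ht)
      refine ⟨t', ht', ?_⟩
      rw [pow_succ, ← mul_assoc, ← h]
      simp [mul_assoc, hx0]
  let S : Submonoid D :=
    { carrier := {y | ∃ t ∈ T, ∃ k : ℕ, y = t * x ^ k}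
      one_mem' := ⟨1, T.one_mem, 0, by simp⟩
      mul_mem' := by
        rintro _ _ ⟨t, ht, k, rfl⟩ ⟨s, hs, l, rfl⟩
        obtain ⟨s', hs', h⟩ := hTx' k s hs
        refine ⟨t * s', T.mul_mem ht hs', k + l, ?_⟩
        rw [pow_add, mul_assoc, ← mul_assoc (x ^ k), h]
        simp only [mul_assoc] }
  have hS : (S : Set D).Finite := by
    refine (hT.image2 (fun t k => t * x ^ k) (Finset.range N).finite_toSet).subset ?_
    rintro _ ⟨t, ht, k, rfl⟩
    refine ⟨t, ht, k % N, by simpa using Nat.mod_lt _ hN, ?_⟩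
    change t * x ^ (k % N) = t * x ^ k
    rw [← pow_eq_pow_mod k hx]
  exact Submonoid.commute_of_finite (p := p) hS ⟨1, T.one_mem, 1, by simp⟩ ⟨t, ht, 0, by simp⟩

theorem finite_of_finite_fixedPoints {K : Type*} [Field K] (τ : RingAut K) {k : ℕ} (hk : 0 < k)
    (hτ : τ ^ k = 1) (hfix : {x | τ x = x}.Finite) : Finite K := by
  have : Finite (Subgroup.zpowers τ) :=
    (isOfFinOrder_iff_pow_eq_one.2 ⟨k, hk, hτ⟩).finite_zpowers
  have : Finite (FixedPoints.subfield (Subgroup.zpowers τ) K) := by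
    refine (hfix.subset ?_).to_subtype
    intro x hx
    exact hx ⟨τ, Subgroup.mem_zpowers τ⟩
  exact Module.finite_of_finite (FixedPoints.subfield (Subgroup.zpowers τ) K)

end FiniteOrder

namespace SkewPoly

variable {D : Type*} [DivisionRing D] {M : Subfield D} {n : D}

theorem exists_minimal_relation (h : ∃ m ∈ M, ∃ y ∈ poly M n, m + n * y = 0 ∧ m ≠ 0) :
    ∃ d, (∃ m ∈ M, ∃ y ∈ bounded M n d, m + n * y = 0 ∧ m ≠ 0) ∧
      ∀ e < d, ∀ m ∈ M, ∀ y ∈ bounded M n e, m + n * y = 0 → m = 0 := by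
  classical
  have h' : ∃ d, ∃ m ∈ M, ∃ y ∈ bounded M n d, m + n * y = 0 ∧ m ≠ 0 := by
    obtain ⟨m, hm, y, ⟨d, hy⟩, h⟩ := h
    exact ⟨d, m, hm, y, hy, h⟩
  refine ⟨Nat.find h', Nat.find_spec h', fun e he m hm y hy hmy => ?_⟩
  by_contra h0
  exact Nat.find_min h' he ⟨m, hm, y, hy, hmy, h0⟩

theorem bounded_finite (hM : (M : Set D).Finite) (d : ℕ) : (bounded M n d).Finite := by
  induction d with
  | zero => exact Set.finite_singleton 0
  | succ d ih =>
    refine (hM.image2 (fun m y => m + n * y) ih).subset ?_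
    rintro _ ⟨m, hm, y, hy, rfl⟩
    exact ⟨m, hm, y, hy, rfl⟩

theorem exists_pow_commute_of_bounded (h0 : n ≠ 0) (hcomm : ∀ x ∈ M, ∀ y ∈ M, x * y = y * x)
    (hc : ∀ m ∈ M, n * m * n⁻¹ ∈ M) (hc' : ∀ m ∈ M, n⁻¹ * m * n ∈ M) {d : ℕ}
    (hd : ∀ e < d, ∀ m ∈ M, ∀ y ∈ bounded M n e, m + n * y = 0 → m = 0) {y : D}
    (hy : y ∈ bounded M n d) (hy0 : y ≠ 0) {j : ℕ} (hj : 0 < j)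
    (h : ∀ l ∈ M, l * y = y * (n ^ j * l * (n ^ j)⁻¹)) :
    ∃ k, 0 < k ∧ ∀ l ∈ M, n ^ k * l = l * n ^ k := by
  induction d generalizing y j with
  | zero => exact absurd hy hy0
  | succ d ih =>
    obtain ⟨m, hm, y', hy', rfl⟩ := hy
    have hcj : ∀ l ∈ M, n ^ j * l * (n ^ j)⁻¹ ∈ M := by
      intro l hl
      clear h hj
      induction j with
      | zero => simpa using hl
      | succ j ih =>
        have := hc _ ih
        rw [pow_succ', _root_.mul_inv_rev]
        simpa only [mul_assoc] using this
    have key : ∀ l ∈ M, l * m - m * (n ^ j * l * (n ^ j)⁻¹) = 0 ∧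
        n⁻¹ * l * n * y' = y' * (n ^ j * l * (n ^ j)⁻¹) := by
      intro l hl
      have e1 : (l * m - m * (n ^ j * l * (n ^ j)⁻¹)) +
          n * (n⁻¹ * l * n * y' + -(y' * (n ^ j * l * (n ^ j)⁻¹))) = 0 := by
        have h1 := sub_eq_zero.2 (h l hl)
        rw [← h1]
        simp only [mul_add, add_mul, mul_neg, ← mul_assoc, mul_inv_cancel₀ h0, one_mul]
        abel
      have e2 := hd d (Nat.lt_succ_self d) _ (M.sub_mem (M.mul_mem hl hm) (M.mul_mem hm (hcj l hl)))
        _ (bounded_add (bounded_mul_left h0 hc' (hc' l hl) hy')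
          (bounded_neg (bounded_mul_right (hcj l hl) hy'))) e1
      rw [e2, zero_add, mul_eq_zero, or_iff_right h0, ← sub_eq_add_neg, sub_eq_zero] at e1
      exact ⟨e2, e1⟩
    rcases eq_or_ne m 0 with rfl | hm0
    · refine ih (fun e he => hd e (he.trans (Nat.lt_succ_self d))) hy' ?_ (Nat.succ_pos j) ?_
      · rintro rfl
        simp at hy0
      · intro l hl
        have := (key _ (hc l hl)).2
        rw [pow_succ, _root_.mul_inv_rev]
        simpa [mul_assoc, h0] using this
    · refine ⟨j, hj, fun l hl => ?_⟩
      have := (key l hl).1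
      rw [hcomm l hl m hm, ← mul_sub, mul_eq_zero, or_iff_right hm0, sub_eq_zero,
        eq_mul_inv_iff_mul_eq₀ (pow_ne_zero _ h0)] at this
      exact this.symm

theorem bounded_center_of_commute (h0 : n ≠ 0) (hn : ∀ m ∈ M, m * n = n * m) {d : ℕ}
    (hd : ∀ e < d, ∀ m ∈ M, ∀ y ∈ bounded M n e, m + n * y = 0 → m = 0) {y : D}
    (hy : y ∈ bounded M n d) (h : ∀ l ∈ M, l * y = y * l) :
    y ∈ bounded (M ⊓ Subfield.commutant (M : Set D)) n d := by
  have hc' : ∀ m ∈ M, n⁻¹ * m * n ∈ M := by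
    intro m hm
    rw [mul_assoc, hn m hm, inv_mul_cancel_left₀ h0]; exact hm
  induction d generalizing y with
  | zero => exact hy
  | succ d ih =>
    obtain ⟨m, hm, y', hy', rfl⟩ := hy
    have key : ∀ l ∈ M, l * m - m * l = 0 ∧ l * y' = y' * l := by
      intro l hl
      have e1 : (l * m - m * l) + n * (l * y' + -(y' * l)) = 0 := by
        have h1 := sub_eq_zero.2 (h l hl)
        rw [← h1]
        simp only [mul_add, add_mul, mul_neg, ← mul_assoc, hn l hl]
        abel
      have e2 := hd d (Nat.lt_succ_self d) _ (M.sub_mem (M.mul_mem hl hm) (M.mul_mem hm hl))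
        _ (bounded_add (bounded_mul_left h0 hc' hl hy')
          (bounded_neg (bounded_mul_right hl hy'))) e1
      rw [e2, zero_add, mul_eq_zero, or_iff_right h0, ← sub_eq_add_neg, sub_eq_zero] at e1
      exact ⟨e2, e1⟩
    exact ⟨m, ⟨hm, fun l hl => sub_eq_zero.1 (key l hl).1⟩, y',
      ih (fun e he => hd e (he.trans (Nat.lt_succ_self d))) hy' fun l hl => (key l hl).2, rfl⟩

/-- An element commuting with `M` and algebraic over it is a root of unity if the center of `M`
is finite. -/
theorem exists_pow_eq_one_of_relation (h0 : n ≠ 0) (hn : ∀ m ∈ M, m * n = n * m)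
    (hfin : ((M ⊓ Subfield.commutant (M : Set D) : Subfield D) : Set D).Finite)
    (h : ∃ m ∈ M, ∃ y ∈ poly M n, m + n * y = 0 ∧ m ≠ 0) : ∃ N, 0 < N ∧ n ^ N = 1 := by
  obtain ⟨d, ⟨m, hm, y, hy, hmy, hm0⟩, hd⟩ := exists_minimal_relation h
  have hninv : n⁻¹ ∈ bounded M n d := by
    have : n⁻¹ = -(y * m⁻¹) := by
      apply inv_eq_of_mul_eq_one_right
      rw [mul_neg, ← mul_assoc, eq_neg_of_add_eq_zero_right hmy, neg_mul, neg_neg,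
        mul_inv_cancel₀ hm0]
    rw [this]
    exact bounded_neg (bounded_mul_right (M.inv_mem hm) hy)
  have hZ := bounded_center_of_commute h0 hn hd hninv fun l hl => Commute.inv_right₀ (hn l hl)
  obtain ⟨N, hN, hN'⟩ := exists_pow_eq_one_of_finite (inv_ne_zero h0)
    (bounded_finite (n := n) hfin (d + 1)) (fun k => by
      induction k with
      | zero => exact ⟨1, Subfield.one_mem _, 0, bounded_zero_mem d, by simp⟩
      | succ k ih =>
        obtain ⟨m, hm, y, hy, e⟩ := ih
        rw [pow_succ', e, mul_add, inv_mul_cancel_left₀ h0]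
        exact bounded_add (bounded_succ (bounded_mul_right hm hZ)) (bounded_succ hy))
  exact ⟨N, hN, by simpa using hN'⟩

end SkewPoly

section
variable {D : Type*} [DivisionRing D]

theorem conjEnd_pow_apply {n : D} (k : ℕ) (x : D) :
    (conjEnd n ^ k) x = n ^ k * x * (n ^ k)⁻¹ := by
  induction k with
  | zero => simp
  | succ k ih =>
    rw [pow_succ', AddMonoid.End.coe_mul, Function.comp_apply, ih, conjEnd_apply, pow_succ',
      _root_.mul_inv_rev]
    simp only [mul_assoc]

theorem charP_addMonoidEnd (p : ℕ) [CharP D p] : CharP (AddMonoid.End D) p :=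
  charP_of_injective_ringHom (f := Module.toAddMonoidEnd D D)
    (fun a b h => by
      have h1 : a * 1 = b * 1 := DFunLike.congr_fun h 1
      simpa using h1) p

theorem exists_pow_commute_of_normalizes {p : ℕ} [Fact p.Prime] [CharP D p] {m : ℕ}
    {H : Subgroup Dˣ} (hH : SubnormalDepth m H)
    {L : Subfield D} (hL : ∀ x ∈ L, ∀ y ∈ L, x * y = y * x)
    (hHL : ∀ h ∈ H, ∀ x ∈ L, h.val * x * h.val⁻¹ ∈ L) {n : Dˣ} (hn : n ∈ H) :
    ∃ k, 0 < k ∧ ∀ l ∈ L, n.val ^ k * l = l * n.val ^ k := by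
  have h0 := n.ne_zero
  have hc := hHL n hn
  have hc' : ∀ l ∈ L, n.val⁻¹ * l * n.val ∈ L := fun l hl => by
    simpa using hHL n⁻¹ (H.inv_mem hn) l hl
  by_cases ht : ∀ l ∈ L, ∀ y ∈ SkewPoly.poly L n.val, l + n.val * y = 0 → l = 0
  · have h : SkewPoly.Transcendental L n.val := ⟨h0, hc, hc', ht⟩
    by_cases hcomm : ∀ l ∈ L, n.val * l = l * n.val
    · exact ⟨1, one_pos, by simpa using hcomm⟩
    push Not at hcomm
    obtain ⟨z, hz, hnz⟩ := hcomm
    have hnil : ∀ c ∈ L, ((1 - conjEnd n.val) ^ m) c = 0 := by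
      intro c hcL
      by_contra hv0
      have hj := h.jet_iterComm h0 rfl hc hcL m
      have hcn : 1 + n.val * c ≠ 0 := fun he => one_ne_zero
        (ht 1 L.one_mem c (SkewPoly.mem_poly_of_mem hcL) he)
      have hW : iterComm n m (Units.mk0 _ hcn) ∈ H := hH.iterComm_mem hn _
      have hWv : (iterComm n m (Units.mk0 _ hcn)).val = iterComm n.val m (1 + n.val * c) := by
        rw [Units.val_iterComm, Units.val_mk0]
      have hz' := hHL _ hW z hz
      have h1 := (h.jet_commute hj hz hz' (by
        rw [← hWv, inv_mul_cancel_right₀ (Units.ne_zero _)])).2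
      have hmem := Subfield.one_sub_conjEnd_pow_mem hc hcL m
      rw [one_sub_conjEnd_pow_mul_left rfl, mul_assoc, hL _ hmem z hz, ← mul_assoc,
        ← mul_assoc] at h1
      exact hnz (mul_right_cancel₀ hv0 h1)
    have := charP_addMonoidEnd (D := D) p
    refine ⟨p ^ m, pow_pos (Fact.out : p.Prime).pos m, fun l hl => ?_⟩
    have h1 : ((1 - conjEnd n.val) ^ p ^ m) l = 0 := by
      have hle : m ≤ p ^ m := (Nat.lt_pow_self (Fact.out : p.Prime).one_lt).le
      rw [← Nat.sub_add_cancel hle, pow_add, AddMonoid.End.coe_mul, Function.comp_apply,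
        hnil l hl, map_zero]
    rw [sub_pow_char_pow_of_commute p _ (Commute.one_left _), one_pow] at h1
    change l - (conjEnd n.val ^ p ^ m) l = 0 at h1
    rw [conjEnd_pow_apply, sub_eq_zero,
      eq_mul_inv_iff_mul_eq₀ (pow_ne_zero _ h0)] at h1
    exact h1.symm
  · push Not at ht
    obtain ⟨d, ⟨l, hl, y, hy, hly, hl0⟩, hd⟩ := SkewPoly.exists_minimal_relation ht
    have hy' : y = -(n.val⁻¹ * l) := by
      rw [← mul_right_inj' h0, mul_neg, mul_inv_cancel_left₀ h0]
      exact eq_neg_of_add_eq_zero_right hly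
    refine SkewPoly.exists_pow_commute_of_bounded h0 hL hc hc' hd hy ?_ one_pos ?_
    · rw [hy']
      simp [hl0]
    · intro a ha
      rw [hy', pow_one, neg_mul, mul_assoc, hL l hl _ (hc a ha)]
      simp [mul_assoc]

/-- A subnormal subgroup acts trivially on every commutative division subring it normalizes, in
positive characteristic. -/
theorem commute_of_normalizes {p : ℕ} [Fact p.Prime] [CharP D p] {m : ℕ}
    {H : Subgroup Dˣ} (hH : SubnormalDepth m H)
    {L : Subfield D} (hL : ∀ x ∈ L, ∀ y ∈ L, x * y = y * x)
    (hHL : ∀ h ∈ H, ∀ x ∈ L, h.val * x * h.val⁻¹ ∈ L) {n : Dˣ} (hn : n ∈ H) {x : D}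
    (hx : x ∈ L) : n.val * x = x * n.val := by
  obtain ⟨k, hk, hkL⟩ := exists_pow_commute_of_normalizes (p := p) hH hL hHL hn
  have h0 := n.ne_zero
  by_cases hfin : (L : Set D).Finite
  · by_cases hpow : (Set.range fun i : ℕ => (n.val ^ k) ^ i).Finite
    · obtain ⟨N, hN, hN'⟩ := exists_pow_eq_one_of_finite (pow_ne_zero k h0) hpow
        fun i => ⟨i, rfl⟩
      exact commute_of_normalizes_finite (p := p) (T := L.toSubring.toSubmonoid) hfin
        (Nat.mul_pos hk hN) (by rw [pow_mul, hN']) (hHL n hn) hx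
    · refine commute_of_normalizes_of_infinite hH hL hHL hn hpow ?_ ?_ ?_ hx
      · rintro _ ⟨i, rfl⟩ _ ⟨j, rfl⟩
        exact (Commute.refl (n.val ^ k)).pow_pow i j
      · rintro _ ⟨i, rfl⟩ y hy
        exact Commute.pow_left (hkL y hy) i
      · rintro _ ⟨i, rfl⟩
        exact ((Commute.refl n.val).pow_left k).pow_left i
  · let _ : Field L := { (inferInstance : DivisionRing L) with
      mul_comm := fun x y => Subtype.ext (hL x x.2 y y.2) }
    let τ : RingAut L :=
      { toFun := fun y => ⟨n.val * y * n.val⁻¹, hHL n hn y y.2⟩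
        invFun := fun y => ⟨n.val⁻¹ * y * n.val, by
          simpa using hHL n⁻¹ (H.inv_mem hn) y y.2⟩
        left_inv := fun y => Subtype.ext (by simp [mul_assoc])
        right_inv := fun y => Subtype.ext (by simp [mul_assoc])
        map_add' := fun y z => Subtype.ext (by simp [mul_add, add_mul])
        map_mul' := fun y z => Subtype.ext (by simp [mul_assoc]) }
    have hτ : ∀ (i : ℕ) (y : L), ((τ ^ i) y).val = n.val ^ i * y * (n.val ^ i)⁻¹ := by
      intro i y
      induction i with
      | zero => simp
      | succ i ih =>
        rw [pow_succ', RingAut.mul_apply]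
        change n.val * ((τ ^ i) y).val * n.val⁻¹ = _
        rw [ih, pow_succ', _root_.mul_inv_rev]
        simp only [mul_assoc]
    have hτk : τ ^ k = 1 := by
      ext y
      rw [hτ, hkL y y.2, mul_inv_cancel_right₀ (pow_ne_zero k h0)]
      rfl
    have hinf : {y | y ∈ L ∧ n.val * y = y * n.val}.Infinite := by
      intro hf
      have hf' : {y : L | τ y = y}.Finite := by
        refine (hf.preimage Subtype.val_injective.injOn).subset fun y hy => ⟨y.2, ?_⟩
        have h1 : n.val * y * n.val⁻¹ = y := congrArg Subtype.val hy
        rwa [mul_inv_eq_iff_eq_mul₀ h0] at h1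
      have : Finite L := finite_of_finite_fixedPoints τ hk hτk hf'
      exact hfin (Set.toFinite _)
    exact commute_of_normalizes_of_infinite hH hL hHL hn hinf
      (fun x hx y hy => hL x hx.1 y hy.1) (fun x hx y hy => hL x hx.1 y hy)
      (fun x hx => hx.2.symm) hx

/-- Jacobson: a division ring of positive characteristic whose nonzero elements are roots of
unity is commutative. -/
theorem Subfield.commute_of_pow_eq_one {p : ℕ} [Fact p.Prime] [CharP D p] {A : Subfield D}
    (hA : ∀ a ∈ A, a ≠ 0 → ∃ N, 0 < N ∧ a ^ N = 1) {a y : D} (ha : a ∈ A) (hy : y ∈ A) :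
    a * y = y * a := by
  by_contra hne
  have ha0 : a ≠ 0 := by rintro rfl; simp at hne
  have hfo : IsOfFinOrder a := by
    obtain ⟨N, hN, h⟩ := hA a ha ha0
    exact isOfFinOrder_iff_pow_eq_one.2 ⟨N, hN, h⟩
  set N := orderOf a with hNdef
  have hN0 : 0 < N := hfo.orderOf_pos
  have haN : a ^ N = 1 := pow_orderOf_eq_one a
  -- the eigencomponents of `y` under conjugation by `a`
  let c : ℕ → D := fun i => ∑ j ∈ Finset.range N, (a ^ i) ^ j * (a ^ j * y * (a ^ j)⁻¹)
  have hc : ∀ i, a ^ i * (a * c i * a⁻¹) = c i := by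
    intro i
    have h1 : ∀ j, a ^ i * (a * ((a ^ i) ^ j * (a ^ j * y * (a ^ j)⁻¹)) * a⁻¹) =
        (a ^ i) ^ (j + 1) * (a ^ (j + 1) * y * (a ^ (j + 1))⁻¹) := by
      intro j
      have e : a * (a ^ i) ^ j = (a ^ i) ^ j * a :=
        ((Commute.refl a).pow_right i).pow_right j
      rw [← mul_assoc a, e, pow_succ' a j, pow_succ' (a ^ i) j, _root_.mul_inv_rev]
      simp only [mul_assoc]
    change a ^ i * (a * (∑ j ∈ Finset.range N, _) * a⁻¹) = ∑ j ∈ Finset.range N, _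
    rw [Finset.mul_sum, Finset.sum_mul, Finset.mul_sum, Finset.sum_congr rfl fun j _ => h1 j]
    have h2 := Finset.sum_range_succ'
      (fun j => (a ^ i) ^ j * (a ^ j * y * (a ^ j)⁻¹)) N
    rw [Finset.sum_range_succ] at h2
    have h3 : (a ^ i) ^ N = 1 := by rw [← pow_mul, mul_comm, pow_mul, haN, one_pow]
    simp only [h3, haN, pow_zero] at h2
    exact (add_right_cancel h2).symm
  have hcA : ∀ i, c i ∈ A := fun i => A.sum_mem fun j _ =>
    A.mul_mem (pow_mem (pow_mem ha i) j) (A.mul_mem (A.mul_mem (pow_mem ha j) hy)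
      (A.inv_mem (pow_mem ha j)))
  have hsum : ∑ i ∈ Finset.range N, c i = N * y := by
    change ∑ i ∈ Finset.range N, ∑ j ∈ Finset.range N, _ = _
    rw [Finset.sum_comm, Finset.sum_eq_single 0]
    · simp
    · intro j hj hj0
      rw [← Finset.sum_mul]
      have h1 : (1 - a ^ j) * ∑ i ∈ Finset.range N, (a ^ j) ^ i = 0 := by
        rw [mul_neg_geom_sum, ← pow_mul, mul_comm, pow_mul, haN, one_pow, sub_self]
      have h2 : 1 - a ^ j ≠ 0 := fun h => pow_ne_one_of_lt_orderOf hj0 (Finset.mem_range.1 hj)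
        (sub_eq_zero.1 h).symm
      have h3 : ∑ i ∈ Finset.range N, (a ^ i) ^ j = ∑ i ∈ Finset.range N, (a ^ j) ^ i :=
        Finset.sum_congr rfl fun i _ => by rw [← pow_mul, mul_comm, pow_mul]
      rw [h3, (mul_eq_zero.1 h1).resolve_left h2, zero_mul]
    · exact fun h => absurd (Finset.mem_range.2 hN0) h
  have hNp : (N : D) ≠ 0 := by
    intro h
    rw [CharP.cast_eq_zero_iff D p] at h
    obtain ⟨M, hM⟩ := h
    have hM0 : 0 < M := Nat.pos_of_mul_pos_left (hM ▸ hN0)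
    have h1 : (a ^ M - 1) ^ p = 0 := by
      rw [sub_pow_char_of_commute p (Commute.one_right _), ← pow_mul, mul_comm, ← hM,
        haN, one_pow, sub_self]
    have h2 : a ^ M = 1 := sub_eq_zero.1 (eq_zero_of_pow_eq_zero h1)
    have h3 := Nat.le_of_dvd hM0 (orderOf_dvd_of_pow_eq_one h2)
    rw [← hNdef, hM] at h3
    have := (Fact.out : p.Prime).two_le
    nlinarith
  have hex : ∃ i, ¬ a * c i = c i * a := by
    by_contra hall
    push Not at hall
    have h1 : a * (N * y) = N * y * a := by
      rw [← hsum, Finset.mul_sum, Finset.sum_mul]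
      exact Finset.sum_congr rfl fun i _ => hall i
    rw [← mul_assoc, ← (Nat.cast_commute N a).eq, mul_assoc, mul_assoc] at h1
    exact hne (mul_left_cancel₀ hNp h1)
  obtain ⟨i, hi⟩ := hex
  have hci0 : c i ≠ 0 := fun h => hi (by rw [h, mul_zero, zero_mul])
  have hconj : c i * a * (c i)⁻¹ = a ^ (i + 1) := by
    rw [mul_inv_eq_iff_eq_mul₀ hci0]
    conv_lhs => rw [← hc i]
    rw [pow_succ]
    simp [mul_assoc, ha0]
  obtain ⟨K, hK, hcK⟩ := hA _ (hcA i) hci0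
  refine hi (commute_of_normalizes_finite (p := p) (T := Submonoid.powers a) ?_ hK hcK ?_
    (Submonoid.mem_powers a)).symm
  · exact hfo.finite_powers
  · rintro _ ⟨j, rfl⟩
    refine ⟨(i + 1) * j, ?_⟩
    change a ^ ((i + 1) * j) = c i * a ^ j * (c i)⁻¹
    rw [pow_mul, ← hconj]
    exact Units.conj_pow (Units.mk0 _ hci0) a j

end

section
variable {D : Type*} [DivisionRing D]

theorem exists_prime_charP_of_finite_center [Finite (Subring.center D)] :
    ∃ p, Fact p.Prime ∧ CharP D p := by
  obtain ⟨p, hp⟩ := CharP.exists D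
  rcases CharP.char_is_prime_or_zero D p with h | rfl
  · exact ⟨p, ⟨h⟩, hp⟩
  · have := CharP.charP_to_charZero D
    refine (Finite.false (α := ℕ) ?_).elim
    refine Finite.of_injective (fun k : ℕ => (k : Subring.center D)) fun a b h => ?_
    exact Nat.cast_injective (R := D) (by simpa using congrArg Subtype.val h)

theorem centralizersCentral_of_finite_center [Finite (Subring.center D)] :
    CentralizersCentral Dˣ := by
  obtain ⟨p, _, _⟩ := exists_prime_charP_of_finite_center (D := D)
  intro r
  induction r with
  | zero =>
    intro G hG _ s hs
    obtain rfl : G = ⊤ := hG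
    exact Subgroup.mem_center_iff.2 fun g => (hs g trivial).symm
  | succ r ih =>
    intro G hG hnc s hs
    obtain ⟨H, hH, hle, hn⟩ := id hG
    set A : Subfield D := Subfield.commutant (Units.val '' (G : Set Dˣ)) with hA
    set B : Subfield D := Subfield.commutant (A : Set D) with hB
    have hGB : ∀ g ∈ G, g.val ∈ B := fun g hg a ha => (ha _ ⟨g, hg, rfl⟩).symm
    have hHG : ∀ h ∈ H, ∀ x ∈ Units.val '' (G : Set Dˣ),
        h.val * x * h.val⁻¹ ∈ Units.val '' (G : Set Dˣ) := by
      rintro h hh _ ⟨g, hg, rfl⟩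
      exact ⟨_, hn g hg h hh, by simp⟩
    have hHA : ∀ h ∈ H, ∀ x ∈ A, h.val * x * h.val⁻¹ ∈ A := fun h hh x hx =>
      subgroup_commutant_conj_mem hHG hh hx
    have hHB : ∀ h ∈ H, ∀ x ∈ B, h.val * x * h.val⁻¹ ∈ B := fun h hh x hx =>
      subgroup_commutant_conj_mem hHA hh hx
    have hHnc : ¬ H ≤ Subgroup.center Dˣ := fun h => hnc (hle.trans h)
    have hL : ∀ x ∈ A, x ∈ B → ∀ d, x * d = d * x := by
      intro x hxA hxB d
      rcases eq_or_ne x 0 with rfl | hx0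
      · simp
      · refine mem_center_units_iff.1 (ih H hH hHnc (Units.mk0 x hx0) fun h hh => ?_) d
        refine Units.ext (Eq.symm ?_)
        exact commute_of_normalizes (p := p) hH (L := A ⊓ B)
          (fun y hy z hz => hz.2 y hy.1)
          (fun h hh y hy => ⟨hHA h hh y hy.1, hHB h hh y hy.2⟩) hh (x := x) ⟨hxA, hxB⟩
    have hsA : s.val ∈ A := by
      rintro _ ⟨g, hg, rfl⟩
      exact congrArg Units.val (hs g hg).symm
    by_contra hsc
    refine hsc (mem_center_units_iff.2 (hL s.val hsA ?_))
    intro a ha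
    refine Subfield.commute_of_pow_eq_one (p := p) (A := A) (fun α hα hα0 => ?_) ha hsA
    by_contra hroot
    have hαB : ∀ m ∈ B, m * α = α * m := fun m hm => (hm α hα).symm
    have h : SkewPoly.Transcendental B α := by
      refine ⟨hα0, fun m hm => ?_, fun m hm => ?_, ?_⟩
      · rwa [← hαB m hm, mul_inv_cancel_right₀ hα0]
      · rwa [mul_assoc, hαB m hm, inv_mul_cancel_left₀ hα0]
      · by_contra hrel
        push Not at hrel
        refine hroot (SkewPoly.exists_pow_eq_one_of_relation hα0 hαB ?_ hrel)
        refine (Set.toFinite (Subring.center D : Set D)).subset fun x hx => ?_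
        have hxA : x ∈ A := by
          rintro _ ⟨g, hg, rfl⟩
          exact hx.2 _ (hGB g hg)
        exact Subring.mem_center_iff.2 fun d => (hL x hxA hx.1 d).symm
    have hcomm := commute_of_unipotent hG hGB (N := r + 1) fun b hb β hβ => by
      have hbα : b.val * α = α * b.val := hαB _ (hGB b hb)
      have hbB : ∀ m ∈ B, b.val * m * b.val⁻¹ ∈ B := hHB b (hle hb)
      have hne : 1 + α * β ≠ 0 := fun he => one_ne_zero
        (h.eq_zero 1 B.one_mem β (SkewPoly.mem_poly_of_mem hβ) he)
      have hj := h.jet_iterComm b.ne_zero hbα hbB hβ (r + 1)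
      have hmem := hGB _ (hG.iterComm_mem hb (Units.mk0 _ hne))
      rw [Units.val_iterComm, Units.val_mk0] at hmem
      have h0 := h.jet_eq_zero hj hmem
      rw [one_sub_conjEnd_pow_mul_left hbα] at h0
      exact (mul_eq_zero.1 h0).resolve_left hα0
    refine hnc fun g hg => mem_center_units_iff.2 (hL g.val ?_ (hGB g hg))
    rintro _ ⟨k, hk, rfl⟩
    exact hcomm k hk _ (hGB g hg)

theorem centralizersCentral_units_divisionRing : CentralizersCentral Dˣ := by
  rcases finite_or_infinite (Subring.center D) with _ | _
  · exact centralizersCentral_of_finite_center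
  · exact centralizersCentral_of_infinite_center

end

/-- If the norms `g * τ g` of a non-central subnormal subgroup are central, so are all norms. -/
theorem CentralizersCentral.norm_mem_center {Γ : Type*} [Group Γ] (hΓ : CentralizersCentral Γ)
    {τ : Γ → Γ} (hτ : ∀ x y, τ (x * y) = τ y * τ x) {r : ℕ} {G : Subgroup Γ}
    (hG : SubnormalDepth r G) (hnc : ¬ G ≤ Subgroup.center Γ)
    (h : ∀ g ∈ G, g * τ g ∈ Subgroup.center Γ) (x : Γ) : x * τ x ∈ Subgroup.center Γ := by
  have hτ1 : τ 1 = 1 := by simpa using hτ 1 1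
  have hτi : ∀ x, τ x⁻¹ = (τ x)⁻¹ := fun x => by
    rw [eq_inv_iff_mul_eq_one, ← hτ, mul_inv_cancel, hτ1]
  have hconj : ∀ (y z : Γ), z ∈ Subgroup.center Γ → y * z * y⁻¹ = z := fun y z hz => by
    rw [Subgroup.mem_center_iff.1 hz, mul_inv_cancel_right]
  induction r generalizing G with
  | zero =>
    obtain rfl : G = ⊤ := hG
    exact h x trivial
  | succ r ih =>
    obtain ⟨H, hH, hle, hn⟩ := id hG
    refine ih hH (fun hc => hnc (hle.trans hc)) fun y hy => ?_
    have hs : τ y * y ∈ Subgroup.center Γ := by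
      refine hΓ.of_commutators_central hG hnc fun g hg => ?_
      have h1 := h g hg
      have h2 := h _ (hn g hg y hy)
      have h3 := hconj y⁻¹ _ h2
      have h4 := hconj (g * (τ y * y)⁻¹ * g⁻¹) _ h1
      have h5 : y⁻¹ * (y * g * y⁻¹ * τ (y * g * y⁻¹)) * y⁻¹⁻¹ =
          (g * (τ y * y)⁻¹ * g⁻¹) * (g * τ g) * (τ y * y) := by
        rw [hτ, hτ, hτi]; group
      have h6 : g * (τ y * y)⁻¹ * g⁻¹ * (τ y * y) ∈ Subgroup.center Γ := by
        have h7 : (g * (τ y * y)⁻¹ * g⁻¹) * (g * τ g) * (τ y * y) =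
            (g * τ g) * (g * (τ y * y)⁻¹ * g⁻¹ * (τ y * y)) := by
          rw [mul_inv_eq_iff_eq_mul.1 h4]; group
        rw [← Subgroup.mul_mem_cancel_left _ h1, ← h7, ← h5, h3]
        exact h2
      have h8 := hconj (τ y * y) _ h6
      have h9 : τ y * y * (g * (τ y * y)⁻¹ * g⁻¹ * (τ y * y)) * (τ y * y)⁻¹ =
          τ y * y * g * (τ y * y)⁻¹ * g⁻¹ := by group
      rw [← h9, h8]
      exact h6
    have h1 : y * τ y = y * (τ y * y) * y⁻¹ := by group
    rw [h1, hconj y _ hs]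
    exact hs

theorem Subring.exists_mem_center_ne {D : Type*} [DivisionRing D]
    (hF : (4 : Cardinal) ≤ Cardinal.mk (Subring.center D)) :
    ∃ u ∈ Subring.center D, u ≠ 0 ∧ u ≠ 1 ∧ u ≠ -1 := by
  by_contra! hcon
  have h1 : (Subring.center D : Set D) ⊆ {0, 1, -1} := fun u hu => by
    by_cases h0 : u = 0
    · simp [h0]
    · by_cases h1 : u = 1
      · simp [h1]
      · simp [hcon u hu h0 h1]
  have h2 := (hF.trans (Cardinal.mk_le_mk_of_subset h1)).trans Cardinal.mk_insert_le
  have h3 : Cardinal.mk ({1, -1} : Set D) ≤ 2 := by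
    refine Cardinal.mk_insert_le.trans ?_
    rw [Cardinal.mk_singleton, one_add_one_eq_two]
  have h4 := h2.trans (add_le_add_left h3 1)
  norm_num at h4

namespace Matrix
variable {D : Type*} [DivisionRing D] {n : ℕ}

theorem centralizersCentral_units_fin (hF : (4 : Cardinal) ≤ Cardinal.mk (Subring.center D))
    (hn : 0 < n) : CentralizersCentral (Matrix (Fin n) (Fin n) D)ˣ := by
  obtain rfl | h : n = 1 ∨ 1 < n := by omega
  · exact centralizersCentral_units_divisionRing.congr
      (Units.mapEquiv (uniqueRingEquiv (m := Fin 1) (A := D)).toMulEquiv)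
  · have : Nontrivial (Fin n) := Fin.nontrivial_iff_two_le.2 h
    exact centralizersCentral_units (Subring.exists_mem_center_ne hF)

theorem val_mem_center_of_mem_center (hn : 0 < n) {s : (Matrix (Fin n) (Fin n) D)ˣ}
    (hs : s ∈ Subgroup.center (Matrix (Fin n) (Fin n) D)ˣ) :
    s.val ∈ Subring.center (Matrix (Fin n) (Fin n) D) := by
  obtain rfl | h : n = 1 ∨ 1 < n := by omega
  · let e := uniqueRingEquiv (m := Fin 1) (A := D)
    refine Subring.mem_center_iff.2 fun x => ?_
    rcases eq_or_ne x 0 with rfl | hx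
    · simp
    · have hex : e x ≠ 0 := fun h0 => hx (e.injective (h0.trans e.map_zero.symm))
      have h1 := congrArg Units.val (Subgroup.mem_center_iff.1 hs
        ((Units.mapEquiv e.toMulEquiv).symm (Units.mk0 _ hex)))
      have h2 : ((Units.mapEquiv e.toMulEquiv).symm (Units.mk0 _ hex)).val = x :=
        e.symm_apply_apply x
      rwa [Units.val_mul, Units.val_mul, h2] at h1
  · have : Nontrivial (Fin n) := Fin.nontrivial_iff_two_le.2 h
    exact val_mem_center_of_commute_elemUnit fun i j h c => (Subgroup.mem_center_iff.1 hs _).symm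

end Matrix
set_option maxHeartbeats 1000000 in
set_option synthInstance.maxHeartbeats 400000 in
/-- Let `D` be a division ring whose center `F` has at least four
elements, `n` a positive integer, `G` a non-central subnormal subgroup of
`GL_n(D)`, and `σ` an involution of the first kind on `M_n(D)`. Then `g * σ g` is
central for every `g ∈ G` iff `σ` is commuting: `x * σ x = σ x * x` for every
`x ∈ M_n(D)`. -/
theorem norms_central_iff_commuting (D : Type*) [DivisionRing D]
    (hF : (4 : Cardinal) ≤ Cardinal.mk (Subring.center D))
    (n : ℕ) (hn : 0 < n)
    (G : Subgroup (Matrix (Fin n) (Fin n) D)ˣ) (hsub : G.IsSubnormal')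
    (hnc : ¬ G ≤ Subgroup.center (Matrix (Fin n) (Fin n) D)ˣ)
    (σ : Matrix (Fin n) (Fin n) D → Matrix (Fin n) (Fin n) D)
    (hadd : ∀ x y, σ (x + y) = σ x + σ y)
    (hmul : ∀ x y, σ (x * y) = σ y * σ x)
    (hinvo : ∀ x, σ (σ x) = x)
    (hfirst : ∀ x ∈ Subring.center (Matrix (Fin n) (Fin n) D), σ x = x) :
    (∀ g ∈ G, g.val * σ g.val ∈
        Subring.center (Matrix (Fin n) (Fin n) D)) ↔
      (∀ x : Matrix (Fin n) (Fin n) D, x * σ x = σ x * x) := by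
  have : Nonempty (Fin n) := ⟨⟨0, hn⟩⟩
  have hσ1 : σ 1 = 1 := hfirst 1 (Subring.one_mem _)
  refine ⟨fun h => ?_, fun h g _ => norm_central_of_commuting hadd hmul hinvo hfirst h g.val⟩
  let τ : (Matrix (Fin n) (Fin n) D)ˣ → (Matrix (Fin n) (Fin n) D)ˣ := fun g =>
    ⟨σ g.val, σ g⁻¹.val, by rw [← hmul, Units.inv_mul, hσ1], by rw [← hmul, Units.mul_inv, hσ1]⟩
  obtain ⟨r, hr⟩ := hsub.exists_depth
  refine Matrix.commuting_of_units_norm_central hn hadd hmul hσ1 fun g => ?_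
  refine Matrix.val_mem_center_of_mem_center hn (s := g * τ g) ?_
  refine (Matrix.centralizersCentral_units_fin hF hn).norm_mem_center
    (fun x y => Units.ext (hmul x.val y.val)) hr hnc (fun g hg => ?_) g
  exact Subgroup.mem_center_iff.2 fun k => Units.ext (Subring.mem_center_iff.1 (h g hg) k.val)
end

section
/- Let A be an algebra over the field F where F is the center of A, such that every finite subset of A is contained in some F-subalgebra of A that is a simple artinian ring, and let ⋆ be an involution of the first kind on A. If x + x^⋆ ∈ F for every x ∈ A, then either (i) A is commutative (A = F), or A is a quaternion division algebra over F (a division ring with center F and dim_F A = 4), or (ii) there is an F-algebra isomorphism e : A ≅ M_2(F) such that e(x^⋆) = adjugate(e(x)) for every x ∈ A, i.e., ⋆ corresponds to the ordinary symplectic involution on M_2(F). -/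
namespace QuadraticTrace

variable {F A : Type*} [Field F] [Ring A] [Algebra F A]

/-- If `x * y + y * x` lies in `F x + F y + F` with the trace coefficients, then the corner of an
idempotent of trace one is spanned by that idempotent. -/
theorem exists_corner_eq_smul {t : A →ₗ[F] F}
    (hq : ∀ x y : A, ∃ m : F, x * y + y * x = t x • y + t y • x + m • 1)
    {e : A} (he : e * e = e) (hte : t e = 1) (x : A) : ∃ c : F, e * x * e = c • e := by
  obtain ⟨m, hm⟩ := hq e x
  have h := congrArg (fun z => e * z * e) hm
  simp only [mul_add, add_mul, hte, one_smul, mul_smul_comm, smul_mul_assoc, mul_one, he] at h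
  have h1 : e * (e * x) * e = e * x * e := by rw [← mul_assoc, he]
  have h2 : e * (x * e) * e = e * x * e := by rw [mul_assoc, mul_assoc x, he, mul_assoc]
  rw [h1, h2, add_assoc, ← add_smul] at h
  exact ⟨_, add_left_cancel h⟩

/-- A system of `2 × 2` matrix units spanning `A` identifies `A` with `M_2(F)`. -/
theorem exists_algEquiv_matrix_of_units {e f u v : A} (hef : e + f = 1)
    (hee : e * e = e) (hff : f * f = f) (he0 : e ≠ 0) (heu : e * u = u) (huf : u * f = u)
    (hfv : f * v = v) (hve : v * e = v) (huv : u * v = e) (hvu : v * u = f)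
    (hspan : ∀ x : A, ∃ a b c d : F, x = a • e + b • u + c • v + d • f) :
    ∃ φ : Matrix (Fin 2) (Fin 2) F ≃ₐ[F] A,
      ∀ M, φ M = M 0 0 • e + M 0 1 • u + M 1 0 • v + M 1 1 • f := by
  have hef0 : e * f = 0 := by
    rw [← add_sub_cancel_left e f, hef, mul_sub, mul_one, hee, sub_self]
  have hfe0 : f * e = 0 := by
    rw [← add_sub_cancel_left e f, hef, sub_mul, one_mul, hee, sub_self]
  have hue : u * e = 0 := by rw [← huf, mul_assoc, hfe0, mul_zero]
  have hfu : f * u = 0 := by rw [← heu, ← mul_assoc, hfe0, zero_mul]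
  have hvf : v * f = 0 := by rw [← hve, mul_assoc, hef0, mul_zero]
  have hev : e * v = 0 := by rw [← hfv, ← mul_assoc, hef0, zero_mul]
  have huu : u * u = 0 := by nth_rw 2 [← heu]; rw [← mul_assoc, hue, zero_mul]
  have hvv : v * v = 0 := by nth_rw 2 [← hfv]; rw [← mul_assoc, hvf, zero_mul]
  let l : Matrix (Fin 2) (Fin 2) F →ₗ[F] A :=
    { toFun := fun M => M 0 0 • e + M 0 1 • u + M 1 0 • v + M 1 1 • f
      map_add' := fun M N => by simp only [Matrix.add_apply]; module
      map_smul' := fun c M => by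
        simp only [Matrix.smul_apply, smul_eq_mul, RingHom.id_apply]; module }
  let φ : Matrix (Fin 2) (Fin 2) F →ₐ[F] A := AlgHom.ofLinearMap l
    (by simp [l, hef])
    (fun M N => by
      simp only [l, LinearMap.coe_mk, AddHom.coe_mk, Matrix.mul_apply, Fin.sum_univ_two,
        mul_add, add_mul, mul_smul_comm, smul_mul_assoc, hee, hff, heu, huf, hfv, hve, huv, hvu,
        hef0, hfe0, huu, hvv, hue, hfu, hvf, hev, smul_zero]
      module)
  have : Nontrivial A := ⟨e, 0, he0⟩
  have hbij : Function.Bijective φ := by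
    refine ⟨RingHom.injective φ.toRingHom, fun x => ?_⟩
    obtain ⟨a, b, c, d, h⟩ := hspan x
    exact ⟨!![a, b; c, d], by simp [φ, l, h]⟩
  exact ⟨AlgEquiv.ofBijective φ hbij, fun M => rfl⟩

/-- An algebra with center `F`, a nondegenerate quadratic trace and an idempotent of trace one is
a matrix algebra, the trace being the matrix trace. -/
theorem exists_algEquiv_matrix (hcenter : Subalgebra.center F A = ⊥) {t : A →ₗ[F] F}
    (ht1 : t 1 = 2) (hcomm : ∀ x y, t (x * y) = t (y * x))
    (hq : ∀ x y : A, ∃ m : F, x * y + y * x = t x • y + t y • x + m • 1)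
    (hnd : ∀ x : A, x ≠ 0 → ∃ y, t (x * y) ≠ 0)
    {e : A} (hee : e * e = e) (hte : t e = 1) :
    ∃ φ : Matrix (Fin 2) (Fin 2) F ≃ₐ[F] A, ∀ M, t (φ M) = M.trace := by
  obtain ⟨f, hf⟩ : ∃ f, f = 1 - e := ⟨_, rfl⟩
  have hef : e + f = 1 := by rw [hf]; abel
  have hff : f * f = f := by rw [hf]; simp [mul_sub, sub_mul, hee]
  have hef0 : e * f = 0 := by rw [hf]; simp [mul_sub, hee]
  have hfe0 : f * e = 0 := by rw [hf]; simp [sub_mul, hee]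
  have htf : t f = 1 := by rw [hf, map_sub, ht1, hte]; norm_num
  have he0 : e ≠ 0 := by rintro rfl; simp at hte
  have hf0 : f ≠ 0 := by rintro h; simp [h] at htf
  have hdec : ∀ x : A, x = e * x * e + e * x * f + f * x * e + f * x * f := by
    intro x; rw [hf]; noncomm_ring
  have hex : ∃ x, e * x * f ≠ 0 := by
    by_contra! h
    have h' : ∀ x, f * x * e = 0 := by
      intro x
      by_contra hx
      obtain ⟨y, hy⟩ := hnd _ hx
      apply hy
      calc t (f * x * e * y) = t (f * (x * (e * y))) := by simp only [mul_assoc]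
        _ = t (x * (e * y) * f) := hcomm _ _
        _ = t (x * (e * y * f)) := by simp only [mul_assoc]
        _ = 0 := by rw [h, mul_zero, map_zero]
    have hmem : e ∈ Subalgebra.center F A := by
      rw [Subalgebra.mem_center_iff]
      intro x
      have h1 : x * e = e * x * e + f * x * e := by
        rw [mul_assoc, mul_assoc, ← add_mul, hef, one_mul]
      have h2 : e * x = e * x * e + e * x * f := by rw [← mul_add, hef, mul_one]
      rw [h', add_zero] at h1
      rw [h, add_zero] at h2
      exact h1.trans h2.symm
    rw [hcenter, Algebra.mem_bot] at hmem
    obtain ⟨c, hc⟩ := hmem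
    rw [← hc, ← Algebra.smul_def] at hef0
    have hc0 : c = 0 := (smul_eq_zero.mp hef0).resolve_right hf0
    exact he0 (by rw [← hc, hc0, map_zero])
  obtain ⟨x, hx⟩ := hex
  obtain ⟨u, hu⟩ : ∃ u, u = e * x * f := ⟨_, rfl⟩
  have heu : e * u = u := by rw [hu, ← mul_assoc, ← mul_assoc, hee]
  have huf : u * f = u := by rw [hu, mul_assoc, hff]
  obtain ⟨y, hy⟩ := hnd _ hx
  obtain ⟨c, hc⟩ := exists_corner_eq_smul hq hee hte (u * y)
  have hc0 : c ≠ 0 := by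
    rintro rfl
    apply hy
    rw [← hu, ← heu, mul_assoc, ← hee, mul_assoc, hcomm, hc]
    simp
  obtain ⟨v, hv⟩ : ∃ v, v = c⁻¹ • (f * y * e) := ⟨_, rfl⟩
  have hfv : f * v = v := by rw [hv, mul_smul_comm, ← mul_assoc, ← mul_assoc, hff]
  have hve : v * e = v := by rw [hv, smul_mul_assoc, mul_assoc, hee]
  have huv : u * v = e := by
    rw [hv, mul_smul_comm, ← mul_assoc, ← mul_assoc, huf, inv_smul_eq_iff₀ hc0, ← hc,
      ← mul_assoc, heu]
  have hvu : v * u = f := by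
    obtain ⟨d, hd⟩ := exists_corner_eq_smul hq hff htf (v * u)
    rw [← mul_assoc, hfv, mul_assoc, huf] at hd
    have h : d • e = (1 : F) • e := by
      calc d • e = u * (d • f) * v := by rw [mul_smul_comm, huf, smul_mul_assoc, huv]
        _ = (u * v) * (u * v) := by rw [← hd]; simp only [mul_assoc]
        _ = (1 : F) • e := by rw [huv, hee, one_smul]
    rw [hd, smul_left_injective F he0 h, one_smul]
  have hspan : ∀ x : A, ∃ a b c d : F, x = a • e + b • u + c • v + d • f := by
    intro x
    obtain ⟨a, ha⟩ := exists_corner_eq_smul hq hee hte x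
    obtain ⟨d, hd⟩ := exists_corner_eq_smul hq hff htf x
    obtain ⟨b, hb⟩ := exists_corner_eq_smul hq hff htf (v * x)
    obtain ⟨g, hg⟩ := exists_corner_eq_smul hq hff htf (x * u)
    refine ⟨a, b, g, d, ?_⟩
    have h1 : e * x * f = b • u := by
      calc e * x * f = u * (f * (v * x) * f) := by
            rw [← mul_assoc f, hfv, ← mul_assoc, ← mul_assoc, huv]
        _ = b • u := by rw [hb, mul_smul_comm, huf]
    have h2 : f * x * e = g • v := by
      calc f * x * e = (f * (x * u) * f) * v := by
            rw [mul_assoc _ f v, hfv, ← huv]; simp only [mul_assoc]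
        _ = g • v := by rw [hg, smul_mul_assoc, hfv]
    rw [← ha, ← hd, ← h1, ← h2]
    exact hdec x
  obtain ⟨φ, hφ⟩ := exists_algEquiv_matrix_of_units hef hee hff he0 heu huf hfv hve huv hvu hspan
  have htu : t u = 0 := by rw [← heu, hcomm, ← huf, mul_assoc, hfe0, mul_zero, map_zero]
  have htv : t v = 0 := by rw [← hfv, hcomm, ← hve, mul_assoc, hef0, mul_zero, map_zero]
  refine ⟨φ, fun M => ?_⟩
  simp [hφ, hte, htf, htu, htv, Matrix.trace_fin_two]

/-- A division algebra with a quadratic trace, having noncommuting elements `a` and `b` such that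
the involution `x ↦ t x - x` moves `a`, has dimension four. -/
theorem finrank_eq_four {t : A →ₗ[F] F}
    (hq : ∀ x y : A, ∃ m : F, x * y + y * x = t x • y + t y • x + m • 1)
    (hn : ∀ x : A, ∃ n : F, x * x = t x • x - n • 1)
    (hinv : ∀ x : A, x ≠ 0 → IsUnit x)
    {a b : A} (hab : a * b ≠ b * a) (ha : (2 : F) • a - t a • 1 ≠ 0) :
    Module.finrank F A = 4 := by
  have hcancel : ∀ x y : A, x ≠ 0 → x * y = 0 → y = 0 := fun x y hx h =>
    (hinv x hx).mul_right_eq_zero.mp h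
  obtain ⟨s, hs⟩ : ∃ s, s = (2 : F) • a - t a • 1 := ⟨_, rfl⟩
  rw [← hs] at ha
  obtain ⟨n, hna⟩ := hn a
  have hsa : s * a = t a • a - (2 * n) • 1 := by
    rw [hs, sub_mul, smul_mul_assoc, smul_mul_assoc, one_mul, hna]; module
  have has : a * s = s * a := by
    rw [hs, mul_sub, sub_mul]; simp
  obtain ⟨D, hD⟩ : ∃ D : F, s * s = D • 1 := by
    refine ⟨t a * t a - 4 * n, ?_⟩
    nth_rw 2 [hs]
    rw [mul_sub, mul_smul_comm, mul_smul_comm, mul_one, hsa, hs]; module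
  have hD0 : D ≠ 0 := by
    rintro rfl
    exact ha (hcancel s s ha (by rw [hD, zero_smul]))
  have hcent : ∀ c : A, a * c = c * a → ∃ p q : F, c = p • 1 + q • a := by
    intro c hc
    obtain ⟨m, hm⟩ := hq a c
    have hsc : s * c = t c • a + m • 1 := by
      rw [← hc] at hm
      rw [hs, sub_mul, smul_mul_assoc, smul_mul_assoc, one_mul, two_smul, hm]; module
    have h : D • c = s * (t c • a + m • 1) := by
      rw [← hsc, ← mul_assoc, hD, smul_mul_assoc, one_mul]
    rw [mul_add, mul_smul_comm, hsa, mul_smul_comm, mul_one, hs] at h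
    refine ⟨D⁻¹ * (-(t c * (2 * n)) - m * t a), D⁻¹ * (t c * t a + 2 * m), ?_⟩
    calc c = D⁻¹ • D • c := (inv_smul_smul₀ hD0 c).symm
      _ = _ := by rw [h]; module
  have hskew : ∀ x : A, (a * x - x * a) * a = t a • (a * x - x * a) - a * (a * x - x * a) := by
    intro x
    have h1 : a * (a * x) = t a • (a * x) - n • x := by
      rw [← mul_assoc, hna, sub_mul]; simp
    have h2 : x * a * a = t a • (x * a) - n • x := by
      rw [mul_assoc, hna, mul_sub]; simp
    rw [sub_mul, mul_sub, h1, h2, mul_assoc]; module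
  obtain ⟨d, hd⟩ : ∃ d, d = a * b - b * a := ⟨_, rfl⟩
  have hd0 : d ≠ 0 := by rw [hd]; exact sub_ne_zero.mpr hab
  have hda : d * a = t a • d - a * d := by rw [hd]; exact hskew b
  have hcomm : ∀ k : A, a * k = k * a → a * (d * k) - d * k * a = -(d * (s * k)) := by
    intro k hk
    have h : a * d = t a • d - d * a := by rw [hda]; abel
    rw [← mul_assoc, h, mul_assoc d k, ← hk, hs, sub_mul, sub_mul, mul_sub, smul_mul_assoc,
      smul_mul_assoc, smul_mul_assoc, one_mul, mul_smul_comm, mul_smul_comm, mul_assoc]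
    module
  have hfree : ∀ p q : F, p • (1 : A) + q • a = 0 → p = 0 ∧ q = 0 := by
    intro p q h
    have hqd : q • d = 0 := by
      have h' : (p • (1 : A) + q • a) * b - b * (p • (1 : A) + q • a) = 0 := by
        rw [h, zero_mul, mul_zero, sub_zero]
      rw [← h', hd, add_mul, mul_add]
      simp only [smul_mul_assoc, mul_smul_comm, one_mul, mul_one]
      module
    have hq0 : q = 0 := (smul_eq_zero.mp hqd).resolve_right hd0
    rw [hq0, zero_smul, add_zero] at h
    have h1 : (1 : A) ≠ 0 := fun h1 => hd0 (by rw [← mul_one d, h1, mul_zero])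
    exact ⟨(smul_eq_zero.mp h).resolve_right h1, hq0⟩
  have hli : LinearIndependent F ![1, a, d, d * a] := by
    rw [Fintype.linearIndependent_iff]
    intro g hg
    simp only [Fin.sum_univ_four, Matrix.cons_val] at hg
    obtain ⟨k, hk⟩ : ∃ k : A, k = g 2 • 1 + g 3 • a := ⟨_, rfl⟩
    have hka : a * k = k * a := by rw [hk, mul_add, add_mul]; simp
    have hg' : (g 0 • (1 : A) + g 1 • a) + d * k = 0 := by
      rw [← hg, hk, mul_add, mul_smul_comm, mul_smul_comm, mul_one]; abel
    have hdk : d * (s * k) = 0 := by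
      rw [← neg_eq_zero, ← hcomm k hka, ← neg_eq_of_add_eq_zero_right hg', mul_neg, neg_mul,
        mul_add, add_mul]
      simp
    have hk0 : k = 0 := hcancel s k ha (hcancel d _ hd0 hdk)
    rw [hk0, mul_zero, add_zero] at hg'
    obtain ⟨h0, h1⟩ := hfree _ _ hg'
    obtain ⟨h2, h3⟩ := hfree _ _ (hk.symm.trans hk0)
    intro i
    fin_cases i
    exacts [h0, h1, h2, h3]
  have hspan : ⊤ ≤ Submodule.span F (Set.range ![1, a, d, d * a]) := by
    intro x _
    obtain ⟨w, hw⟩ := (hinv d hd0).exists_right_inv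
    obtain ⟨y, hy⟩ : ∃ y, y = a * x - x * a := ⟨_, rfl⟩
    have hya : y * a = t a • y - a * y := by rw [hy]; exact hskew x
    have hdk : d * (w * y) = y := by rw [← mul_assoc, hw, one_mul]
    have hk : a * (w * y) = w * y * a := by
      rw [← sub_eq_zero]
      apply hcancel d _ hd0
      rw [mul_sub, ← mul_assoc, ← mul_assoc d (w * y), hda, hdk, hya, sub_mul, smul_mul_assoc,
        mul_assoc a, hdk, sub_self]
    obtain ⟨k, hkdef⟩ : ∃ k, k = w * y := ⟨_, rfl⟩
    rw [← hkdef] at hdk hk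
    have hk' : a * (-D⁻¹ • (s * k)) = (-D⁻¹ • (s * k)) * a := by
      rw [mul_smul_comm, smul_mul_assoc, ← mul_assoc, has, mul_assoc, hk, mul_assoc]
    have hx : a * (x - d * (-D⁻¹ • (s * k))) = (x - d * (-D⁻¹ • (s * k))) * a := by
      have h := hcomm _ hk'
      rw [mul_smul_comm _ s, ← mul_assoc s, hD, smul_mul_assoc, one_mul, smul_smul,
        neg_mul, inv_mul_cancel₀ hD0, neg_one_smul, mul_neg, neg_neg, hdk, hy] at h
      rw [mul_sub, sub_mul, sub_eq_sub_iff_sub_eq_sub, h]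
    obtain ⟨p, q, h1⟩ := hcent _ hx
    obtain ⟨p', q', h2⟩ := hcent _ hk'
    rw [h2, sub_eq_iff_eq_add, mul_add, mul_smul_comm, mul_smul_comm, mul_one] at h1
    rw [h1]
    have hmem : ∀ i, ![1, a, d, d * a] i ∈ Submodule.span F (Set.range ![1, a, d, d * a]) :=
      fun i => Submodule.subset_span ⟨i, rfl⟩
    exact add_mem (add_mem (Submodule.smul_mem _ _ (hmem 0)) (Submodule.smul_mem _ _ (hmem 1)))
      (add_mem (Submodule.smul_mem _ _ (hmem 2)) (Submodule.smul_mem _ _ (hmem 3)))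
  rw [Module.finrank_eq_card_basis (Module.Basis.mk hli hspan), Fintype.card_fin]

/-- The trace of an almost locally simple algebra is nondegenerate: an element orthogonal to the
whole algebra generates a proper ideal in each of the simple subalgebras containing it. -/
theorem exists_trace_mul_ne_zero
    (hloc : ∀ S : Finset A, ∃ B : Subalgebra F A,
      (S : Set A) ⊆ (B : Set A) ∧ IsSimpleRing B ∧ IsArtinianRing B)
    {t : A →ₗ[F] F} (hcomm : ∀ x y, t (x * y) = t (y * x)) (ht : ∃ z, t z ≠ 0)
    {x : A} (hx : x ≠ 0) : ∃ y, t (x * y) ≠ 0 := by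
  by_contra! h
  obtain ⟨B, hB, hBs, -⟩ := hloc {x}
  have hxB : x ∈ B := hB (by simp)
  let I : TwoSidedIdeal B := TwoSidedIdeal.mk' {r : B | ∀ y : A, t (r * y) = 0}
    (fun y => by simp)
    (fun {r r'} hr hr' y => by
      simp only [Set.mem_ofPred_eq] at hr hr'
      simp [add_mul, hr, hr'])
    (fun {r} hr y => by
      simp only [Set.mem_ofPred_eq] at hr
      simp [hr])
    (fun {r r'} hr y => by
      simp only [Set.mem_ofPred_eq] at hr
      rw [MulMemClass.coe_mul, mul_assoc, hcomm, mul_assoc, hr])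
    (fun {r r'} hr y => by
      simp only [Set.mem_ofPred_eq] at hr
      rw [MulMemClass.coe_mul, mul_assoc, hr])
  have hI : ∀ r : B, r ∈ I ↔ ∀ y : A, t (r * y) = 0 := fun r => by
    simp [I, TwoSidedIdeal.mem_mk']
  have hxI : (⟨x, hxB⟩ : B) ∈ I := (hI _).mpr h
  have hItop : I = ⊤ := by
    rcases hBs.simple.eq_bot_or_eq_top I with h0 | h1
    · rw [h0, TwoSidedIdeal.mem_bot] at hxI
      exact absurd (congrArg Subtype.val hxI) hx
    · exact h1
  obtain ⟨z, hz⟩ := ht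
  have h1 : (1 : B) ∈ I := by rw [hItop]; trivial
  exact hz (by simpa using (hI 1).mp h1 z)

end QuadraticTrace


/-- Let `A` be an algebra over a field `F` with `F` the center of `A`,
such that every finite subset of `A` is contained in an `F`-subalgebra of `A` that
is a simple artinian ring (almost locally simple artinian), and let `σ` be an
involution of the first kind on `A`. If `x + σ x ∈ F` for every `x ∈ A`, then
either (i) `A` is commutative, or `A` is a quaternion division algebra over `F`
(a division ring with center `F` and `dim_F A = 4`), or (ii) there is an
`F`-algebra isomorphism `e : A ≃ M_2(F)` with `e (σ x) = adjugate (e x)` for all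
`x`, i.e. `σ` corresponds to the ordinary symplectic involution. -/
theorem almost_locally_simple_artinian_symplectic (F A : Type*) [Field F] [Ring A]
    [Algebra F A]
    (hcenter : Subalgebra.center F A = ⊥)
    (hloc : ∀ S : Finset A, ∃ B : Subalgebra F A,
      (S : Set A) ⊆ (B : Set A) ∧ IsSimpleRing B ∧ IsArtinianRing B)
    (σ : A → A)
    (hadd : ∀ x y : A, σ (x + y) = σ x + σ y)
    (hmul : ∀ x y : A, σ (x * y) = σ y * σ x)
    (hinvo : ∀ x : A, σ (σ x) = x)
    (hfirst : ∀ x ∈ Subring.center A, σ x = x)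
    (htr : ∀ x : A, x + σ x ∈ (⊥ : Subalgebra F A)) :
    ((∀ x y : A, x * y = y * x) ∨
      ((∀ x : A, x ≠ 0 → IsUnit x) ∧ Module.finrank F A = 4)) ∨
    (∃ e : A ≃ₐ[F] Matrix (Fin 2) (Fin 2) F,
      ∀ x : A, e (σ x) = Matrix.adjugate (e x)) := by
  by_cases hc : ∀ x y : A, x * y = y * x
  · exact Or.inl (Or.inl hc)
  have hnt : Nontrivial A := by
    by_contra h
    rw [not_nontrivial_iff_subsingleton] at h
    exact hc fun x y => Subsingleton.elim _ _
  have hinj : Function.Injective (fun c : F => c • (1 : A)) := smul_left_injective F one_ne_zero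
  have hσF : ∀ c : F, σ (c • 1) = c • 1 := fun c => by
    apply hfirst
    rw [Subring.mem_center_iff]
    intro g; simp
  have hex : ∀ x : A, ∃ c : F, x + σ x = c • 1 := fun x => by
    obtain ⟨c, h⟩ := Algebra.mem_bot.mp (htr x)
    exact ⟨c, by rw [← h, Algebra.algebraMap_eq_smul_one]⟩
  choose t₀ ht₀ using hex
  have hσsmul : ∀ (c : F) (x : A), σ (c • x) = c • σ x := fun c x => by
    have h : c • x = (c • 1) * x := by simp
    rw [h, hmul, hσF]; simp
  let t : A →ₗ[F] F :=
    { toFun := t₀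
      map_add' := fun x y => hinj (by
        change t₀ (x + y) • (1 : A) = (t₀ x + t₀ y) • (1 : A)
        rw [← ht₀, add_smul, ← ht₀, ← ht₀, hadd]; abel)
      map_smul' := fun c x => hinj (by
        change t₀ (c • x) • (1 : A) = (c • t₀ x) • (1 : A)
        rw [← ht₀, smul_assoc, ← ht₀, hσsmul, smul_add]) }
  have ht : ∀ x, x + σ x = t x • 1 := ht₀
  have hσ : ∀ x, σ x = t x • 1 - x := fun x => by rw [← ht]; abel
  have ht1 : t 1 = 2 := hinj (by
    change t 1 • (1 : A) = (2 : F) • (1 : A)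
    have h1 : σ 1 = 1 := by simpa using hσF 1
    rw [← ht, h1, two_smul])
  have hxy : ∀ x y : A, x * y + y * x = t x • y + t y • x + (t (x * y) - t x * t y) • 1 := by
    intro x y
    have h := ht (x * y)
    rw [hmul, hσ x, hσ y, sub_mul, mul_sub, mul_sub] at h
    simp only [smul_mul_assoc, mul_smul_comm, one_mul, mul_one] at h
    rw [sub_smul, ← h]; module
  have hcomm : ∀ x y, t (x * y) = t (y * x) := fun x y => hinj (by
    change t (x * y) • (1 : A) = t (y * x) • (1 : A)
    have h1 := hxy x y
    rw [add_comm, hxy y x, add_comm (t y • x), mul_comm (t y), sub_smul, sub_smul] at h1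
    exact (sub_left_injective (add_left_cancel h1)).symm)
  have hq : ∀ x y : A, ∃ m : F, x * y + y * x = t x • y + t y • x + m • 1 :=
    fun x y => ⟨_, hxy x y⟩
  have hn : ∀ x : A, ∃ n : F, x * x = t x • x - n • 1 := by
    intro x
    have hmem : t x • x - x * x ∈ Subalgebra.center F A := by
      rw [Subalgebra.mem_center_iff]
      intro y
      obtain ⟨m, hm⟩ := hq x y
      have h1 := congrArg (fun z => x * z) hm
      have h2 := congrArg (fun z => z * x) hm
      simp only [mul_add, add_mul, mul_smul_comm, smul_mul_assoc, mul_one, one_mul] at h1 h2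
      have h3 : x * (x * y) - y * x * x = t x • (x * y) - t x • (y * x) := by
        have h4 : x * (x * y) - y * x * x
            = (x * (x * y) + x * (y * x)) - (x * y * x + y * x * x) := by noncomm_ring
        rw [h4, h1, h2]; abel
      rw [mul_sub, sub_mul, mul_smul_comm, smul_mul_assoc, ← mul_assoc, mul_assoc x x y,
        sub_eq_sub_iff_sub_eq_sub, ← neg_sub, ← h3, neg_sub]
    rw [hcenter, Algebra.mem_bot] at hmem
    obtain ⟨n, h⟩ := hmem
    exact ⟨n, by rw [← Algebra.algebraMap_eq_smul_one, h]; abel⟩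
  have htne : ∃ z, t z ≠ 0 := by
    by_contra! h
    refine hc fun x y => ?_
    have h1 : ∀ x, σ x = -x := fun x => by rw [hσ, h, zero_smul, zero_sub]
    have h2 : ∀ x : A, -x = x := fun x => by
      have h3 : (-1 : A) = 1 := by rw [← h1]; simpa using hσF 1
      rw [← neg_one_mul, h3, one_mul]
    have h3 := hmul x y
    rwa [h1, h1, h1, h2, h2, h2] at h3
  have hnd : ∀ x : A, x ≠ 0 → ∃ y, t (x * y) ≠ 0 := fun x hx =>
    QuadraticTrace.exists_trace_mul_ne_zero hloc hcomm htne hx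
  by_cases hdiv : ∀ x : A, x ≠ 0 → IsUnit x
  · refine Or.inl (Or.inr ⟨hdiv, ?_⟩)
    obtain ⟨a, ha⟩ : ∃ a, σ a ≠ a := by
      by_contra! h
      refine hc fun x y => ?_
      have h1 := hmul x y
      rwa [h, h, h] at h1
    obtain ⟨b, hb⟩ : ∃ b, a * b ≠ b * a := by
      by_contra! h
      exact ha (hfirst a (Subring.mem_center_iff.mpr fun g => (h g).symm))
    refine QuadraticTrace.finrank_eq_four hq hn hdiv hb fun h => ha ?_
    rw [hσ, ← sub_eq_zero, ← neg_eq_zero, ← h]; module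
  · right
    push Not at hdiv
    obtain ⟨x, hx, hxu⟩ := hdiv
    obtain ⟨n, hnx⟩ := hn x
    have hn0 : n = 0 := by
      by_contra hn0
      apply hxu
      have h1 : x * (t x • 1 - x) = n • 1 := by rw [mul_sub, hnx]; simp
      have h2 : (t x • 1 - x) * x = n • 1 := by rw [sub_mul, hnx]; simp
      exact isUnit_iff_exists.mpr ⟨n⁻¹ • (t x • 1 - x),
        by rw [mul_smul_comm, h1, inv_smul_smul₀ hn0],
        by rw [smul_mul_assoc, h2, inv_smul_smul₀ hn0]⟩
    have hxσ : σ x * x = 0 := by rw [hσ, sub_mul, hnx, hn0]; simp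
    obtain ⟨y, hy⟩ := hnd x hx
    have hz : x * y * (x * y) = t (x * y) • (x * y) := by
      have h : σ (x * y) * (x * y) = 0 := by
        rw [hmul, mul_assoc, ← mul_assoc (σ x), hxσ, zero_mul, mul_zero]
      rw [hσ, sub_mul, smul_mul_assoc, one_mul, sub_eq_zero] at h
      exact h.symm
    obtain ⟨φ, hφ⟩ := QuadraticTrace.exists_algEquiv_matrix hcenter ht1 hcomm hq hnd
      (e := (t (x * y))⁻¹ • (x * y))
      (by rw [smul_mul_smul_comm, hz, smul_smul, inv_mul_cancel_right₀ hy])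
      (by rw [map_smul, smul_eq_mul, inv_mul_cancel₀ hy])
    refine ⟨φ.symm, fun x => ?_⟩
    have h := hφ (φ.symm x)
    rw [AlgEquiv.apply_symm_apply] at h
    rw [hσ, map_sub, map_smul, map_one, h, Matrix.adjugate_fin_two]
    ext i j
    fin_cases i <;> fin_cases j <;> simp [Matrix.trace_fin_two]
end
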